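/- arXiv:2505.00799 — 8 statements merged into one kernel-verified Lean document; each statement's English description precedes it below -/
import Mathlib

section
/- Let N ∈ ℕ, let f be a cusp form of weight k ∈ ℕ for Γ₀(N), and let γ = (a b; c d) ∈ Γ₀(N) with c > 0. Then for every ρ ∈ ℂ the integrals ∫₀^∞ f(−d/c + it) t^{ρ−1} dt and ∫₀^∞ f(a/c + it) t^{k−ρ−1} dt converge absolutely, and c^ρ ∫₀^∞ f(−d/c + it) t^{ρ−1} dt = i^{−k} · c^{k−ρ} ∫₀^∞ f(a/c + it) t^{k−ρ−1} dt. (Here complex powers of the positive reals c and t are the standard ones.) -/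
open MeasureTheory Set

lemma aux_conv (f : ℂ → ℂ)
    (hf_hol : DifferentiableOn ℂ f {z : ℂ | 0 < z.im})
    (hf_cusp : ∀ r : ℚ, ∃ δ > (0:ℝ), ∃ M : ℝ, ∀ t : ℝ, 0 < t → t ≤ 1 →
      ‖f ((r : ℂ) + t * Complex.I)‖ ≤ M * Real.exp (-δ / t))
    (hf_inf : ∃ δ > (0:ℝ), ∃ M : ℝ, ∀ z : ℂ, 1 ≤ z.im →
      ‖f z‖ ≤ M * Real.exp (-δ * z.im)) (r : ℚ) (s : ℂ) :
    MellinConvergent (fun t : ℝ => f ((r : ℂ) + t * Complex.I)) s := by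
  apply mellinConvergent_of_isBigO_rpow (a := s.re + 1) (b := s.re - 1)
  · apply ContinuousOn.locallyIntegrableOn _ measurableSet_Ioi
    apply hf_hol.continuousOn.comp (by fun_prop)
    intro t ht
    simpa using ht
  · obtain ⟨δ, hδ, M, h⟩ := hf_inf
    have h1 : (fun t : ℝ => f ((r : ℂ) + t * Complex.I)) =O[Filter.atTop]
        (fun t : ℝ => Real.exp (-δ * t)) := by
      apply Asymptotics.IsBigO.of_bound M
      filter_upwards [Filter.eventually_ge_atTop 1] with t ht
      rw [Real.norm_of_nonneg (Real.exp_pos _).le]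
      simpa using h ((r : ℂ) + t * Complex.I) (by simpa using ht)
    exact h1.trans (isLittleO_exp_neg_mul_rpow_atTop hδ _).isBigO
  · linarith
  · obtain ⟨δ, hδ, M, h⟩ := hf_cusp r
    have h1 : (fun t : ℝ => f ((r : ℂ) + t * Complex.I)) =O[nhdsWithin 0 (Ioi 0)]
        (fun t : ℝ => Real.exp (-δ * t⁻¹)) := by
      apply Asymptotics.IsBigO.of_bound M
      filter_upwards [Ioc_mem_nhdsGT (zero_lt_one (α := ℝ))] with t ht
      rw [Real.norm_of_nonneg (Real.exp_pos _).le]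
      simpa [div_eq_mul_inv] using h t ht.1 ht.2
    refine h1.trans ?_
    have h2 := ((isLittleO_exp_neg_mul_rpow_atTop hδ (s.re - 1)).isBigO).comp_tendsto
      (tendsto_inv_nhdsGT_zero (𝕜 := ℝ))
    refine h2.congr' (by rfl) ?_
    filter_upwards [self_mem_nhdsWithin] with t ht
    simp only [Function.comp]
    rw [Real.inv_rpow (le_of_lt ht), Real.rpow_neg (le_of_lt ht)]
  · linarith

/-- functional equation for the completed twisted `L`-function of an
integer weight cusp form `f` for `Γ₀(N)`.  The cusp form conditions
(holomorphy on `ℍ`, weight-`k` modularity for `Γ₀(N)`, and exponential decay at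
every cusp, i.e. at every rational point and at `i∞`) are given as hypotheses.
For `γ = (a b; c d) ∈ Γ₀(N)` with `c > 0` and every `ρ ∈ ℂ`, both Mellin
integrals converge absolutely and
`c^ρ ∫₀^∞ f(−d/c + it) t^{ρ−1} dt = i^{−k} c^{k−ρ} ∫₀^∞ f(a/c + it) t^{k−ρ−1} dt`. -/
theorem statement1 (N : ℕ) (k : ℕ) (f : ℂ → ℂ)
    (hf_hol : DifferentiableOn ℂ f {z : ℂ | 0 < z.im})
    (hf_mod : ∀ A B C D : ℤ, A * D - B * C = 1 → (N : ℤ) ∣ C →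
      ∀ z : ℂ, 0 < z.im →
        f (((A : ℂ) * z + B) / ((C : ℂ) * z + D)) = ((C : ℂ) * z + D) ^ k * f z)
    (hf_cusp : ∀ r : ℚ, ∃ δ > (0:ℝ), ∃ M : ℝ, ∀ t : ℝ, 0 < t → t ≤ 1 →
      ‖f ((r : ℂ) + t * Complex.I)‖ ≤ M * Real.exp (-δ / t))
    (hf_inf : ∃ δ > (0:ℝ), ∃ M : ℝ, ∀ z : ℂ, 1 ≤ z.im →
      ‖f z‖ ≤ M * Real.exp (-δ * z.im))
    (a b c d : ℤ) (hdet : a * d - b * c = 1) (hNc : (N : ℤ) ∣ c) (hc : 0 < c) :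
    ∀ ρ : ℂ,
      IntegrableOn
        (fun t : ℝ => f (-(d : ℂ) / (c : ℂ) + t * Complex.I) * (t : ℂ) ^ (ρ - 1))
        (Ioi 0) ∧
      IntegrableOn
        (fun t : ℝ => f ((a : ℂ) / (c : ℂ) + t * Complex.I) * (t : ℂ) ^ ((k : ℂ) - ρ - 1))
        (Ioi 0) ∧
      (c : ℂ) ^ ρ *
          ∫ t in Ioi (0:ℝ), f (-(d : ℂ) / (c : ℂ) + t * Complex.I) * (t : ℂ) ^ (ρ - 1) =
        Complex.I ^ (-(k : ℤ)) * (c : ℂ) ^ ((k : ℂ) - ρ) *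
          ∫ t in Ioi (0:ℝ), f ((a : ℂ) / (c : ℂ) + t * Complex.I) * (t : ℂ) ^ ((k : ℂ) - ρ - 1) := by
  intro ρ
  have hc0 : (c : ℂ) ≠ 0 := by exact_mod_cast hc.ne'
  have hcR : (0 : ℝ) < c := by exact_mod_cast hc
  have e1 : ((-(d : ℚ) / c : ℚ) : ℂ) = -(d : ℂ) / (c : ℂ) := by push_cast; rfl
  have e2 : (((a : ℚ) / c : ℚ) : ℂ) = (a : ℂ) / (c : ℂ) := by push_cast; rfl
  have c1 := aux_conv f hf_hol hf_cusp hf_inf (-(d : ℚ) / c) ρ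
  have c2 := aux_conv f hf_hol hf_cusp hf_inf ((a : ℚ) / c) ((k : ℂ) - ρ)
  rw [e1] at c1
  rw [e2] at c2
  refine ⟨?_, ?_, ?_⟩
  · simpa only [MellinConvergent, smul_eq_mul, mul_comm] using c1
  · simpa only [MellinConvergent, smul_eq_mul, mul_comm] using c2
  set G : ℝ → ℂ := fun t => f (-(d : ℂ) / (c : ℂ) + t * Complex.I) with hG
  set F : ℝ → ℂ := fun t => f ((a : ℂ) / (c : ℂ) + t * Complex.I) with hF
  have i1 : (∫ t in Ioi (0:ℝ), f (-(d : ℂ) / (c : ℂ) + t * Complex.I) * (t : ℂ) ^ (ρ - 1))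
      = mellin G ρ := by
    simp only [mellin, smul_eq_mul, mul_comm, hG]
  have i2 : (∫ t in Ioi (0:ℝ), f ((a : ℂ) / (c : ℂ) + t * Complex.I) *
      (t : ℂ) ^ ((k : ℂ) - ρ - 1)) = mellin F (k - ρ) := by
    simp only [mellin, smul_eq_mul, mul_comm, hF]
  rw [i1, i2]
  have key : ∀ t ∈ Ioi (0 : ℝ), G t = ((Complex.I * c) ^ k)⁻¹ *
      ((t : ℂ) ^ (-(k : ℂ)) • F (((c : ℝ) ^ 2 * t)⁻¹)) := by
    intro t ht
    have ht0 : (t : ℂ) ≠ 0 := by exact_mod_cast (ne_of_gt ht)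
    have hdet' : (a : ℂ) * d - b * c = 1 := by exact_mod_cast hdet
    have him : 0 < (-(d : ℂ) / (c : ℂ) + t * Complex.I).im := by
      have : (-(d : ℂ) / (c : ℂ)) = ((-(d : ℝ) / c : ℝ) : ℂ) := by push_cast; rfl
      rw [this]
      simpa using ht
    have h := hf_mod a b c d hdet hNc _ him
    have hden : (c : ℂ) * (-(d : ℂ) / (c : ℂ) + t * Complex.I) + d = Complex.I * c * t := by
      field_simp; ring
    have hI := Complex.I_ne_zero
    have harg : ((a : ℂ) * (-(d : ℂ) / (c : ℂ) + t * Complex.I) + b) / (Complex.I * c * t)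
        = (a : ℂ) / c + ((((c : ℝ) ^ 2 * t)⁻¹ : ℝ) : ℂ) * Complex.I := by
      push_cast
      field_simp
      linear_combination (-1 : ℂ) * hdet' - Complex.I_sq
    rw [hden, harg] at h
    simp only [hF, hG, smul_eq_mul]
    rw [h, Complex.cpow_neg, Complex.cpow_natCast, mul_pow _ (t : ℂ)]
    have : (Complex.I * c) ^ k ≠ 0 := pow_ne_zero _ (mul_ne_zero hI hc0)
    have : (t : ℂ) ^ k ≠ 0 := pow_ne_zero _ ht0
    field_simp
  have m1 : mellin G ρ = mellin (fun t : ℝ => ((Complex.I * c) ^ k)⁻¹ *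
      ((t : ℂ) ^ (-(k : ℂ)) • F (((c : ℝ) ^ 2 * t)⁻¹))) ρ := by
    apply setIntegral_congr_fun measurableSet_Ioi
    intro t ht
    simp only [key t ht]
  have hc2 : (0 : ℝ) < (c : ℝ) ^ 2 := by positivity
  have m2 : mellin G ρ = ((Complex.I * c) ^ k)⁻¹ *
      ((((c : ℝ) ^ 2 : ℝ) : ℂ) ^ (-(ρ + -(k : ℂ))) * mellin F (k - ρ)) := by
    rw [m1]
    have := mellin_const_smul (fun t : ℝ => (t : ℂ) ^ (-(k : ℂ)) • F (((c : ℝ) ^ 2 * t)⁻¹)) ρ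
      (((Complex.I * c) ^ k)⁻¹ : ℂ)
    simp only [smul_eq_mul] at this ⊢
    rw [this]
    have h3 := mellin_cpow_smul (fun t : ℝ => F (((c : ℝ) ^ 2 * t)⁻¹)) ρ (-(k : ℂ))
    simp only [smul_eq_mul] at h3
    rw [h3]
    have h4 := mellin_comp_mul_left (fun t : ℝ => F t⁻¹) (ρ + -(k : ℂ)) hc2
    rw [h4, mellin_comp_inv, smul_eq_mul]
    congr 3
    ring_nf
  rw [m2]
  have p1 : (((c : ℝ) ^ 2 : ℝ) : ℂ) ^ (-(ρ + -(k : ℂ))) = (c : ℂ) ^ ((k : ℂ) - ρ) * (c : ℂ) ^ ((k : ℂ) - ρ) := by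
    rw [show -(ρ + -(k : ℂ)) = (k : ℂ) - ρ by ring, pow_two, Complex.ofReal_mul,
      Complex.mul_cpow_ofReal_nonneg hcR.le hcR.le]
    simp
  have p2 : (c : ℂ) ^ ρ * (c : ℂ) ^ ((k : ℂ) - ρ) = (c : ℂ) ^ k := by
    rw [← Complex.cpow_add _ _ hc0, ← Complex.cpow_natCast]
    congr 1
    ring
  have hck : (c : ℂ) ^ k ≠ 0 := pow_ne_zero _ hc0
  rw [p1, zpow_neg, zpow_natCast, mul_pow, mul_inv]
  calc _ = (Complex.I ^ k)⁻¹ * ((c : ℂ) ^ k)⁻¹ * ((c : ℂ) ^ ρ * (c : ℂ) ^ ((k : ℂ) - ρ)) *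
        (c : ℂ) ^ ((k : ℂ) - ρ) * mellin F (k - ρ) := by ring
    _ = _ := by rw [p2, mul_assoc (Complex.I ^ k)⁻¹, inv_mul_cancel₀ hck, mul_one]
end

section
/- Let ℓ ∈ ℕ with ℓ ≥ 1 and set k = ℓ + 1/2. Let N ∈ ℕ with 4 ∣ N and let γ = (a b; c d) ∈ Γ₀(N) with c > 0 (so d is odd). Let f : ℍ → ℂ be holomorphic and suppose: (i) for all z ∈ ℍ, f((az+b)/(cz+d)) = ε_d^{−2k} (c/d) (cz+d)^k f(z), where (cz+d)^k is the principal branch; (ii) there exist δ, M > 0 such that |f(−d/c + it)| ≤ M e^{−δt} and |f(a/c + it)| ≤ M e^{−δt} for all t ≥ 1/c. Then for every ρ ∈ ℂ both integrals ∫₀^∞ f(−d/c + it) t^{ρ−1} dt and ∫₀^∞ f(a/c + it) t^{k−ρ−1} dt converge absolutely, and c^ρ ∫₀^∞ f(−d/c + it) t^{ρ−1} dt = i^{−k} · ε_d^{2k} · (c/d) · c^{k−ρ} ∫₀^∞ f(a/c + it) t^{k−ρ−1} dt, where i^{−k} = e^{−iπk/2} and powers of the positive reals c, t are the standard ones. 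-/
open MeasureTheory Set

lemma aux_locInt (f : ℂ → ℂ) (hf : DifferentiableOn ℂ f {z : ℂ | 0 < z.im}) (x : ℂ)
    (hx : x.im = 0) (m : ℝ) (hm : 0 < m) :
    LocallyIntegrableOn (fun t : ℝ => f (x + ((m * t : ℝ) : ℂ) * Complex.I)) (Ioi 0) := by
  refine ContinuousOn.locallyIntegrableOn ?_ measurableSet_Ioi
  refine hf.continuousOn.comp (by fun_prop) ?_
  intro t ht
  have ht' : (0:ℝ) < t := ht
  have : 0 < m * t := by positivity
  simpa [hx] using this

lemma aux_bigO (G : ℝ → ℂ) (c : ℝ) (hc : 0 < c) (δ M : ℝ) (hδ : 0 < δ)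
    (h : ∀ t : ℝ, 1 / c ≤ t → ‖G t‖ ≤ M * Real.exp (-δ * t)) (r : ℝ) :
    (fun t : ℝ => G (c⁻¹ * t) - 0) =O[Filter.atTop] (fun t : ℝ => t ^ r) := by
  refine Asymptotics.IsBigO.trans ?_
    (isLittleO_exp_neg_mul_rpow_atTop (a := δ * c⁻¹) (by positivity) r).isBigO
  refine Asymptotics.IsBigO.of_bound M ?_
  filter_upwards [Filter.eventually_ge_atTop 1] with t ht
  have h1 : 1 / c ≤ c⁻¹ * t := by
    rw [one_div]; exact le_mul_of_one_le_right (by positivity) ht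
  have := h _ h1
  rw [sub_zero, Real.norm_of_nonneg (Real.exp_pos _).le]
  convert this using 3
  ring

lemma aux_key (k : ℝ) (t : ℝ) (ht : 0 < t) :
    ((t : ℂ) * Complex.I) ^ (k : ℂ) =
      Complex.exp (Complex.I * Real.pi * k / 2) * ((t ^ k : ℝ) : ℂ) := by
  rw [Complex.ofReal_cpow ht.le, Complex.cpow_def_of_ne_zero (by simp [ht.ne']),
    Complex.cpow_def_of_ne_zero (by simp [ht.ne']), Complex.log_ofReal_mul ht Complex.I_ne_zero,
    Complex.log_I, ← Complex.exp_add, Complex.ofReal_log ht.le]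
  congr 1
  ring

/-- functional equation for the Mellin transform of a half-integer
weight cusp form.  Here `k = ℓ + 1/2`, `ε_d` is `1` or `i` according to
`d ≡ 1, 3 (mod 4)`, and the Kronecker symbol `(c/d)` for `c > 0` and odd `d` is
the Jacobi symbol `J(c | |d|)`.  Hypothesis (i) is slash-invariance of `f` under
`γ` (with the principal branch of `(cz+d)^k`), and (ii) is exponential decay of
`f` along the vertical lines at `−d/c` and `a/c`.  The conclusion: for every
`ρ ∈ ℂ` both integrals converge absolutely and
`c^ρ ∫₀^∞ f(−d/c+it)t^{ρ−1}dt
  = i^{−k} ε_d^{2k} (c/d) c^{k−ρ} ∫₀^∞ f(a/c+it)t^{k−ρ−1}dt`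
where `i^{−k} = e^{−iπk/2}`. -/
theorem statement3 (ℓ : ℕ) (hℓ : 1 ≤ ℓ) (k : ℝ) (hk : k = ℓ + 1/2)
    (N : ℕ) (hN4 : 4 ∣ N)
    (a b c d : ℤ) (hdet : a * d - b * c = 1) (hNc : (N : ℤ) ∣ c) (hc : 0 < c)
    (f : ℂ → ℂ) (hf_hol : DifferentiableOn ℂ f {z : ℂ | 0 < z.im})
    (εd : ℂ) (hεd : εd = if (d : ZMod 4) = 1 then 1 else Complex.I)
    (htrans : ∀ z : ℂ, 0 < z.im →
      f (((a : ℂ) * z + b) / ((c : ℂ) * z + d)) =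
        εd ^ (-(2 * (ℓ : ℤ) + 1)) * (jacobiSym c d.natAbs : ℂ) *
          ((c : ℂ) * z + d) ^ (k : ℂ) * f z)
    (hdecay : ∃ δ > (0:ℝ), ∃ M > (0:ℝ), ∀ t : ℝ, 1 / (c : ℝ) ≤ t →
      ‖f (-(d : ℂ) / (c : ℂ) + t * Complex.I)‖ ≤ M * Real.exp (-δ * t) ∧
      ‖f ((a : ℂ) / (c : ℂ) + t * Complex.I)‖ ≤ M * Real.exp (-δ * t)) :
    ∀ ρ : ℂ,
      IntegrableOn
        (fun t : ℝ => f (-(d : ℂ) / (c : ℂ) + t * Complex.I) * (t : ℂ) ^ (ρ - 1))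
        (Ioi 0) ∧
      IntegrableOn
        (fun t : ℝ => f ((a : ℂ) / (c : ℂ) + t * Complex.I) * (t : ℂ) ^ ((k : ℂ) - ρ - 1))
        (Ioi 0) ∧
      (c : ℂ) ^ ρ *
          ∫ t in Ioi (0:ℝ), f (-(d : ℂ) / (c : ℂ) + t * Complex.I) * (t : ℂ) ^ (ρ - 1) =
        Complex.exp (-Complex.I * Real.pi * k / 2) * εd ^ (2 * ℓ + 1) *
          (jacobiSym c d.natAbs : ℂ) * (c : ℂ) ^ ((k : ℂ) - ρ) *
          ∫ t in Ioi (0:ℝ), f ((a : ℂ) / (c : ℂ) + t * Complex.I) *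
            (t : ℂ) ^ ((k : ℂ) - ρ - 1) := by
  have hcR : (0:ℝ) < (c:ℝ) := by exact_mod_cast hc
  have hcC : (c:ℂ) ≠ 0 := by exact_mod_cast hc.ne'
  have hε0 : εd ≠ 0 := by
    rw [hεd]; split_ifs <;> simp
  have hgcd : c.gcd (d.natAbs : ℤ) = 1 := by
    have h1 : IsCoprime c d := ⟨-b, a, by linarith⟩
    have h2 := Int.isCoprime_iff_gcd_eq_one.mp h1
    rw [Int.gcd, Int.natAbs_natCast]; exact h2
  have hJ : (jacobiSym c d.natAbs : ℂ) * (jacobiSym c d.natAbs : ℂ) = 1 := by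
    have := jacobiSym.sq_one hgcd
    rw [← sq]; exact_mod_cast this
  obtain ⟨δ, hδ, M, hM, hdec⟩ := hdecay
  have hJ0 : (jacobiSym c d.natAbs : ℂ) ≠ 0 := left_ne_zero_of_mul_eq_one hJ
  generalize (jacobiSym c d.natAbs : ℂ) = J at *
  set F : ℝ → ℂ := fun t => f (-(d : ℂ) / (c : ℂ) + t * Complex.I) with hF
  set G : ℝ → ℂ := fun t => f ((a : ℂ) / (c : ℂ) + t * Complex.I) with hG
  have hfeq : ∀ x ∈ Ioi (0:ℝ), G ((c:ℝ)⁻¹ * (1 / x)) =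
      ((εd ^ (-(2 * (ℓ : ℤ) + 1)) * J * Complex.exp (Complex.I * Real.pi * k / 2)) *
        ((x ^ k : ℝ) : ℂ)) • F ((c:ℝ)⁻¹ * x) := by
    intro x hx
    have hx : (0:ℝ) < x := hx
    have hxC : (x:ℂ) ≠ 0 := by exact_mod_cast hx.ne'
    have him : 0 < (-(d : ℂ) / (c : ℂ) + (((c:ℝ)⁻¹ * x : ℝ) : ℂ) * Complex.I).im := by
      have h0 : (-(d : ℂ) / (c : ℂ)).im = 0 := by
        rw [show (-(d : ℂ) / (c : ℂ)) = ((-(d:ℝ) / (c:ℝ) : ℝ) : ℂ) by push_cast; rfl]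
        exact Complex.ofReal_im _
      have : 0 < (c:ℝ)⁻¹ * x := by positivity
      rw [Complex.add_im, h0]
      simpa using this
    have h := htrans _ him
    have e1 : (c : ℂ) * (-(d : ℂ) / (c : ℂ) + (((c:ℝ)⁻¹ * x : ℝ) : ℂ) * Complex.I) + d
        = (x : ℂ) * Complex.I := by
      push_cast; field_simp; ring
    have e2 : ((a : ℂ) * (-(d : ℂ) / (c : ℂ) + (((c:ℝ)⁻¹ * x : ℝ) : ℂ) * Complex.I) + b) /
        ((x : ℂ) * Complex.I) = (a : ℂ) / (c : ℂ) + (((c:ℝ)⁻¹ * (1 / x) : ℝ) : ℂ) * Complex.I := by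
      have hd : (a:ℂ) * d - b * c = 1 := by exact_mod_cast hdet
      rw [div_eq_iff (mul_ne_zero hxC Complex.I_ne_zero)]
      push_cast
      field_simp
      linear_combination (-1 : ℂ) * hd - Complex.I_sq
    rw [e1, e2, aux_key k x hx] at h
    simp only [hF, hG, smul_eq_mul]
    rw [h]; ring
  have ima : ((a : ℂ) / (c : ℂ)).im = 0 := by
    rw [show ((a : ℂ) / (c : ℂ)) = (((a:ℝ) / (c:ℝ) : ℝ) : ℂ) by push_cast; rfl]
    exact Complex.ofReal_im _
  have imd : (-(d : ℂ) / (c : ℂ)).im = 0 := by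
    rw [show (-(d : ℂ) / (c : ℂ)) = ((-(d:ℝ) / (c:ℝ) : ℝ) : ℂ) by push_cast; rfl]
    exact Complex.ofReal_im _
  have hkpos : 0 < k := by rw [hk]; positivity
  have hE0 : εd ^ (-(2 * (ℓ : ℤ) + 1)) * J * Complex.exp (Complex.I * Real.pi * k / 2) ≠ 0 :=
    mul_ne_zero (mul_ne_zero (zpow_ne_zero _ hε0) hJ0) (Complex.exp_ne_zero _)
  let P : WeakFEPair ℂ :=
    { f := fun t => G ((c:ℝ)⁻¹ * t)
      g := fun t => F ((c:ℝ)⁻¹ * t)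
      k := k
      ε := εd ^ (-(2 * (ℓ : ℤ) + 1)) * J * Complex.exp (Complex.I * Real.pi * k / 2)
      f₀ := 0
      g₀ := 0
      hf_int := aux_locInt f hf_hol _ ima _ (by positivity)
      hg_int := aux_locInt f hf_hol _ imd _ (by positivity)
      hk := hkpos
      hε := hE0
      h_feq := hfeq
      hf_top := aux_bigO G c hcR δ M hδ (fun t ht => (hdec t ht).2)
      hg_top := aux_bigO F c hcR δ M hδ (fun t ht => (hdec t ht).1) }
  have hP : IsStrongFEPair P := ⟨rfl, rfl⟩
  have hci : (0:ℝ) < (c:ℝ)⁻¹ := by positivity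
  intro ρ
  have hGm := hP.hasMellin ((k:ℂ) - ρ)
  have hFm := hP.symm.hasMellin ρ
  have hfe := P.functional_equation ρ
  change P.Λ ((k:ℂ) - ρ) = _ at hfe
  rw [← hGm.2, ← hFm.2] at hfe
  have cG : MellinConvergent G ((k:ℂ) - ρ) :=
    (MellinConvergent.comp_mul_left hci).mp hGm.1
  have cF : MellinConvergent F ρ :=
    (MellinConvergent.comp_mul_left hci).mp hFm.1
  change mellin (fun t => G ((c:ℝ)⁻¹ * t)) ((k:ℂ) - ρ) =
    (εd ^ (-(2 * (ℓ : ℤ) + 1)) * J * Complex.exp (Complex.I * Real.pi * k / 2)) •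
    mellin (fun t => F ((c:ℝ)⁻¹ * t)) ρ at hfe
  rw [mellin_comp_mul_left _ _ hci, mellin_comp_mul_left _ _ hci] at hfe
  have hcp : ∀ s : ℂ, (((c:ℝ)⁻¹ : ℝ) : ℂ) ^ (-s) = (c:ℂ) ^ s := by
    intro s
    rw [Complex.ofReal_inv, Complex.inv_cpow_ofReal_nonneg hcR.le, Complex.cpow_neg, inv_inv,
      Complex.ofReal_intCast]
  rw [hcp, hcp] at hfe
  simp only [mellin, MellinConvergent, smul_eq_mul] at hfe cG cF
  have m1 : ∀ t : ℝ, (t:ℂ) ^ (ρ - 1) * F t = F t * (t:ℂ) ^ (ρ - 1) := fun t => mul_comm _ _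
  have m2 : ∀ t : ℝ, (t:ℂ) ^ ((k:ℂ) - ρ - 1) * G t = G t * (t:ℂ) ^ ((k:ℂ) - ρ - 1) :=
    fun t => mul_comm _ _
  simp only [m1, m2] at hfe cG cF
  refine ⟨cF, cG, ?_⟩
  have hexp : Complex.exp (-Complex.I * Real.pi * k / 2) *
      Complex.exp (Complex.I * Real.pi * k / 2) = 1 := by
    rw [← Complex.exp_add, ← Complex.exp_zero]; congr 1; ring
  have hz : εd ^ (2 * ℓ + 1) * εd ^ (-(2 * (ℓ : ℤ) + 1)) = 1 := by
    rw [zpow_neg, show (2 * (ℓ:ℤ) + 1) = ((2 * ℓ + 1 : ℕ) : ℤ) by push_cast; rfl, zpow_natCast]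
    exact mul_inv_cancel₀ (pow_ne_zero _ hε0)
  rw [mul_assoc _ ((c:ℂ) ^ ((k:ℂ) - ρ)), hfe]
  generalize (c:ℂ) ^ ρ * ∫ t in Ioi (0:ℝ), F t * (t:ℂ) ^ (ρ - 1) = X
  generalize Complex.exp (-Complex.I * Real.pi * k / 2) = E1 at *
  generalize Complex.exp (Complex.I * Real.pi * k / 2) = E2 at *
  generalize εd ^ (2 * ℓ + 1) = A at *
  generalize εd ^ (-(2 * (ℓ : ℤ) + 1)) = B at *
  calc X = (E1 * E2) * (A * B) * (J * J) * X := by rw [hexp, hz, hJ]; ring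
    _ = _ := by ring
end

section
/- Let (a_m)_{m≥1} be complex numbers with |a_m| ≤ C·m^σ for some constants C, σ > 0, so that φ(t) := ∑_{m≥1} a_m e^{−mt} converges for every t > 0 and the Dirichlet series L(ρ) := ∑_{m≥1} a_m m^{−ρ} converges absolutely for Re ρ > σ + 1. Suppose there are complex numbers (c_n)_{n≥0} such that φ admits the asymptotic expansion ∑ c_n t^n at 0, i.e. for every N ≥ 1 one has φ(t) − ∑_{n=0}^{N−1} c_n t^n = O(t^N) as t → 0⁺. Then there exists an entire function F : ℂ → ℂ such that F(ρ) = L(ρ) whenever Re ρ > σ + 1, and F(−n) = (−1)^n · n! · c_n for every integer n ≥ 0. -/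
open Filter Topology Asymptotics

noncomputable def zE (n : ℕ) (s : ℂ) : ℂ :=
  (∏ k ∈ Finset.range n, (s + k)) * (Complex.Gamma (s + n + 1))⁻¹

lemma zE_diff (n : ℕ) : Differentiable ℂ (zE n) := by
  unfold zE
  refine Differentiable.mul ?_ ?_
  · exact Differentiable.fun_finsetProd fun k _ => by fun_prop
  · exact Complex.differentiable_one_div_Gamma.comp (f := fun s : ℂ => s + n + 1) (by fun_prop)

lemma zE_prod (n : ℕ) (s : ℂ) :
    (Complex.Gamma s)⁻¹ = (∏ k ∈ Finset.range n, (s + k)) * (Complex.Gamma (s + n))⁻¹ := by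
  induction n with
  | zero => simp
  | succ n ih =>
    rw [ih, Complex.one_div_Gamma_eq_self_mul_one_div_Gamma_add_one (s + n), Finset.prod_range_succ]
    push_cast
    rw [← add_assoc]
    ring

lemma zE_mul (n : ℕ) (s : ℂ) : (s + n) * zE n s = (Complex.Gamma s)⁻¹ := by
  rw [zE_prod (n + 1) s, zE, Finset.prod_range_succ]
  push_cast
  rw [← add_assoc]
  ring

lemma zE_self (n : ℕ) : zE n (-(n : ℂ)) = (-1) ^ n * (n.factorial : ℂ) := by
  have h : ∀ n : ℕ, ∏ k ∈ Finset.range n, (-(n : ℂ) + k) = (-1) ^ n * (n.factorial : ℂ) := by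
    intro n
    induction n with
    | zero => simp
    | succ n ih =>
      rw [Finset.prod_range_succ']
      have : ∀ k ∈ Finset.range n, (-((n + 1 : ℕ) : ℂ) + ((k + 1 : ℕ) : ℂ)) = -(n : ℂ) + k := by
        intro k _
        push_cast
        ring
      rw [Finset.prod_congr rfl this, ih, Nat.factorial_succ]
      push_cast
      ring
  rw [zE, h]
  simp

lemma zE_lt {k n : ℕ} (h : k < n) : zE k (-(n : ℂ)) = 0 := by
  obtain ⟨d, rfl⟩ := Nat.exists_eq_add_of_lt h
  have : (-((k + d + 1 : ℕ) : ℂ) + k + 1) = -(d : ℂ) := by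
    push_cast
    ring
  rw [zE, this, Complex.Gamma_neg_nat_eq_zero]
  simp

noncomputable def zg (φ : ℝ → ℂ) (c : ℕ → ℂ) (N : ℕ) (t : ℝ) : ℂ :=
  φ t - ∑ n ∈ Finset.range N, c n • (Set.indicator (Set.Ioc 0 1) (fun t => (t : ℂ) ^ (n : ℂ)) : ℝ → ℂ) t

section
variable {φ : ℝ → ℂ} {c : ℕ → ℂ}

lemma zg_loc (hcont : ContinuousOn φ (Set.Ioi 0)) (N : ℕ) :
    MeasureTheory.LocallyIntegrableOn (zg φ c N) (Set.Ioi 0) := by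
  have h1 := hcont.locallyIntegrableOn (μ := MeasureTheory.volume) measurableSet_Ioi
  have h2 : ∀ n : ℕ, MeasureTheory.LocallyIntegrable
      (Set.indicator (Set.Ioc 0 1) (fun t => (t : ℂ) ^ (n : ℂ)) : ℝ → ℂ) := by
    intro n
    refine MeasureTheory.LocallyIntegrable.indicator ?_ measurableSet_Ioc
    simp only [Complex.cpow_natCast]
    exact Continuous.locallyIntegrable (by fun_prop)
  have h3 : MeasureTheory.LocallyIntegrable (fun t : ℝ => ∑ n ∈ Finset.range N, c n •
      (Set.indicator (Set.Ioc 0 1) (fun t => (t : ℂ) ^ (n : ℂ)) : ℝ → ℂ) t) := by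
    exact MeasureTheory.locallyIntegrable_finsetSum _ fun n _ => (h2 n).smul (c n)
  exact h1.sub (h3.locallyIntegrableOn _)

lemma zg_top (hdec : φ =O[atTop] fun t => Real.exp (-1 * t)) (N : ℕ) :
    (zg φ c N) =O[atTop] fun t => Real.exp (-1 * t) := by
  refine hdec.congr' ?_ EventuallyEq.rfl
  filter_upwards [eventually_gt_atTop 1] with t ht
  simp [zg, ht]

lemma zg_bot (hasymp : ∀ N : ℕ, 1 ≤ N →
      (fun t : ℝ => φ t - ∑ n ∈ Finset.range N, c n * (t : ℂ) ^ n)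
        =O[𝓝[>] (0:ℝ)] fun t : ℝ => t ^ N) (N : ℕ) :
    (zg φ c N) =O[𝓝[>] 0] (fun t : ℝ => t ^ (-(-(N : ℝ)))) := by
  have h : (fun t : ℝ => φ t - ∑ n ∈ Finset.range N, c n * (t : ℂ) ^ n)
        =O[𝓝[>] (0:ℝ)] fun t : ℝ => t ^ N := by
    rcases Nat.eq_zero_or_pos N with rfl | hN
    · have h1 := hasymp 1 le_rfl
      simp only [Finset.range_one, Finset.sum_singleton, pow_zero, mul_one, pow_one,
        Finset.range_zero, Finset.sum_empty, sub_zero] at h1 ⊢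
      have h2 : (fun t : ℝ => t) =O[𝓝[>] (0:ℝ)] fun _ => (1 : ℝ) := by
        have : Tendsto (fun t : ℝ => t) (𝓝[>] 0) (𝓝 0) := tendsto_id.mono_left nhdsWithin_le_nhds
        exact this.isBigO_one ℝ
      have h3 := (h1.trans h2).add (isBigO_const_const (c 0) (one_ne_zero (α := ℝ)) _)
      simpa using h3
    · exact hasymp N hN
  refine h.congr' ?_ ?_
  · filter_upwards [Ioc_mem_nhdsGT (zero_lt_one (α := ℝ))] with t ht
    simp [zg, Set.indicator_of_mem ht]
  · filter_upwards with t
    simp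

noncomputable def zF (φ : ℝ → ℂ) (c : ℕ → ℂ) (N : ℕ) (s : ℂ) : ℂ :=
  (Complex.Gamma s)⁻¹ * mellin (zg φ c N) s + ∑ n ∈ Finset.range N, c n * zE n s

theorem z_main (hcont : ContinuousOn φ (Set.Ioi 0))
    (hdec : φ =O[atTop] fun t => Real.exp (-1 * t))
    (hasymp : ∀ N : ℕ, 1 ≤ N →
      (fun t : ℝ => φ t - ∑ n ∈ Finset.range N, c n * (t : ℂ) ^ n)
        =O[𝓝[>] (0:ℝ)] fun t : ℝ => t ^ N) :
    ∃ F : ℂ → ℂ, Differentiable ℂ F ∧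
      (∀ s : ℂ, 0 < s.re → F s = (Complex.Gamma s)⁻¹ * mellin φ s) ∧
      ∀ n : ℕ, F (-(n : ℂ)) = (-1) ^ n * (n.factorial : ℂ) * c n := by
  have hstep : ∀ (N : ℕ) (s : ℂ), -(N : ℝ) < s.re → zF φ c (N + 1) s = zF φ c N s := by
    intro N s hs
    have hconv : MellinConvergent (zg φ c N) s := mellinConvergent_of_isBigO_rpow_exp one_pos
      (zg_loc hcont N) (zg_top hdec N) (zg_bot hasymp N) hs
    have hI := hasMellin_cpow_Ioc (N : ℂ) (s := s) (by simp; linarith)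
    have hI2 := hasMellin_const_smul hI.1 (c N)
    have h := (hasMellin_sub hconv hI2.1).2
    have he : zg φ c (N + 1) = fun t => zg φ c N t - c N •
        (Set.indicator (Set.Ioc 0 1) (fun t => (t : ℂ) ^ (N : ℂ)) : ℝ → ℂ) t := by
      funext t
      simp only [zg, Finset.sum_range_succ]
      ring
    have hne : s + N ≠ 0 := by
      intro h0
      have := congrArg Complex.re h0
      simp at this
      linarith
    rw [zF, zF, he, h, hI2.2, hI.2, Finset.sum_range_succ, ← zE_mul N s, smul_eq_mul]
    field_simp
    ring
  have hle : ∀ (N M : ℕ), N ≤ M → ∀ s : ℂ, -(N : ℝ) < s.re → zF φ c M s = zF φ c N s := by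
    intro N M hNM s hs
    induction M, hNM using Nat.le_induction with
    | base => rfl
    | succ M hM ih =>
      rw [hstep M s, ih]
      have : (N : ℝ) ≤ M := by exact_mod_cast hM
      linarith
  have heq : ∀ (N M : ℕ) (s : ℂ), -(N : ℝ) < s.re → -(M : ℝ) < s.re →
      zF φ c M s = zF φ c N s := by
    intro N M s h1 h2
    rcases le_total N M with h | h
    · exact hle N M h s h1
    · exact (hle M N h s h2).symm
  have hex : ∀ s : ℂ, ∃ N : ℕ, -(N : ℝ) < s.re := by
    intro s
    obtain ⟨N, hN⟩ := exists_nat_gt (-s.re)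
    exact ⟨N, by linarith⟩
  choose K hK using hex
  have hF : ∀ (N : ℕ) (s : ℂ), -(N : ℝ) < s.re → zF φ c (K s) s = zF φ c N s :=
    fun N s hs => heq _ _ s hs (hK s)
  refine ⟨fun s => zF φ c (K s) s, ?_, ?_, ?_⟩
  · intro s
    have hd : DifferentiableAt ℂ (zF φ c (K s)) s := by
      unfold zF
      refine DifferentiableAt.add (DifferentiableAt.mul
        (Complex.differentiable_one_div_Gamma s) ?_) ?_
      · exact mellin_differentiableAt_of_isBigO_rpow_exp one_pos
          (zg_loc hcont _) (zg_top hdec _) (zg_bot hasymp _) (hK s)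
      · exact DifferentiableAt.fun_sum fun n _ => ((zE_diff n) s).const_mul _
    refine hd.congr_of_eventuallyEq ?_
    have : ∀ᶠ z : ℂ in 𝓝 s, -(K s : ℝ) < z.re :=
      Complex.continuous_re.continuousAt.eventually (lt_mem_nhds (hK s))
    filter_upwards [this] with z hz
    exact hF _ z hz
  · intro s hs
    have : zg φ c 0 = φ := by
      funext t
      simp [zg]
    simp only [hF 0 s (by simpa using hs)]
    simp [zF, this]
  · intro n
    simp only [hF (n + 1) (-(n : ℂ)) (by simp)]
    rw [zF, Complex.Gamma_neg_nat_eq_zero, Finset.sum_range_succ, zE_self,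
      Finset.sum_eq_zero fun k hk => by rw [zE_lt (Finset.mem_range.1 hk), mul_zero]]
    simp
    ring
end

lemma z_summable (a : ℕ → ℂ) (C σ : ℝ)
    (hbound : ∀ m : ℕ, ‖a (m + 1)‖ ≤ C * ((m + 1 : ℕ) : ℝ) ^ σ) {r : ℝ} (hr : 0 < r) :
    Summable fun m : ℕ => ‖a (m + 1)‖ * Real.exp (-((m + 1 : ℕ) : ℝ) * r) := by
  have h0 := (summable_nat_add_iff 1).2 (Real.summable_pow_mul_exp_neg_nat_mul ⌈σ⌉₊ hr)
  have hC : 0 ≤ C := by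
    have := (norm_nonneg _).trans (hbound 0)
    simpa using this
  refine Summable.of_nonneg_of_le (fun m => by positivity) (fun m => ?_) (h0.mul_left C)
  have h1 : ((m + 1 : ℕ) : ℝ) ^ σ ≤ ((m + 1 : ℕ) : ℝ) ^ ⌈σ⌉₊ := by
    rw [← Real.rpow_natCast]
    exact Real.rpow_le_rpow_of_exponent_le (by simp) (Nat.le_ceil σ)
  have e : Real.exp (-r * ((m + 1 : ℕ) : ℝ)) = Real.exp (-((m + 1 : ℕ) : ℝ) * r) := by ring_nf
  rw [e, ← mul_assoc]
  gcongr
  exact (hbound m).trans (by gcongr)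

lemma z_norm (x : ℂ) (m : ℕ) (t : ℝ) : ‖x * Complex.exp (-((m + 1 : ℕ) : ℂ) * (t : ℂ))‖ =
    ‖x‖ * Real.exp (-((m + 1 : ℕ) : ℝ) * t) := by
  rw [norm_mul, Complex.norm_exp]
  congr 2
  rw [← Complex.ofReal_natCast, ← Complex.ofReal_neg, ← Complex.ofReal_mul, Complex.ofReal_re]

/-- Zagier's asymptotics/analytic-continuation correspondence.
If `|a_m| ≤ C m^σ`, `φ(t) = ∑_{m≥1} a_m e^{−mt}` admits the asymptotic
expansion `∑ c_n tⁿ` as `t → 0⁺`, then the Dirichlet series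
`L(ρ) = ∑ a_m m^{−ρ}` (absolutely convergent for `Re ρ > σ + 1`) extends to an
entire function `F` with `F(−n) = (−1)ⁿ n! c_n` for all `n ≥ 0`. -/
theorem statement4 (a : ℕ → ℂ) (C σ : ℝ) (hC : 0 < C) (hσ : 0 < σ)
    (hbound : ∀ m : ℕ, ‖a (m + 1)‖ ≤ C * ((m + 1 : ℕ) : ℝ) ^ σ)
    (c : ℕ → ℂ)
    (hasymp : ∀ N : ℕ, 1 ≤ N →
      (fun t : ℝ =>
          (∑' m : ℕ, a (m + 1) * Complex.exp (-((m + 1 : ℕ) : ℂ) * (t : ℂ))) -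
            ∑ n ∈ Finset.range N, c n * (t : ℂ) ^ n)
        =O[𝓝[>] (0:ℝ)] fun t : ℝ => t ^ N) :
    ∃ F : ℂ → ℂ, Differentiable ℂ F ∧
      (∀ ρ : ℂ, σ + 1 < ρ.re →
        F ρ = ∑' m : ℕ, a (m + 1) * ((m + 1 : ℕ) : ℂ) ^ (-ρ)) ∧
      ∀ n : ℕ, F (-(n : ℂ)) = (-1) ^ n * (n.factorial : ℂ) * c n := by
  have hcont : ContinuousOn (fun t : ℝ => ∑' m : ℕ, a (m + 1) * Complex.exp (-((m + 1 : ℕ) : ℂ) * (t : ℂ)))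
      (Set.Ioi 0) := by
    intro t ht
    have ht0 : (0 : ℝ) < t := ht
    have hc : ContinuousOn (fun t : ℝ => ∑' m : ℕ, a (m + 1) *
        Complex.exp (-((m + 1 : ℕ) : ℂ) * (t : ℂ))) (Set.Ici (t / 2)) := by
      refine continuousOn_tsum (fun m => by fun_prop)
        (z_summable a C σ hbound (half_pos ht0)) ?_
      intro m x hx
      rw [z_norm]
      have hx' : t / 2 ≤ x := hx
      refine mul_le_mul_of_nonneg_left (Real.exp_le_exp.2 ?_) (norm_nonneg _)
      exact mul_le_mul_of_nonpos_left hx' (neg_nonpos.2 (Nat.cast_nonneg _))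
    exact (hc.continuousAt (Ici_mem_nhds (half_lt_self ht0))).continuousWithinAt
  have hdec : (fun t : ℝ => ∑' m : ℕ, a (m + 1) * Complex.exp (-((m + 1 : ℕ) : ℂ) * (t : ℂ)))
      =O[atTop] fun t : ℝ => Real.exp (-1 * t) := by
    have hS := z_summable a C σ hbound one_pos
    refine IsBigO.of_bound (∑' m : ℕ,
      ‖a (m + 1)‖ * Real.exp (-((m + 1 : ℕ) : ℝ) * 1) * Real.exp 1) ?_
    filter_upwards [eventually_ge_atTop 1] with t ht
    rw [Real.norm_of_nonneg (Real.exp_pos _).le]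
    refine tsum_of_norm_bounded ((hS.mul_right _).hasSum.mul_right _) fun m => ?_
    rw [z_norm, mul_assoc, mul_assoc, ← Real.exp_add, ← Real.exp_add]
    gcongr
    push_cast
    have : (0 : ℝ) ≤ m * (t - 1) := mul_nonneg (by positivity) (by linarith)
    linarith
  obtain ⟨F, hF1, hF2, hF3⟩ := z_main (c := c)
    (φ := fun t : ℝ => ∑' m : ℕ, a (m + 1) * Complex.exp (-((m + 1 : ℕ) : ℂ) * (t : ℂ)))
    hcont hdec hasymp
  · refine ⟨F, hF1, ?_, hF3⟩
    intro s hs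
    have hs0 : 0 < s.re := by linarith
    rw [hF2 s hs0]
    have hsum := hasSum_mellin (a := fun m : ℕ => a (m + 1)) (p := fun m : ℕ => ((m + 1 : ℕ) : ℝ))
      (F := fun t : ℝ => ∑' m : ℕ, a (m + 1) * Complex.exp (-((m + 1 : ℕ) : ℂ) * (t : ℂ)))
      (s := s) (fun i => Or.inr (by positivity)) hs0 ?_ ?_
    · rw [← hsum.tsum_eq, ← tsum_mul_left]
      refine tsum_congr fun m => ?_
      have := Complex.Gamma_ne_zero_of_re_pos hs0
      rw [Complex.cpow_neg, Complex.ofReal_natCast]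
      field_simp
    · intro t ht
      have h : Summable fun m : ℕ => a (m + 1) * Complex.exp (-((m + 1 : ℕ) : ℂ) * (t : ℂ)) := by
        refine Summable.of_norm ?_
        simp only [z_norm]
        exact z_summable a C σ hbound ht
      convert h.hasSum using 3 with m
      push_cast
      rfl
    · have h0 := (summable_nat_add_iff 1).2
        (Real.summable_nat_rpow.2 (show σ - s.re < -1 by linarith))
      refine Summable.of_nonneg_of_le (fun m => by positivity) (fun m => ?_) (h0.mul_left C)
      rw [Real.rpow_sub (by positivity), ← mul_div_assoc]
      gcongr
      exact hbound m
end

section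
/- Let d(n) denote the number of positive divisors of n, γ the Euler–Mascheroni constant, and ζ the Riemann zeta function. For every integer N ≥ 1, as x → 0⁺ one has ∑_{n≥1} d(n) e^{−nx} = (γ − log x)/x + 1/4 + ∑_{n=1}^{N−1} (ζ(−n)²/n!) (−x)^n + O(x^N). -/
open Filter Topology Asymptotics

noncomputable def zc (n : ℕ) : ℂ := riemannZeta (-(n : ℂ)) / (n.factorial : ℂ)

lemma zc_eq (n : ℕ) : zc n = (-1) ^ n * ((bernoulliFun (n+1) 0 : ℝ) : ℂ) / ((n+1).factorial : ℂ) := by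
  rw [zc, riemannZeta_neg_nat_eq_bernoulli, bernoulliFun_eval_zero, Nat.factorial_succ]
  have h1 : (n.factorial : ℂ) ≠ 0 := by exact_mod_cast n.factorial_ne_zero
  have h2 : (n + 1 : ℂ) ≠ 0 := by exact_mod_cast n.succ_ne_zero
  push_cast
  field_simp

lemma hasDerivAt_bernC (k : ℕ) (u : ℝ) :
    HasDerivAt (fun u : ℝ => ((bernoulliFun (k+1) u : ℝ) : ℂ))
      ((k+1 : ℂ) * ((bernoulliFun k u : ℝ) : ℂ)) u := by
  have := (hasDerivAt_bernoulliFun (k+1) u).ofReal_comp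
  simpa using this

lemma em_step (d : ℕ → ℝ → ℂ) (hd : ∀ k u, HasDerivAt (d k) (d (k+1) u) u) (K : ℕ) :
    d 0 1 = (∫ u in (0:ℝ)..1, d 0 u) - ∑ n ∈ Finset.range (K+1), zc n * (d n 1 - d n 0)
      + (-1) ^ K / ((K+1).factorial : ℂ) *
        ∫ u in (0:ℝ)..1, ((bernoulliFun (K+1) u : ℝ) : ℂ) * d (K+1) u := by
  have hc : ∀ k, Continuous (d k) := fun k =>
    continuous_iff_continuousAt.2 fun u => (hd k u).continuousAt
  have ibp : ∀ k, ∫ u in (0:ℝ)..1, ((bernoulliFun (k+1) u : ℝ) : ℂ) * d (k+1) u =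
      ((bernoulliFun (k+1) 1 : ℝ) : ℂ) * d k 1 - ((bernoulliFun (k+1) 0 : ℝ) : ℂ) * d k 0
       - (k+1) * ∫ u in (0:ℝ)..1, ((bernoulliFun k u : ℝ) : ℂ) * d k u := by
    intro k
    rw [intervalIntegral.integral_mul_deriv_eq_deriv_mul
      (fun u _ => hasDerivAt_bernC k u) (fun u _ => hd k u)]
    · rw [← intervalIntegral.integral_const_mul]
      simp only [mul_assoc]
    · apply Continuous.intervalIntegrable
      have := continuous_bernoulliFun k
      fun_prop
    · exact (hc _).intervalIntegrable _ _
  induction K with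
  | zero =>
    have := ibp 0
    simp only [zero_add] at this ⊢
    rw [this]
    simp [zc, riemannZeta_zero]
    ring
  | succ K ih =>
    have h1 := ibp (K+1)
    rw [Finset.sum_range_succ, h1]
    nth_rewrite 1 [ih]
    rw [bernoulliFun_endpoints_eq_of_ne_one (by omega), zc_eq, Nat.factorial_succ (K+1)]
    have h1 : ((K+1).factorial : ℂ) ≠ 0 := by exact_mod_cast (K+1).factorial_ne_zero
    have h2 : (K + 1 + 1 : ℂ) ≠ 0 := by exact_mod_cast (K+1).succ_ne_zero
    push_cast
    field_simp
    ring

structure Nice (D : ℕ → ℝ → ℂ) : Prop where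
  hd : ∀ k u, HasDerivAt (D k) (D (k+1) u) u
  hb : ∀ k, ∃ C : ℝ, ∀ t, 0 ≤ t → ‖D k t‖ ≤ C * Real.exp (-t)

lemma Nice.cont {D : ℕ → ℝ → ℂ} (h : Nice D) (k : ℕ) : Continuous (D k) :=
  continuous_iff_continuousAt.2 fun u => (h.hd k u).continuousAt

lemma Nice.integrableOn {D : ℕ → ℝ → ℂ} (h : Nice D) (k : ℕ) :
    MeasureTheory.IntegrableOn (D k) (Set.Ioi 0) := by
  obtain ⟨C, hC⟩ := h.hb k
  have h1 : MeasureTheory.IntegrableOn (fun t : ℝ => C * Real.exp (-t)) (Set.Ioi 0) :=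
    (integrableOn_exp_neg_Ioi 0).const_mul C
  refine MeasureTheory.Integrable.mono' h1 (h.cont k).aestronglyMeasurable ?_
  filter_upwards [MeasureTheory.ae_restrict_mem measurableSet_Ioi] with t ht
  exact hC t (le_of_lt ht)

lemma Nice.tendsto {D : ℕ → ℝ → ℂ} (h : Nice D) (k : ℕ) : Tendsto (D k) atTop (𝓝 0) := by
  obtain ⟨C, hC⟩ := h.hb k
  have h1 : Tendsto (fun t : ℝ => C * Real.exp (-t)) atTop (𝓝 0) := by
    simpa using (Real.tendsto_exp_neg_atTop_nhds_zero).const_mul C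
  refine squeeze_zero_norm' ?_ h1
  filter_upwards [eventually_ge_atTop 0] with t ht using hC t ht

lemma summable_exp_aux {x : ℝ} (hx : 0 < x) : Summable fun m : ℕ => Real.exp (-(m * x)) := by
  simp_rw [← mul_neg]
  exact Real.summable_exp_nat_mul_iff.2 (by linarith)

lemma Nice.summable {D : ℕ → ℝ → ℂ} (h : Nice D) (k : ℕ) {x : ℝ} (hx : 0 < x) :
    Summable fun m : ℕ => D k (((m:ℝ)+1) * x) := by
  obtain ⟨C, hC⟩ := h.hb k
  refine Summable.of_norm_bounded (g := fun m : ℕ => C * Real.exp (-((m+1 : ℕ) * x))) ?_ ?_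
  · exact ((summable_nat_add_iff 1).2 (summable_exp_aux hx)).mul_left C
  · intro m
    have := hC (((m:ℝ)+1) * x) (by positivity)
    push_cast
    exact this

lemma em_finite {D : ℕ → ℝ → ℂ} (h : Nice D) (K : ℕ) {x : ℝ} (hx : 0 < x) (m : ℕ) :
    D 0 (((m:ℝ)+1) * x) = (1 / x : ℂ) * (∫ t in ((m:ℝ)*x)..(((m+1 : ℕ):ℝ) * x), D 0 t)
      - ∑ n ∈ Finset.range (K+1), zc n * x^n * (D n (((m+1:ℕ):ℝ) * x) - D n ((m:ℝ) * x))
      + (-1) ^ K / ((K+1).factorial : ℂ) * x^(K+1) *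
        ∫ u in (0:ℝ)..1, ((bernoulliFun (K+1) u : ℝ) : ℂ) * D (K+1) ((m + u) * x) := by
  have hx' : (x : ℂ) ≠ 0 := by exact_mod_cast hx.ne'
  have := em_step (fun k u => (x:ℂ)^k * D k ((m + u) * x)) ?_ K
  · simp only [pow_zero, one_mul] at this
    rw [this]
    congr 1
    · congr 1
      · have h1 := intervalIntegral.integral_comp_mul_add (a := 0) (b := 1) (D 0) hx.ne' (m * x)
        have h2 : (∫ u in (0:ℝ)..1, D 0 ((m+u)*x)) = ∫ u in (0:ℝ)..1, D 0 (x * u + m * x) := by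
          congr 1; ext u; congr 1; ring
        rw [h2, h1]
        simp
        left
        congr 1
        ring
      · refine Finset.sum_congr rfl fun n _ => ?_
        push_cast
        simp
        ring
    · rw [mul_assoc]
      congr 1
      rw [← intervalIntegral.integral_const_mul]
      congr 1; ext u; ring
  · intro k u
    have h1 : HasDerivAt (fun u : ℝ => (m + u) * x) x u := by
      simpa using ((hasDerivAt_id u).const_add (m:ℝ)).mul_const x
    have h2 := (HasDerivAt.scomp u (h.hd k ((m+u)*x)) h1).const_mul ((x:ℂ)^k)
    have h3 : (x:ℂ)^k * x • D (k+1) ((m+u)*x) = (x:ℂ)^(k+1) * D (k+1) ((m+u)*x) := by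
      rw [Complex.real_smul]
      ring
    rw [h3] at h2
    exact h2

lemma em_bound {D : ℕ → ℝ → ℂ} (h : Nice D) (N : ℕ) : ∃ C : ℝ, ∀ x : ℝ, 0 < x → x ≤ 1 →
    ‖(∑' m : ℕ, D 0 (((m:ℝ)+1) * x)) - ((1 / x : ℂ) * (∫ t in Set.Ioi (0:ℝ), D 0 t)
      + ∑ n ∈ Finset.range (N+1), zc n * D n 0 * x^n)‖ ≤ C * x ^ N := by
  obtain ⟨C, hC⟩ := h.hb (N+1)
  obtain ⟨B, hB⟩ := isCompact_Icc.exists_bound_of_continuousOn (s := Set.Icc (0:ℝ) 1)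
    (continuous_bernoulliFun (N+1)).continuousOn
  have hB0 : 0 ≤ B := (norm_nonneg _).trans (hB 0 (by simp))
  have hC0 : 0 ≤ C := by have := (norm_nonneg _).trans (hC 0 le_rfl); simpa using this
  set A : ℝ := B * C
  have hA0 : 0 ≤ A := mul_nonneg hB0 hC0
  refine ⟨A * 2, fun x hx hx1 => ?_⟩
  have hx' : (x : ℂ) ≠ 0 := by exact_mod_cast hx.ne'
  set R : ℕ → ℂ := fun m => (-1) ^ N / ((N+1).factorial : ℂ) * x^(N+1) *
        ∫ u in (0:ℝ)..1, ((bernoulliFun (N+1) u : ℝ) : ℂ) * D (N+1) ((m + u) * x) with hR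
  have hRb : ∀ m, ‖R m‖ ≤ A * x^(N+1) * Real.exp (-(m * x)) := by
    intro m
    have h1 : ‖∫ u in (0:ℝ)..1, ((bernoulliFun (N+1) u : ℝ) : ℂ) * D (N+1) ((m + u) * x)‖ ≤
        A * Real.exp (-(m * x)) * |(1:ℝ) - 0| := by
      apply intervalIntegral.norm_integral_le_of_norm_le_const
      intro u hu
      rw [Set.uIoc_of_le zero_le_one] at hu
      rw [norm_mul, Complex.norm_real]
      have h2 := hB u ⟨hu.1.le, hu.2⟩
      have h3 := hC ((m+u)*x) (by have := hu.1; positivity)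
      have h4 : Real.exp (-((m+u)*x)) ≤ Real.exp (-(m*x)) := by
        apply Real.exp_le_exp.2
        nlinarith [hu.1]
      calc _ ≤ B * (C * Real.exp (-((m+u)*x))) := by gcongr
        _ ≤ B * (C * Real.exp (-(m*x))) := by gcongr
        _ = _ := by ring
    have h5 : ‖(-1 : ℂ) ^ N / ((N+1).factorial : ℂ)‖ ≤ 1 := by
      rw [norm_div, norm_pow, norm_neg, norm_one, one_pow, Complex.norm_natCast]
      exact div_le_one_of_le₀ (by exact_mod_cast Nat.one_le_iff_ne_zero.2 (N+1).factorial_ne_zero) (by positivity)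
    simp only [hR]
    rw [norm_mul, norm_mul, norm_pow, Complex.norm_real, Real.norm_of_nonneg hx.le]
    simp only [sub_zero, abs_one, mul_one] at h1
    calc _ ≤ 1 * x^(N+1) * (A * Real.exp (-(m * x))) := by gcongr
      _ = _ := by ring
  have hfin : ∀ M : ℕ, (∑ m ∈ Finset.range M, D 0 (((m:ℝ)+1) * x)) -
      ((1 / x : ℂ) * (∫ t in (0:ℝ)..(M * x), D 0 t)
       - ∑ n ∈ Finset.range (N+1), zc n * x^n * (D n (M * x) - D n 0)) = ∑ m ∈ Finset.range M, R m := by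
    intro M
    induction M with
    | zero => simp
    | succ M ih =>
      rw [Finset.sum_range_succ, Finset.sum_range_succ (fun m => R m), ← ih, em_finite h N hx M,
        ← intervalIntegral.integral_add_adjacent_intervals (a := 0) (b := (M:ℝ) * x)
          ((h.cont 0).intervalIntegrable _ _) ((h.cont 0).intervalIntegrable _ _)]
      simp only [hR]
      have : ∑ n ∈ Finset.range (N+1), zc n * x^n * (D n (((M+1:ℕ):ℝ) * x) - D n 0) =
         ∑ n ∈ Finset.range (N+1), zc n * x^n * (D n (((M+1:ℕ):ℝ) * x) - D n (M * x)) +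
         ∑ n ∈ Finset.range (N+1), zc n * x^n * (D n (M * x) - D n 0) := by
        rw [← Finset.sum_add_distrib]
        exact Finset.sum_congr rfl fun n _ => by ring
      rw [this]
      ring
  have hgeo : ∀ M : ℕ, ∑ m ∈ Finset.range M, Real.exp (-(m * x)) ≤ 2 / x := by
    intro M
    calc _ ≤ ∑' m : ℕ, Real.exp (-(m * x)) :=
          (summable_exp_aux hx).sum_le_tsum _ (fun _ _ => (Real.exp_pos _).le)
      _ = (1 - Real.exp (-x))⁻¹ := by
          rw [← tsum_geometric_of_lt_one (Real.exp_pos _).le (Real.exp_lt_one_iff.2 (by linarith))]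
          congr 1; ext m; rw [← Real.exp_nat_mul]; ring_nf
      _ ≤ 2 / x := by
          have : Real.exp (-x) ≤ 1 - x / 2 := by
            have := Real.add_one_le_exp x
            rw [Real.exp_neg, inv_le_comm₀ (Real.exp_pos _) (by linarith)]
            refine le_trans ?_ this
            rw [inv_le_iff_one_le_mul₀ (by linarith)]
            nlinarith
          rw [inv_le_comm₀ (by linarith) (by positivity), inv_div]
          linarith
  have hMx : Tendsto (fun M : ℕ => (M:ℝ) * x) atTop atTop :=
    tendsto_natCast_atTop_atTop.atTop_mul_const hx
  have hlim : Tendsto (fun M : ℕ => (∑ m ∈ Finset.range M, D 0 (((m:ℝ)+1) * x)) -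
      ((1 / x : ℂ) * (∫ t in (0:ℝ)..(M * x), D 0 t)
       - ∑ n ∈ Finset.range (N+1), zc n * x^n * (D n (M * x) - D n 0))) atTop
      (𝓝 ((∑' m : ℕ, D 0 (((m:ℝ)+1) * x)) - ((1 / x : ℂ) * (∫ t in Set.Ioi (0:ℝ), D 0 t)
      - ∑ n ∈ Finset.range (N+1), zc n * x^n * (0 - D n 0)))) := by
    refine ((h.summable 0 hx).hasSum.tendsto_sum_nat).sub (Tendsto.sub ?_ ?_)
    · exact (MeasureTheory.intervalIntegral_tendsto_integral_Ioi 0 (h.integrableOn 0) hMx).const_mul _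
    · refine tendsto_finsetSum _ fun n _ => ?_
      exact (((h.tendsto n).comp hMx).sub_const _).const_mul _
  have hle := le_of_tendsto hlim.norm (Eventually.of_forall (fun M => by
    rw [hfin M]
    calc ‖∑ m ∈ Finset.range M, R m‖ ≤ ∑ m ∈ Finset.range M, A * x^(N+1) * Real.exp (-(m * x)) :=
          norm_sum_le_of_le _ (fun m _ => hRb m)
      _ = A * x^(N+1) * ∑ m ∈ Finset.range M, Real.exp (-(m * x)) := by rw [Finset.mul_sum]
      _ ≤ A * x^(N+1) * (2 / x) := by gcongr; exact hgeo M
      _ = A * 2 * x ^ N := by field_simp; ring))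
  have key : ((1 / x : ℂ) * (∫ t in Set.Ioi (0:ℝ), D 0 t)
      + ∑ n ∈ Finset.range (N+1), zc n * D n 0 * x^n) = ((1 / x : ℂ) * (∫ t in Set.Ioi (0:ℝ), D 0 t)
      - ∑ n ∈ Finset.range (N+1), zc n * x^n * (0 - D n 0)) := by
    rw [sub_eq_add_neg, ← Finset.sum_neg_distrib]
    congr 1
    exact Finset.sum_congr rfl fun n _ => by ring
  rw [key]
  exact hle

lemma nice_exp : Nice (fun k t => (-1 : ℂ) ^ k * ((Real.exp (-t) : ℝ) : ℂ)) := by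
  constructor
  · intro k u
    have h1 : HasDerivAt (fun t : ℝ => Real.exp (-t)) (-Real.exp (-u)) u := by
      simpa using (hasDerivAt_neg u).exp
    have h2 := (h1.ofReal_comp).const_mul ((-1:ℂ)^k)
    have h3 : (-1:ℂ)^k * ((-Real.exp (-u) : ℝ) : ℂ) = (-1 : ℂ) ^ (k+1) * ((Real.exp (-u) : ℝ) : ℂ) := by
      push_cast; ring
    rw [h3] at h2
    exact h2
  · intro k
    refine ⟨1, fun t _ => ?_⟩
    rw [norm_mul, norm_pow, norm_neg, norm_one, one_pow, Complex.norm_real,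
      Real.norm_of_nonneg (Real.exp_pos _).le]

lemma hasSum_exp {x : ℝ} (hx : 0 < x) :
    HasSum (fun m : ℕ => Real.exp (-(((m:ℝ)+1) * x))) (1 / (Real.exp x - 1)) := by
  have h1 := (hasSum_geometric_of_lt_one (Real.exp_pos (-x)).le
    (Real.exp_lt_one_iff.2 (by linarith : -x < 0))).mul_left (Real.exp (-x))
  have e1 : (fun m : ℕ => Real.exp (-(((m:ℝ)+1) * x))) =
      fun m : ℕ => Real.exp (-x) * Real.exp (-x) ^ m := by
    ext m; rw [← Real.exp_nat_mul, ← Real.exp_add]; ring_nf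
  have e2 : 1 / (Real.exp x - 1) = Real.exp (-x) * (1 - Real.exp (-x))⁻¹ := by
    have : Real.exp x - 1 ≠ 0 := by have := Real.add_one_lt_exp hx.ne'; linarith
    rw [Real.exp_neg]
    have := Real.exp_pos x
    have h3 : 1 - (Real.exp x)⁻¹ = (Real.exp x - 1) / Real.exp x := by field_simp
    rw [h3]
    field_simp
  rw [e1, e2]
  exact h1

lemma expn (N : ℕ) : ∃ C : ℝ, ∀ x : ℝ, 0 < x → x ≤ 1 →
    ‖((1 / (Real.exp x - 1) : ℝ) : ℂ) - ((1 / x : ℂ)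
      + ∑ n ∈ Finset.range (N+1), zc n * (-1) ^ n * x^n)‖ ≤ C * x ^ N := by
  obtain ⟨C, hC⟩ := em_bound nice_exp N
  refine ⟨C, fun x hx hx1 => ?_⟩
  have := hC x hx hx1
  simp only [pow_zero, one_mul] at this
  rw [← Complex.ofReal_tsum, (hasSum_exp hx).tsum_eq, integral_complex_ofReal,
    integral_exp_neg_Ioi_zero] at this
  simpa using this

noncomputable def HH (z : ℂ) : ℂ :=
  dslope (dslope (fun z => z - 1 + Complex.exp (-z)) 0) 0 z / dslope Complex.exp 0 z

lemma exp_ne_one' {z : ℂ} (h : |z.im| < 2) (h0 : z ≠ 0) : Complex.exp z - 1 ≠ 0 := by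
  intro h1
  obtain ⟨n, hn⟩ := Complex.exp_eq_one_iff.1 (sub_eq_zero.1 h1)
  have him : z.im = n * (2 * Real.pi) := by rw [hn]; simp
  have hn0 : n ≠ 0 := by rintro rfl; simp at hn; exact h0 hn
  have h2 : (1:ℝ) ≤ |(n:ℝ)| := by exact_mod_cast Int.one_le_abs hn0
  rw [him, abs_mul, abs_of_pos (by positivity : 0 < 2 * Real.pi)] at h
  nlinarith [Real.pi_gt_three]

lemma HH_eq {z : ℂ} (h : |z.im| < 2) (h0 : z ≠ 0) :
    HH z = 1 / (Complex.exp z - 1) - Complex.exp (-z) / z := by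
  have h1 := exp_ne_one' h h0
  have hd : deriv (fun z : ℂ => z - 1 + Complex.exp (-z)) 0 = 0 := by
    have : HasDerivAt (fun z : ℂ => z - 1 + Complex.exp (-z)) (1 + Complex.exp (-0) * (-1)) 0 :=
      ((hasDerivAt_id (0:ℂ)).sub_const 1).add ((hasDerivAt_neg (0:ℂ)).cexp)
    rw [this.deriv]; simp
  rw [HH, dslope_of_ne _ h0, dslope_of_ne _ h0, slope_def_field, slope_def_field,
    dslope_of_ne _ h0, dslope_same, hd, slope_def_field, Complex.exp_neg]
  have := Complex.exp_ne_zero z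
  simp
  field_simp
  ring

lemma strip_open : IsOpen {z : ℂ | |z.im| < 2} := by
  apply isOpen_lt <;> fun_prop

lemma HH_diff : DifferentiableOn ℂ HH {z : ℂ | |z.im| < 2} := by
  have hS : {z : ℂ | |z.im| < 2} ∈ 𝓝 (0:ℂ) := strip_open.mem_nhds (by simp)
  refine DifferentiableOn.div ?_ ?_ ?_
  · rw [Complex.differentiableOn_dslope hS, Complex.differentiableOn_dslope hS]
    fun_prop
  · rw [Complex.differentiableOn_dslope hS]
    fun_prop
  · intro z hz
    rcases eq_or_ne z 0 with rfl | h0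
    · simp [dslope_same]
    · rw [dslope_of_ne _ h0, slope_def_field]
      have := exp_ne_one' hz h0
      simp [h0, this]

lemma HH_bound : ∃ C : ℝ, ∀ z : ℂ, -1 ≤ z.re → |z.im| ≤ 1 → ‖HH z‖ ≤ C * Real.exp (-z.re) := by
  have hK : IsCompact (Set.Icc (-1:ℝ) 1 ×ℂ Set.Icc (-1:ℝ) 1) := isCompact_Icc.reProdIm isCompact_Icc
  obtain ⟨B, hB⟩ := hK.exists_bound_of_continuousOn (f := HH) (HH_diff.continuousOn.mono (by
    intro z hz
    have := (Complex.mem_reProdIm.1 hz).2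
    have := abs_le.2 this
    show |z.im| < 2
    linarith))
  have hB0 : 0 ≤ B := (norm_nonneg _).trans (hB 0 (by simp [Complex.mem_reProdIm]))
  refine ⟨B * Real.exp 1 + 3, fun z hr hi => ?_⟩
  rcases le_total z.re 1 with h1 | h1
  · have h2 := hB z (Complex.mem_reProdIm.2 ⟨⟨hr, h1⟩, abs_le.1 hi⟩)
    have h3 : 1 ≤ Real.exp 1 * Real.exp (-z.re) := by
      rw [← Real.exp_add]; exact Real.one_le_exp (by linarith)
    nlinarith [Real.exp_pos (-z.re)]
  · have h0 : z ≠ 0 := by rintro rfl; simp at h1; linarith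
    rw [HH_eq (by linarith) h0]
    have he : (2:ℝ) ≤ Real.exp z.re := by have := Real.add_one_le_exp z.re; linarith
    have h2 : ‖1 / (Complex.exp z - 1)‖ ≤ 2 * Real.exp (-z.re) := by
      have h3 : Real.exp z.re - 1 ≤ ‖Complex.exp z - 1‖ := by
        have := norm_sub_norm_le (Complex.exp z) 1
        rwa [Complex.norm_exp, norm_one] at this
      rw [norm_div, norm_one, Real.exp_neg, ← div_eq_mul_inv, div_le_div_iff₀ (by linarith) (by linarith)]
      linarith
    have h4 : ‖Complex.exp (-z) / z‖ ≤ Real.exp (-z.re) := by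
      rw [norm_div, Complex.norm_exp, Complex.neg_re]
      have : 1 ≤ ‖z‖ := h1.trans (Complex.re_le_norm z)
      exact div_le_self (Real.exp_pos _).le this
    have h5 := norm_sub_le (1 / (Complex.exp z - 1)) (Complex.exp (-z) / z)
    have : 0 ≤ B * Real.exp 1 * Real.exp (-z.re) := by positivity
    nlinarith

lemma HH_analytic (t : ℝ) : AnalyticAt ℂ HH (t : ℂ) :=
  HH_diff.analyticAt (strip_open.mem_nhds (by simp))

lemma nice_HH : Nice (fun k t => iteratedDeriv k HH (t : ℂ)) := by
  constructor
  · intro k u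
    have h1 : AnalyticAt ℂ (iteratedDeriv k HH) (u : ℂ) := by
      rw [iteratedDeriv_eq_iterate]
      exact (HH_analytic u).iterated_deriv k
    have h2 := h1.differentiableAt.hasDerivAt.comp_ofReal
    rw [iteratedDeriv_succ]
    exact h2
  · intro k
    obtain ⟨C, hC⟩ := HH_bound
    have hC0 : 0 ≤ C := by
      have := (norm_nonneg _).trans (hC 0 (by simp) (by simp)); simpa using this
    refine ⟨k.factorial * (C * Real.exp 1), fun t ht => ?_⟩
    have := Complex.norm_iteratedDeriv_le_of_forall_mem_sphere_norm_le (c := (t:ℂ)) (R := 1)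
      (C := C * Real.exp (1 - t)) (f := HH) k one_pos ?_ ?_
    · rw [one_pow, div_one, sub_eq_add_neg, Real.exp_add] at this
      refine this.trans (le_of_eq (by ring))
    · apply DifferentiableOn.diffContOnCl
      refine HH_diff.mono fun z hz => ?_
      have hz := Metric.closure_ball_subset_closedBall hz
      rw [Metric.mem_closedBall, Complex.dist_eq] at hz
      have := (Complex.abs_im_le_norm (z - t)).trans hz
      simp at this
      show |z.im| < 2
      linarith
    · intro z hz
      rw [mem_sphere_iff_norm] at hz
      have h1 := (Complex.abs_im_le_norm (z - t)).trans hz.le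
      have h2 := (Complex.abs_re_le_norm (z - t)).trans hz.le
      simp at h1 h2
      rw [abs_le] at h2
      refine (hC z (by linarith) h1).trans ?_
      gcongr
      linarith

lemma HH_real {t : ℝ} (ht : 0 < t) :
    HH t = ((1 / (Real.exp t - 1) : ℝ) : ℂ) - ((Real.exp (-t) : ℝ) : ℂ) / t := by
  rw [HH_eq (by simp) (by exact_mod_cast ht.ne')]
  push_cast
  rfl

lemma HH_integral : ∫ t in Set.Ioi (0:ℝ), HH t = (Real.eulerMascheroniConstant : ℂ) := by
  have hc : Continuous (fun t : ℝ => HH t) := by simpa using nice_HH.cont 0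
  have hloc : MeasureTheory.LocallyIntegrableOn (fun t : ℝ => HH t) (Set.Ioi 0) :=
    hc.locallyIntegrable.locallyIntegrableOn _
  have htop : (fun t : ℝ => HH t) =O[atTop] fun t => Real.exp (-1 * t) := by
    obtain ⟨C, hC⟩ := nice_HH.hb 0
    refine IsBigO.of_bound C ?_
    filter_upwards [eventually_ge_atTop 0] with t ht
    have := hC t ht
    simpa [abs_of_pos (Real.exp_pos _)] using this
  have hbot : (fun t : ℝ => HH t) =O[𝓝[>] 0] fun t => t ^ (-(0:ℝ)) := by
    simp only [neg_zero, Real.rpow_zero]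
    exact ((hc.tendsto 0).isBigO_one ℝ).mono nhdsWithin_le_nhds
  have hd : DifferentiableAt ℂ (mellin (fun t : ℝ => HH t)) 1 :=
    mellin_differentiableAt_of_isBigO_rpow_exp one_pos hloc htop hbot (by simp)
  have h1 : mellin (fun t : ℝ => HH t) 1 = ∫ t in Set.Ioi (0:ℝ), HH t := by
    simp [mellin]
  have hval : ∀ s : ℝ, 1 < s → mellin (fun t : ℝ => HH t) s =
      Complex.Gamma s * (riemannZeta s - 1 / (s - 1)) := by
    intro s hs
    have hcv : MellinConvergent (fun t : ℝ => HH t) s :=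
      mellinConvergent_of_isBigO_rpow_exp one_pos hloc htop hbot (by simp; linarith)
    have hGc : MellinConvergent (fun t : ℝ => ((Real.exp (-t) : ℝ) : ℂ)) ((s:ℂ) + (-1)) := by
      have := Complex.GammaIntegral_convergent (s := (s:ℂ) + (-1)) (by simp; linarith)
      refine this.congr_fun (fun t ht => ?_) measurableSet_Ioi
      simp [mul_comm]
    have hGv := mellin_cpow_smul (fun t : ℝ => ((Real.exp (-t) : ℝ) : ℂ)) s (-1)
    rw [← MellinConvergent.cpow_smul] at hGc
    have hadd := (hasMellin_add hcv hGc).2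
    have hs1 : (s:ℂ) - 1 ≠ 0 := by
      rw [sub_ne_zero]; exact_mod_cast hs.ne'
    have hGG : mellin (fun t : ℝ => ((Real.exp (-t) : ℝ) : ℂ)) ((s:ℂ) + (-1)) =
        Complex.Gamma s / (s - 1) := by
      rw [← Complex.GammaIntegral_eq_mellin, ← Complex.Gamma_eq_integral (by simp; linarith)]
      have := Complex.Gamma_add_one ((s:ℂ) + (-1)) (by rwa [← sub_eq_add_neg])
      rw [neg_add_cancel_right, ← sub_eq_add_neg] at this
      rw [← sub_eq_add_neg, this]
      field_simp
    rw [hGv, hGG] at hadd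
    have hz := hasSum_mellin (a := fun _ : ℕ => (1:ℂ)) (p := fun n : ℕ => (n:ℝ) + 1)
      (F := fun t : ℝ => HH t + (t:ℂ) ^ (-1 : ℂ) • ((Real.exp (-t) : ℝ) : ℂ)) (s := s)
      (fun i => Or.inr (by positivity)) (by simp; linarith) ?_ ?_
    · rw [hadd] at hz
      have hz2 := hz.tsum_eq
      simp_rw [mul_div_assoc] at hz2
      rw [tsum_mul_left] at hz2
      have h3 := zeta_eq_tsum_one_div_nat_add_one_cpow (s := s) (by simpa using hs)
      push_cast at hz2
      rw [← h3] at hz2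
      rw [mul_sub, hz2]
      ring
    · intro t ht
      have ht : 0 < t := ht
      have hh := Complex.hasSum_ofReal.2 (hasSum_exp ht)
      have e2 : HH t + (t:ℂ) ^ (-1 : ℂ) • ((Real.exp (-t) : ℝ) : ℂ) = ((1 / (Real.exp t - 1) : ℝ) : ℂ) := by
        rw [HH_real ht, Complex.cpow_neg_one, smul_eq_mul]
        ring
      simp only [e2, one_mul, neg_mul]
      exact hh
    · have := (Real.summable_one_div_nat_add_rpow 1 s).2 hs
      refine this.congr fun n => ?_
      rw [abs_of_pos (by positivity)]
      simp
  have hl1 : Tendsto (fun s : ℝ => mellin (fun t : ℝ => HH t) s) (𝓝[>] 1)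
      (𝓝 (mellin (fun t : ℝ => HH t) 1)) := by
    have : Tendsto (fun s : ℝ => (s:ℂ)) (𝓝[>] 1) (𝓝 1) := by
      have := (Complex.continuous_ofReal.tendsto 1).mono_left (nhdsWithin_le_nhds (s := Set.Ioi 1))
      simpa using this
    exact hd.continuousAt.tendsto.comp this
  have hl2 : Tendsto (fun s : ℝ => Complex.Gamma s * (riemannZeta s - 1 / (s - 1))) (𝓝[>] 1)
      (𝓝 (1 * (Real.eulerMascheroniConstant : ℂ))) := by
    refine Tendsto.mul ?_ ZetaAsymptotics.tendsto_riemannZeta_sub_one_div_nhds_right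
    have hG : ContinuousAt Complex.Gamma 1 := (Complex.differentiableAt_Gamma_one).continuousAt
    have : Tendsto (fun s : ℝ => (s:ℂ)) (𝓝[>] 1) (𝓝 1) := by
      have := (Complex.continuous_ofReal.tendsto 1).mono_left (nhdsWithin_le_nhds (s := Set.Ioi 1))
      simpa using this
    have h3 := hG.tendsto.comp this
    rw [Complex.Gamma_one] at h3
    exact h3
  rw [one_mul] at hl2
  rw [← h1]
  refine tendsto_nhds_unique (hl1.congr' ?_) hl2
  filter_upwards [self_mem_nhdsWithin] with s hs using hval s hs

lemma toO {f : ℝ → ℂ} {N : ℕ} (h : ∃ C : ℝ, ∀ x : ℝ, 0 < x → x ≤ 1 → ‖f x‖ ≤ C * x ^ N) :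
    f =O[𝓝[>] (0:ℝ)] fun x : ℝ => x ^ N := by
  obtain ⟨C, hC⟩ := h
  refine IsBigO.of_bound C ?_
  filter_upwards [Ioc_mem_nhdsGT (zero_lt_one (α := ℝ))] with x hx
  have := hC x hx.1 hx.2
  rwa [Real.norm_of_nonneg (pow_nonneg hx.1.le _)]

lemma dropO {f : ℝ → ℂ} {a : ℕ → ℂ} {N : ℕ}
    (h : (fun x : ℝ => f x - ∑ n ∈ Finset.range (N+1), a n * (x:ℂ)^n) =O[𝓝[>] (0:ℝ)] fun x : ℝ => x ^ N) :
    (fun x : ℝ => f x - ∑ n ∈ Finset.range N, a n * (x:ℂ)^n) =O[𝓝[>] (0:ℝ)] fun x : ℝ => x ^ N := by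
  have h2 : (fun x : ℝ => a N * (x:ℂ)^N) =O[𝓝[>] (0:ℝ)] fun x : ℝ => x ^ N := by
    refine IsBigO.of_bound ‖a N‖ (Eventually.of_forall fun x => ?_)
    simp
  refine (h.add h2).congr_left fun x => ?_
  rw [Finset.sum_range_succ]; ring

lemma uniq (N : ℕ) : ∀ a : ℕ → ℂ,
    (fun x : ℝ => ∑ n ∈ Finset.range N, a n * (x:ℂ)^n) =O[𝓝[>] (0:ℝ)] (fun x : ℝ => x ^ N) →
    ∀ n < N, a n = 0 := by
  induction N with
  | zero => intro a _ n hn; omega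
  | succ N ih =>
    intro a h
    have h0 : a 0 = 0 := by
      have h1 : Tendsto (fun x : ℝ => ∑ n ∈ Finset.range (N+1), a n * (x:ℂ)^n) (𝓝[>] (0:ℝ)) (𝓝 0) := by
        refine h.trans_tendsto ?_
        have : Tendsto (fun x : ℝ => x^(N+1)) (𝓝 0) (𝓝 (0^(N+1))) := (continuous_pow (N+1)).tendsto 0
        rw [zero_pow (by omega)] at this
        exact this.mono_left nhdsWithin_le_nhds
      have h2 : Tendsto (fun x : ℝ => ∑ n ∈ Finset.range (N+1), a n * (x:ℂ)^n) (𝓝[>] (0:ℝ)) (𝓝 (a 0)) := by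
        have hc : Continuous (fun x : ℝ => ∑ n ∈ Finset.range (N+1), a n * (x:ℂ)^n) := by fun_prop
        have := (hc.tendsto 0).mono_left (nhdsWithin_le_nhds (s := Set.Ioi 0))
        simpa [Finset.sum_range_succ'] using this
      exact tendsto_nhds_unique h2 h1
    have h3 : (fun x : ℝ => ∑ n ∈ Finset.range N, a (n+1) * (x:ℂ)^n) =O[𝓝[>] (0:ℝ)] (fun x : ℝ => x ^ N) := by
      obtain ⟨C, hC⟩ := h.bound
      refine IsBigO.of_bound C ?_
      filter_upwards [hC, self_mem_nhdsWithin] with x hx hx0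
      have hx0 : 0 < x := hx0
      have e : ∑ n ∈ Finset.range (N+1), a n * (x:ℂ)^n = x * ∑ n ∈ Finset.range N, a (n+1) * (x:ℂ)^n := by
        rw [Finset.sum_range_succ', h0, Finset.mul_sum]
        simp only [zero_mul, add_zero]
        exact Finset.sum_congr rfl fun n _ => by ring
      rw [e, norm_mul, Complex.norm_real, pow_succ', norm_mul] at hx
      have : 0 < ‖x‖ := by simpa using hx0.ne'
      refine le_of_mul_le_mul_left (hx.trans (le_of_eq ?_)) this
      ring
    intro n hn
    cases n with
    | zero => exact h0
    | succ n => exact ih _ h3 n (by omega)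

lemma g_O (N : ℕ) : (fun x : ℝ => (((1 / (Real.exp x - 1) : ℝ) : ℂ) - 1 / x)
      - ∑ n ∈ Finset.range N, (zc n * (-1) ^ n) * (x:ℂ)^n) =O[𝓝[>] (0:ℝ)] fun x : ℝ => x ^ N := by
  apply dropO
  apply toO
  obtain ⟨C, hC⟩ := expn N
  refine ⟨C, fun x h0 h1 => ?_⟩
  have := hC x h0 h1
  rwa [← sub_sub] at this

lemma e_O (N : ℕ) : (fun x : ℝ => (((Real.exp (-x) : ℝ) : ℂ) / x - 1 / x)
      - ∑ n ∈ Finset.range N, ((-1) ^ (n+1) / ((n+1).factorial : ℂ)) * (x:ℂ)^n)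
      =O[𝓝[>] (0:ℝ)] fun x : ℝ => x ^ N := by
  apply toO
  refine ⟨Real.exp 1, fun x h0 h1 => ?_⟩
  have hx : (x:ℂ) ≠ 0 := by exact_mod_cast h0.ne'
  have h2 := Complex.norm_exp_sub_sum_le_norm_mul_exp (-(x:ℂ)) (N+1)
  have e : Complex.exp (-(x:ℂ)) - ∑ m ∈ Finset.range (N+1), (-(x:ℂ)) ^ m / (m.factorial : ℂ) =
     x * ((((Real.exp (-x) : ℝ) : ℂ) / x - 1 / x)
      - ∑ n ∈ Finset.range N, ((-1) ^ (n+1) / ((n+1).factorial : ℂ)) * (x:ℂ)^n) := by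
    rw [Finset.sum_range_succ', mul_sub, Finset.mul_sum]
    have : ∀ n, (-(x:ℂ)) ^ (n+1) / ((n+1).factorial : ℂ) =
        x * ((-1) ^ (n+1) / ((n+1).factorial : ℂ) * (x:ℂ)^n) := by
      intro n; rw [neg_pow]; ring
    simp_rw [this]
    push_cast
    field_simp
    simp
    ring
  rw [e, norm_mul, norm_neg, Complex.norm_real, Real.norm_of_nonneg h0.le, pow_succ', mul_assoc] at h2
  have h3 := le_of_mul_le_mul_left h2 h0
  refine h3.trans ?_
  rw [mul_comm]
  gcongr

lemma HH_O (N : ℕ) : (fun x : ℝ => HH x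
      - ∑ n ∈ Finset.range N, (iteratedDeriv n HH ((0:ℝ):ℂ) / (n.factorial : ℂ)) * (x:ℂ)^n)
      =O[𝓝[>] (0:ℝ)] fun x : ℝ => x ^ N := by
  have h1 := (HH_analytic 0).hasFPowerSeriesAt.isBigO_sub_partialSum_pow N
  have ht : Tendsto (fun x : ℝ => (x:ℂ)) (𝓝[>] 0) (𝓝 0) := by
    have := (Complex.continuous_ofReal.tendsto 0).mono_left (nhdsWithin_le_nhds (s := Set.Ioi 0))
    simpa using this
  have h2 := h1.comp_tendsto ht
  refine IsBigO.congr' (h2.trans (IsBigO.of_bound 1 ?_)) ?_ (EventuallyEq.refl _ (fun x : ℝ => x ^ N))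
  · exact Eventually.of_forall fun x => by simp
  · refine Eventually.of_forall fun x => ?_
    simp [FormalMultilinearSeries.partialSum, FormalMultilinearSeries.ofScalars, mul_comm]

lemma coef (n : ℕ) : iteratedDeriv n HH ((0:ℝ):ℂ) =
    n.factorial * ((-1)^n * (zc n + 1 / ((n+1).factorial : ℂ))) := by
  have h := uniq (n+1) (fun k => zc k * (-1)^k - (-1) ^ (k+1) / ((k+1).factorial : ℂ) -
    iteratedDeriv k HH ((0:ℝ):ℂ) / (k.factorial : ℂ)) ?_ n (by omega)
  · have h1 : (n.factorial : ℂ) ≠ 0 := by exact_mod_cast n.factorial_ne_zero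
    rw [sub_eq_zero, eq_div_iff h1] at h
    rw [← h]; ring
  · refine (((HH_O (n+1)).sub (g_O (n+1))).add (e_O (n+1))).congr' ?_ (EventuallyEq.refl _ _)
    filter_upwards [self_mem_nhdsWithin] with x hx
    rw [HH_real hx]
    simp only [sub_mul, Finset.sum_sub_distrib]
    ring

lemma log_lim : Tendsto (fun x : ℝ => Real.log ((1 - Real.exp (-x)) / x)) (𝓝[>] 0) (𝓝 0) := by
  have h1 : HasDerivAt (fun x : ℝ => 1 - Real.exp (-x)) 1 0 := by
    simpa using ((hasDerivAt_neg (0:ℝ)).exp).const_sub 1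
  have h2 := (hasDerivAt_iff_tendsto_slope.1 h1).mono_left (nhdsGT_le_nhdsNE 0)
  have h3 := (Real.continuousAt_log (one_ne_zero)).tendsto.comp h2
  rw [Real.log_one] at h3
  refine h3.congr fun x => ?_
  simp [slope_def_field]

lemma one_sub_exp_pos {x : ℝ} (hx : 0 < x) : 0 < 1 - Real.exp (-x) := by
  have := Real.exp_lt_one_iff.2 (by linarith : -x < 0)
  linarith

lemma log_deriv' {x : ℝ} (hx : 0 < x) :
    HasDerivAt (fun x : ℝ => Real.log ((1 - Real.exp (-x)) / x)) (1 / (Real.exp x - 1) - 1 / x) x := by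
  have h1 : HasDerivAt (fun x : ℝ => 1 - Real.exp (-x)) (Real.exp (-x)) x := by
    simpa using ((hasDerivAt_neg x).exp).const_sub 1
  have hp := one_sub_exp_pos hx
  have h2 := (h1.div (hasDerivAt_id x) hx.ne').log (div_ne_zero hp.ne' hx.ne')
  have he := Real.exp_pos x
  have h3 : Real.exp x - 1 ≠ 0 := by have := Real.add_one_lt_exp hx.ne'; linarith
  have h4 : 1 - (Real.exp x)⁻¹ = (Real.exp x - 1) / Real.exp x := by field_simp
  have key : (Real.exp (-x) * x - (1 - Real.exp (-x)) * 1) / x ^ 2 / ((1 - Real.exp (-x)) / x) =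
      1 / (Real.exp x - 1) - 1 / x := by
    rw [Real.exp_neg, h4]
    field_simp
  rw [← key]
  exact h2

lemma log_O (N : ℕ) : (fun x : ℝ => ((Real.log ((1 - Real.exp (-x)) / x) : ℝ) : ℂ) / x
      - ∑ n ∈ Finset.range N, (zc n * (-1) ^ n / (n+1)) * (x:ℂ)^n)
      =O[𝓝[>] (0:ℝ)] fun x : ℝ => x ^ N := by
  apply dropO
  apply toO
  obtain ⟨C, hC⟩ := expn N
  refine ⟨C / (N+1), fun x hx hx1 => ?_⟩
  have hx' : (x:ℂ) ≠ 0 := by exact_mod_cast hx.ne'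
  set f : ℝ → ℂ := fun y => ((Real.log ((1 - Real.exp (-y)) / y) : ℝ) : ℂ)
      - ∑ n ∈ Finset.range (N+1), (zc n * (-1) ^ n / (n+1)) * (y:ℂ)^(n+1) with hf
  have hder : ∀ y, 0 < y → HasDerivAt f (((1 / (Real.exp y - 1) : ℝ) : ℂ) - ((1 / y : ℂ)
      + ∑ n ∈ Finset.range (N+1), zc n * (-1) ^ n * y^n)) y := by
    intro y hy
    have h1 := (log_deriv' hy).ofReal_comp
    have h2 : HasDerivAt (fun y : ℝ => ∑ n ∈ Finset.range (N+1), (zc n * (-1) ^ n / (n+1)) * (y:ℂ)^(n+1))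
        (∑ n ∈ Finset.range (N+1), zc n * (-1) ^ n * y^n) y := by
      refine HasDerivAt.fun_sum fun n _ => ?_
      have h3 := ((hasDerivAt_pow (n+1) (y:ℂ)).const_mul (zc n * (-1) ^ n / (n+1))).comp_ofReal
      have h4 : (zc n * (-1) ^ n / (n+1)) * (((n+1 : ℕ) : ℂ) * (y:ℂ)^(n+1-1)) = zc n * (-1) ^ n * y^n := by
        have : (n + 1 : ℂ) ≠ 0 := by exact_mod_cast n.succ_ne_zero
        rw [Nat.add_sub_cancel]
        push_cast
        field_simp
      rw [h4] at h3
      exact h3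
    have h5 := h1.sub h2
    rw [← sub_sub]
    push_cast at h5 ⊢
    exact h5
  have hlim : Tendsto f (𝓝[>] 0) (𝓝 0) := by
    have h1 : Tendsto (fun x : ℝ => ((Real.log ((1 - Real.exp (-x)) / x) : ℝ) : ℂ)) (𝓝[>] 0) (𝓝 ((0:ℝ):ℂ)) :=
      (Complex.continuous_ofReal.tendsto 0).comp log_lim
    have hc : Continuous (fun y : ℝ => ∑ n ∈ Finset.range (N+1), (zc n * (-1) ^ n / (n+1)) * (y:ℂ)^(n+1)) := by
      fun_prop
    have h2 := (hc.tendsto 0).mono_left (nhdsWithin_le_nhds (s := Set.Ioi 0))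
    have h3 := h1.sub h2
    simpa using h3
  have hb : ∀ a, 0 < a → a < x → ‖f x‖ ≤ ‖f a‖ + (C / (N+1) * x^(N+1) - C / (N+1) * a^(N+1)) := by
    intro a ha hax
    refine image_norm_le_of_norm_deriv_right_le_deriv_boundary (a := a) (b := x)
      (B := fun y => ‖f a‖ + (C / (N+1) * y^(N+1) - C / (N+1) * a^(N+1))) (B' := fun y => C * y^N)
      (fun y hy => (hder y (ha.trans_le hy.1)).continuousAt.continuousWithinAt)
      (fun y hy => (hder y (ha.trans_le hy.1)).hasDerivWithinAt) (by simp) ?_ ?_ ⟨hax.le, le_rfl⟩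
    · intro y
      have h1 := (((hasDerivAt_pow (N+1) y).const_mul (C / (N+1))).sub_const (C / (N+1) * a^(N+1))).const_add ‖f a‖
      have h4 : C / (N+1) * (((N+1 : ℕ) : ℝ) * y^(N+1-1)) = C * y^N := by
        rw [Nat.add_sub_cancel]
        push_cast
        field_simp
      rw [h4] at h1
      exact h1
    · intro y hy
      exact hC y (ha.trans_le hy.1) (hy.2.le.trans hx1)
  have hfx : ‖f x‖ ≤ C / (N+1) * x^(N+1) := by
    have h1 : Tendsto (fun a : ℝ => ‖f a‖ + (C / (N+1) * x^(N+1) - C / (N+1) * a^(N+1))) (𝓝[>] 0)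
        (𝓝 (‖(0:ℂ)‖ + (C / (N+1) * x^(N+1) - C / (N+1) * 0^(N+1)))) := by
      refine hlim.norm.add (tendsto_const_nhds.sub ?_)
      have hc : Continuous (fun a : ℝ => C / (N+1) * a^(N+1)) := by fun_prop
      exact (hc.tendsto 0).mono_left nhdsWithin_le_nhds
    have h2 := ge_of_tendsto h1 (by
      filter_upwards [Ioo_mem_nhdsGT hx] with a ha using hb a ha.1 ha.2)
    simpa using h2
  have e : f x = x * (((Real.log ((1 - Real.exp (-x)) / x) : ℝ) : ℂ) / x
      - ∑ n ∈ Finset.range (N+1), (zc n * (-1) ^ n / (n+1)) * (x:ℂ)^n) := by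
    simp only [hf]
    rw [mul_sub, Finset.mul_sum, mul_div_cancel₀ _ hx']
    congr 1
    exact Finset.sum_congr rfl fun n _ => by ring
  rw [e, norm_mul, Complex.norm_real, Real.norm_of_nonneg hx.le] at hfx
  refine le_of_mul_le_mul_left (hfx.trans (le_of_eq ?_)) hx
  ring

lemma F_eq {x : ℝ} (hx : 0 < x) :
    (∑' n : ℕ, (((n + 1).divisors.card : ℂ)) *
            Complex.exp (-((n + 1 : ℕ) : ℂ) * (x : ℂ))) =
    (∑' m : ℕ, HH ((((m:ℝ)+1) * x : ℝ) : ℂ)) - ((Real.log (1 - Real.exp (-x)) : ℝ) : ℂ) / x := by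
  have hx' : (x:ℂ) ≠ 0 := by exact_mod_cast hx.ne'
  set r : ℂ := Complex.exp (-(x:ℂ)) with hr
  have hr1 : ‖r‖ < 1 := by
    rw [hr, Complex.norm_exp]; simp [hx]
  have hrp : ∀ n : ℕ, Complex.exp (-((n : ℕ) : ℂ) * (x : ℂ)) = r ^ n := by
    intro n; rw [hr, ← Complex.exp_nat_mul]; ring_nf
  have h1 := tsum_pow_div_one_sub_eq_tsum_sigma hr1 0
  rw [tsum_pnat_eq_tsum_succ (f := fun n : ℕ => (n:ℂ) ^ 0 * r ^ n / (1 - r ^ n)),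
    tsum_pnat_eq_tsum_succ (f := fun n : ℕ => (ArithmeticFunction.sigma 0 n : ℂ) * r ^ n)] at h1
  simp only [ArithmeticFunction.sigma_zero_apply, pow_zero, one_mul] at h1
  simp_rw [hrp]
  rw [← h1]
  have hlog : HasSum (fun m : ℕ => ((Real.exp (-(((m:ℝ)+1) * x)) : ℝ) : ℂ) / ((((m:ℝ)+1) * x : ℝ) : ℂ))
      (-((Real.log (1 - Real.exp (-x)) : ℝ) : ℂ) / x) := by
    have h2 := Real.hasSum_pow_div_log_of_abs_lt_one (x := Real.exp (-x))
      (by rw [abs_of_pos (Real.exp_pos _)]; exact Real.exp_lt_one_iff.2 (by linarith))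
    have h3 := (Complex.hasSum_ofReal.2 h2).div_const (x:ℂ)
    have e1 : (fun m : ℕ => ((Real.exp (-(((m:ℝ)+1) * x)) : ℝ) : ℂ) / ((((m:ℝ)+1) * x : ℝ) : ℂ)) =
       fun m : ℕ => ((Real.exp (-x) ^ (m+1) / ((m:ℝ)+1) : ℝ) : ℂ) / (x:ℂ) := by
      ext m
      rw [← Real.exp_nat_mul]
      push_cast
      rw [div_div]
      ring_nf
    rw [e1]
    push_cast at h3 ⊢
    exact h3
  have hH : Summable (fun m : ℕ => HH ((((m:ℝ)+1) * x : ℝ) : ℂ)) := by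
    simpa using nice_HH.summable 0 hx
  have e2 : ∀ m : ℕ, r ^ (m+1) / (1 - r ^ (m+1)) = HH ((((m:ℝ)+1) * x : ℝ) : ℂ) +
      ((Real.exp (-(((m:ℝ)+1) * x)) : ℝ) : ℂ) / ((((m:ℝ)+1) * x : ℝ) : ℂ) := by
    intro m
    have ht : 0 < ((m:ℝ)+1) * x := by positivity
    rw [HH_real ht, sub_add_cancel, ← hrp]
    have h3 : Real.exp (((m:ℝ)+1) * x) - 1 ≠ 0 := by have := Real.add_one_lt_exp ht.ne'; linarith
    have e3 : Complex.exp (-((m + 1 : ℕ) : ℂ) * (x : ℂ)) = ((Real.exp (((m:ℝ)+1) * x) : ℝ) : ℂ)⁻¹ := by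
      push_cast; rw [← Complex.exp_neg]; ring_nf
    have h4 : ((Real.exp (((m:ℝ)+1) * x) : ℝ) : ℂ) ≠ 0 := by exact_mod_cast (Real.exp_pos _).ne'
    rw [e3, Complex.ofReal_div, Complex.ofReal_sub, Complex.ofReal_one]
    have h5 : ((Real.exp (((m:ℝ)+1) * x) : ℝ) : ℂ) - 1 ≠ 0 := by exact_mod_cast h3
    have h6 : 1 - ((Real.exp (((m:ℝ)+1) * x) : ℝ) : ℂ)⁻¹ = (((Real.exp (((m:ℝ)+1) * x) : ℝ) : ℂ) - 1) / ((Real.exp (((m:ℝ)+1) * x) : ℝ) : ℂ) := by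
      field_simp
    rw [h6]
    field_simp
  simp_rw [e2]
  rw [hH.tsum_add hlog.summable, hlog.tsum_eq]
  ring

theorem statement5 (N : ℕ) (hN : 1 ≤ N) :
    (fun x : ℝ =>
        (∑' n : ℕ, (((n + 1).divisors.card : ℂ)) *
            Complex.exp (-((n + 1 : ℕ) : ℂ) * (x : ℂ))) -
          ((((Real.eulerMascheroniConstant - Real.log x : ℝ)) : ℂ) / (x : ℂ) + 1 / 4 +
            ∑ n ∈ Finset.Ioo 0 N,
              (riemannZeta (-(n : ℂ))) ^ 2 / (n.factorial : ℂ) * (-(x : ℂ)) ^ n))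
      =O[𝓝[>] (0:ℝ)] fun x : ℝ => x ^ N := by
  have hA : (fun x : ℝ => ((∑' m : ℕ, HH ((((m:ℝ)+1) * x : ℝ) : ℂ)) -
      (1 / x : ℂ) * (Real.eulerMascheroniConstant : ℂ))
      - ∑ n ∈ Finset.range N, (zc n * iteratedDeriv n HH ((0:ℝ):ℂ)) * (x:ℂ)^n)
      =O[𝓝[>] (0:ℝ)] fun x : ℝ => x ^ N := by
    apply dropO
    apply toO
    obtain ⟨C, hC⟩ := em_bound nice_HH N
    refine ⟨C, fun x h0 h1 => ?_⟩
    have := hC x h0 h1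
    simp only [iteratedDeriv_zero] at this
    rw [HH_integral, ← sub_sub] at this
    exact this
  refine (hA.sub (log_O N)).congr' ?_ (EventuallyEq.refl _ _)
  filter_upwards [self_mem_nhdsWithin] with x hx
  have hx : 0 < x := hx
  have hsum : (1 / 4 : ℂ) + ∑ n ∈ Finset.Ioo 0 N,
      (riemannZeta (-(n : ℂ))) ^ 2 / (n.factorial : ℂ) * (-(x : ℂ)) ^ n =
      ∑ n ∈ Finset.range N, (zc n * iteratedDeriv n HH ((0:ℝ):ℂ)) * (x:ℂ)^n -
      ∑ n ∈ Finset.range N, (zc n * (-1) ^ n / (n+1)) * (x:ℂ)^n := by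
    rw [← Finset.sum_sub_distrib]
    have e1 : ∀ n, (zc n * iteratedDeriv n HH ((0:ℝ):ℂ)) * (x:ℂ)^n - (zc n * (-1) ^ n / (n+1)) * (x:ℂ)^n
        = (riemannZeta (-(n : ℂ))) ^ 2 / (n.factorial : ℂ) * (-(x : ℂ)) ^ n := by
      intro n
      have h1 : (n.factorial : ℂ) ≠ 0 := by exact_mod_cast n.factorial_ne_zero
      have h2 : (n + 1 : ℂ) ≠ 0 := by exact_mod_cast n.succ_ne_zero
      rw [coef, neg_pow, zc, Nat.factorial_succ]
      push_cast
      field_simp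
      ring
    simp_rw [e1]
    rw [Finset.range_eq_Ico, Finset.sum_eq_sum_Ico_succ_bot (by omega)]
    have : Finset.Ioo 0 N = Finset.Ico (0+1) N := by ext; simp; omega
    rw [this]
    congr 1
    simp [riemannZeta_zero]
    norm_num
  rw [F_eq hx, add_assoc, hsum, Real.log_div (one_sub_exp_pos hx).ne' hx.ne']
  push_cast
  ring
end

section
/- Let d(n) denote the number of positive divisors of n and define f : ℍ → ℂ by f(z) = 1 − 4∑_{n≥1} d(n) e^{2πinz}. Define ψ : ℍ → ℂ by ψ(z) = f(z) − z^{−1} f(−1/z). Then there exists a function Ψ, analytic on the cut plane ℂ' = ℂ ∖ (−∞, 0], such that Ψ(z) = ψ(z) for all z ∈ ℍ. -/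
noncomputable section

/-- The holomorphic periodic function `f(z) = 1 − 4 ∑_{n≥1} d(n) e^{2πinz}`
attached to the real-analytic Eisenstein series `E_{1/2}`. -/
def eisPeriodic (z : ℂ) : ℂ :=
  1 - 4 * ∑' n : ℕ, (((n + 1).divisors.card : ℂ)) *
    Complex.exp (2 * Real.pi * Complex.I * ((n : ℂ) + 1) * z)

open Complex Filter Topology

def chiF (w : ℂ) : ℂ := Complex.log (w + 1) - Complex.log w - (1 / w + 1 / (w + 1)) / 2

def bigF (z : ℂ) : ℂ := ∑' p : ℕ × ℕ, chiF (((p.1 : ℂ) + 1) * z + p.2)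

lemma slit_add_nonneg {w : ℂ} (hw : w ∈ slitPlane) {r : ℝ} (hr : 0 ≤ r) : w + r ∈ slitPlane := by
  rw [mem_slitPlane_iff] at *
  rcases hw with h | h
  · left; simp; linarith
  · right; simpa using h

lemma slit_add_nat {w : ℂ} (hw : w ∈ slitPlane) (n : ℕ) : w + n ∈ slitPlane := by
  simpa using slit_add_nonneg hw (Nat.cast_nonneg (α := ℝ) n)

lemma slit_add_one {w : ℂ} (hw : w ∈ slitPlane) : w + 1 ∈ slitPlane := by
  simpa using slit_add_nat hw 1

lemma slit_mul_pos {w : ℂ} (hw : w ∈ slitPlane) {r : ℝ} (hr : 0 < r) : (r : ℂ) * w ∈ slitPlane := by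
  rw [mem_slitPlane_iff] at *
  rcases hw with h | h
  · left; simp; positivity
  · right; simp; exact ⟨hr.ne', h⟩

lemma slit_arg {z : ℂ} (hz : z ∈ slitPlane) (p : ℕ × ℕ) :
    ((p.1 : ℂ) + 1) * z + p.2 ∈ slitPlane := by
  have := slit_mul_pos hz (r := (p.1 : ℝ) + 1) (by positivity)
  push_cast at this
  exact slit_add_nat this _

lemma log_one_add_inv {w : ℂ} (hw : w ∈ slitPlane) :
    Complex.log (1 + 1 / w) = Complex.log (w + 1) - Complex.log w := by
  have h0 : w ≠ 0 := slitPlane_ne_zero hw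
  have h1 : w + 1 ≠ 0 := slitPlane_ne_zero (slit_add_one hw)
  have key : -Real.pi < (Complex.log (w + 1) - Complex.log w).im ∧
      (Complex.log (w + 1) - Complex.log w).im ≤ Real.pi := by
    simp only [sub_im, log_im]
    have a1 := arg_le_pi w
    have a2 := neg_pi_lt_arg w
    have a3 := arg_le_pi (w+1)
    have a4 := neg_pi_lt_arg (w+1)
    have a5 := (mem_slitPlane_iff_arg.1 hw).1
    have a6 : arg w < Real.pi := lt_of_le_of_ne a1 a5
    rcases le_or_gt 0 w.im with h | h
    · have b1 := arg_nonneg_iff.2 h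
      have b2 := arg_nonneg_iff.2 (show 0 ≤ (w+1).im by simpa using h)
      constructor <;> linarith
    · have b1 := arg_neg_iff.2 h
      have b2 := arg_neg_iff.2 (show (w+1).im < 0 by simpa using h)
      constructor <;> linarith
  rw [← Complex.log_exp key.1 key.2, Complex.exp_sub, Complex.exp_log h0, Complex.exp_log h1]
  congr 1
  field_simp

lemma chiF_bound {w : ℂ} (hw : w ∈ slitPlane) (h2 : 2 ≤ ‖w‖) : ‖chiF w‖ ≤ 2 * (1 / ‖w‖) ^ 3 := by
  have h0 : w ≠ 0 := slitPlane_ne_zero hw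
  have h1 : w + 1 ≠ 0 := slitPlane_ne_zero (slit_add_one hw)
  set u : ℂ := 1 / w with hu
  have hun : ‖u‖ = 1 / ‖w‖ := by simp [hu]
  have hu2 : ‖u‖ ≤ 1 / 2 := by
    rw [hun]; exact one_div_le_one_div_of_le (by norm_num) h2
  have h1u : 1 + u ≠ 0 := by
    intro h
    apply h1
    rw [hu] at h
    field_simp at h
    simpa using h
  have e : chiF w = (Complex.log (1 + u) - logTaylor 3 u) - u ^ 3 / (1 + u) / 2 := by
    have : 1 / (w + 1) = u / (1 + u) := by
      rw [hu]; field_simp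
    rw [chiF, ← log_one_add_inv hw, this, ← hu]
    simp only [logTaylor, Finset.sum_range_succ, Finset.sum_range_zero]
    push_cast
    field_simp
    ring
  have b1 := norm_log_sub_logTaylor_le 2 (z := u) (by linarith)
  norm_num at b1
  have b2 : (1:ℝ)/2 ≤ ‖1 + u‖ := by
    have := norm_sub_norm_le (1 : ℂ) (-u)
    simp only [norm_one, norm_neg, sub_neg_eq_add] at this
    linarith
  have b3 : (1 - ‖u‖)⁻¹ ≤ 2 := by
    rw [inv_le_comm₀ (by linarith) (by norm_num)]; linarith
  have b4 : ‖u ^ 3 / (1 + u) / 2‖ ≤ ‖u‖ ^ 3 := by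
    rw [norm_div, norm_div, norm_pow, Complex.norm_ofNat, div_div, div_le_iff₀ (by positivity)]
    have : 0 ≤ ‖u‖ ^ 3 := by positivity
    nlinarith
  rw [← hun, e]
  refine (norm_sub_le _ _).trans ?_
  have : ‖u‖ ^ 3 * (1 - ‖u‖)⁻¹ ≤ ‖u‖ ^ 3 * 2 := by gcongr
  have : 0 ≤ ‖u‖ ^ 3 := by positivity
  linarith

lemma chiF_cont : ContinuousOn chiF slitPlane := by
  intro w hw
  apply ContinuousAt.continuousWithinAt
  have h1 := slit_add_one hw
  have : ContinuousAt (fun w : ℂ => Complex.log (w+1)) w :=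
    ContinuousAt.clog (by fun_prop) h1
  have : ContinuousAt (fun w : ℂ => Complex.log w) w := continuousAt_clog hw
  have := slitPlane_ne_zero hw
  have := slitPlane_ne_zero h1
  unfold chiF
  fun_prop (disch := assumption)

lemma chiF_diff {w : ℂ} (hw : w ∈ slitPlane) : DifferentiableAt ℂ chiF w := by
  have h1 := slit_add_one hw
  have : DifferentiableAt ℂ (fun w : ℂ => Complex.log (w+1)) w :=
    DifferentiableAt.clog (by fun_prop) h1
  have : DifferentiableAt ℂ (fun w : ℂ => Complex.log w) w := differentiableAt_log hw
  have := slitPlane_ne_zero hw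
  have := slitPlane_ne_zero h1
  unfold chiF
  fun_prop (disch := assumption)

lemma chiF_unif {L : Set ℂ} (hL : IsCompact L) (hs : L ⊆ slitPlane) :
    ∃ C : ℝ, ∀ v ∈ L, ∀ r : ℝ, 1 ≤ r → ‖chiF (r * v)‖ ≤ C * (1 / r) ^ 3 := by
  rcases L.eq_empty_or_nonempty with rfl | hne
  · exact ⟨0, by simp⟩
  obtain ⟨v0, hv0, hmin⟩ := hL.exists_isMinOn hne (f := fun v => ‖v‖) (by fun_prop)
  have hc : 0 < ‖v0‖ := norm_pos_iff.2 (slitPlane_ne_zero (hs hv0))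
  set c := ‖v0‖
  set R := 2 / c with hR
  obtain ⟨B, hB⟩ := ((isCompact_Icc (a := (1:ℝ)) (b := R)).prod hL).exists_bound_of_continuousOn
    (f := fun p : ℝ × ℂ => chiF (p.1 * p.2)) (by
      apply chiF_cont.comp (by fun_prop)
      rintro ⟨r, v⟩ ⟨hr, hv⟩
      exact slit_mul_pos (hs hv) (by linarith [hr.1]))
  refine ⟨max (|B| * R ^ 3) (2 * (1 / c) ^ 3), fun v hv r hr => ?_⟩
  have hr0 : 0 < r := by linarith
  have hvc : c ≤ ‖v‖ := hmin hv
  rcases le_or_gt r R with h | h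
  · have h1 := hB (r, v) ⟨⟨hr, h⟩, hv⟩
    have : |B| ≤ (|B| * R ^ 3) * (1 / r) ^ 3 := by
      rw [mul_assoc, ← mul_pow]
      have : 1 ≤ R * (1 / r) := by rw [mul_one_div, one_le_div hr0]; exact h
      exact le_mul_of_one_le_right (abs_nonneg _) (one_le_pow₀ this)
    calc _ ≤ B := h1
      _ ≤ |B| := le_abs_self _
      _ ≤ _ := this
      _ ≤ _ := by gcongr; exact le_max_left _ _
  · have hn : ‖(r : ℂ) * v‖ = r * ‖v‖ := by
      rw [norm_mul, norm_real, Real.norm_of_nonneg hr0.le]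
    have hrc : r * c ≤ ‖(r : ℂ) * v‖ := by rw [hn]; gcongr
    have h2 : 2 < r * c := by rw [hR, div_lt_iff₀ hc] at h; exact h
    refine (chiF_bound (slit_mul_pos (hs hv) hr0) (by linarith)).trans ?_
    calc _ ≤ 2 * (1 / (r * c)) ^ 3 := by gcongr
      _ = (2 * (1 / c) ^ 3) * (1 / r) ^ 3 := by field_simp
      _ ≤ _ := by gcongr; exact le_max_right _ _

lemma summable_box : Summable fun p : ℕ × ℕ => (1 / ((p.1 : ℝ) + 1 + p.2)) ^ 3 := by
  have h1 : Summable fun n : ℕ => 1 / ((n : ℝ) + 1) ^ (3 / 2 : ℝ) := by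
    have := (summable_nat_add_iff 1).2 (Real.summable_one_div_nat_rpow.2 (show (1:ℝ) < 3/2 by norm_num))
    simpa using this
  have h2 := h1.mul_of_nonneg h1 (fun n => by positivity) (fun n => by positivity)
  refine Summable.of_nonneg_of_le (fun p => by positivity) (fun p => ?_) h2
  rw [one_div_pow, one_div_mul_one_div]
  apply one_div_le_one_div_of_le (by positivity)
  rw [← Real.mul_rpow (by positivity) (by positivity)]
  have : ((p.1 : ℝ) + 1 + p.2) ^ 3 = (((p.1 : ℝ) + 1 + p.2) ^ 2) ^ (3 / 2 : ℝ) := by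
    rw [← Real.rpow_natCast, ← Real.rpow_natCast, ← Real.rpow_mul (by positivity)]
    norm_num
  rw [this]
  have a : (0:ℝ) ≤ p.1 := by positivity
  have b : (0:ℝ) ≤ p.2 := by positivity
  gcongr
  nlinarith

lemma bigF_local {K : Set ℂ} (hK : IsCompact K) (hs : K ⊆ slitPlane) :
    ∃ C : ℝ, ∀ z ∈ K, ∀ p : ℕ × ℕ, ‖chiF (((p.1 : ℂ) + 1) * z + p.2)‖ ≤
      C * (1 / ((p.1 : ℝ) + 1 + p.2)) ^ 3 := by
  obtain ⟨C, hC⟩ := chiF_unif (L := (fun q : ℝ × ℂ => (q.1 : ℂ) * q.2 + (1 - q.1 : ℝ)) '' (Set.Ioc 0 1 ∪ {0} ) ×ˢ K)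
    (by
      have : (Set.Ioc 0 1 ∪ {0} : Set ℝ) = Set.Icc 0 1 := by
        ext x; simp
      rw [this]
      exact (isCompact_Icc.prod hK).image (by fun_prop))
    (by
      rintro _ ⟨⟨s, z⟩, ⟨h, hz⟩, rfl⟩
      rcases h with h | h
      · exact slit_add_nonneg (slit_mul_pos (hs hz) h.1) (by linarith [h.2])
      · simp at h; subst h; simp)
  refine ⟨C, fun z hz p => ?_⟩
  have h0 : (0:ℝ) < (p.1 : ℝ) + 1 + p.2 := by positivity
  have h0' : ((p.1 : ℂ) + 1 + p.2) ≠ 0 := by exact_mod_cast h0.ne'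
  have := hC _ ⟨(((p.1 : ℝ) + 1) / ((p.1 : ℝ) + 1 + p.2), z), ⟨Or.inl ⟨by positivity, ?_⟩, hz⟩, rfl⟩
    ((p.1 : ℝ) + 1 + p.2) (by
      have : (0:ℝ) ≤ p.1 := by positivity
      have : (0:ℝ) ≤ p.2 := by positivity
      linarith)
  · convert this using 3
    push_cast
    field_simp
    ring
  · rw [div_le_one h0]; simp

lemma bigF_summable {z : ℂ} (hz : z ∈ slitPlane) :
    Summable fun p : ℕ × ℕ => chiF (((p.1 : ℂ) + 1) * z + p.2) := by
  obtain ⟨C, hC⟩ := bigF_local (K := {z}) isCompact_singleton (by simpa using hz)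
  exact Summable.of_norm_bounded (summable_box.mul_left C) (fun p => hC z rfl p)

lemma bigF_diff {z : ℂ} (hz : z ∈ slitPlane) : DifferentiableAt ℂ bigF z := by
  obtain ⟨ε, hε, hb⟩ := Metric.nhds_basis_closedBall.mem_iff.1 (isOpen_slitPlane.mem_nhds hz)
  obtain ⟨C, hC⟩ := bigF_local (isCompact_closedBall z ε) hb
  have := Complex.differentiableOn_tsum_of_summable_norm (U := Metric.ball z ε)
    (F := fun (p : ℕ × ℕ) (z : ℂ) => chiF (((p.1 : ℂ) + 1) * z + p.2))
    (summable_box.mul_left C) (fun p w hw => by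
      apply DifferentiableAt.differentiableWithinAt
      exact (chiF_diff (slit_arg (hb (Metric.ball_subset_closedBall hw)) p)).comp
        (f := fun z : ℂ => ((p.1 : ℂ) + 1) * z + p.2) w (by fun_prop)) Metric.isOpen_ball
    (fun p w hw => hC w (Metric.ball_subset_closedBall hw) p)
  exact this.differentiableAt (Metric.ball_mem_nhds z hε)

lemma chiF_telescope (w : ℂ) (N : ℕ) : ∑ n ∈ Finset.range N, chiF (w + n) =
    Complex.log (w + N) - Complex.log w - 1 / w / 2 + 1 / (w + N) / 2
      - ∑ n ∈ Finset.range N, 1 / (w + (n + 1)) := by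
  induction N with
  | zero => simp
  | succ N ih =>
    rw [Finset.sum_range_succ, ih, Finset.sum_range_succ, chiF]
    push_cast
    rw [add_assoc w]
    ring

lemma log_diff_tendsto (w : ℂ) (hw : w ∈ slitPlane) :
    Tendsto (fun N : ℕ => Complex.log (w + N) - Complex.log (N : ℂ)) atTop (𝓝 0) := by
  have h1 : Tendsto (fun N : ℕ => 1 + w / (N : ℂ)) atTop (𝓝 1) := by
    simpa using (tendsto_const_div_atTop_nhds_zero_nat w).const_add 1
  have h2 : Tendsto (fun N : ℕ => Complex.log (1 + w / (N : ℂ))) atTop (𝓝 0) := by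
    have := (continuousAt_clog (one_mem_slitPlane)).tendsto.comp h1
    rw [Complex.log_one] at this
    exact this
  refine h2.congr' ?_
  filter_upwards [eventually_gt_atTop 0] with N hN
  have hN' : (0:ℝ) < N := by exact_mod_cast hN
  have e : w + N = ((N : ℝ) : ℂ) * (1 + w / N) := by
    push_cast
    have : (N : ℂ) ≠ 0 := by exact_mod_cast hN.ne'
    field_simp; ring
  have hne : 1 + w / N ≠ 0 := by
    intro h
    rw [h, mul_zero] at e
    exact slitPlane_ne_zero (slit_add_nat hw N) e
  rw [e, Complex.log_ofReal_mul hN' hne, ofReal_log hN'.le]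
  simp

lemma inv_add_tendsto (w : ℂ) : Tendsto (fun N : ℕ => 1 / (w + N)) atTop (𝓝 0) := by
  have h1 : Tendsto (fun N : ℕ => 1 + w / (N : ℂ)) atTop (𝓝 1) := by
    simpa using (tendsto_const_div_atTop_nhds_zero_nat w).const_add 1
  have h2 := (tendsto_const_div_atTop_nhds_zero_nat (1 : ℂ)).div h1 one_ne_zero
  rw [zero_div] at h2
  refine h2.congr' ?_
  filter_upwards [eventually_gt_atTop 0] with N hN
  have : (N : ℂ) ≠ 0 := by exact_mod_cast hN.ne'
  simp only [Pi.div_apply]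
  rw [div_div]
  congr 1
  field_simp
  ring

lemma phi_cot {w : ℂ} (hw : 0 < w.im) :
    ∑' n : ℕ, chiF (w + n) - ∑' n : ℕ, chiF (-w + n) =
      2 * Real.pi * I * ∑' n : ℕ, Complex.exp (2 * Real.pi * I * w) ^ (n + 1) := by
  have hs1 : w ∈ slitPlane := mem_slitPlane_iff.2 (Or.inr hw.ne')
  have hs2 : -w ∈ slitPlane := mem_slitPlane_iff.2 (Or.inr (by simpa using hw.ne'))
  have sm (z : ℂ) (hz : z ∈ slitPlane) : Summable fun n : ℕ => chiF (z + n) := by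
    have := (bigF_summable hz).prod_factor 0
    simpa using this
  have t1 := ((sm w hs1).hasSum.tendsto_sum_nat).sub ((sm _ hs2).hasSum.tendsto_sum_nat)
  have hZ : w ∈ integerComplement := UpperHalfPlane.coe_mem_integerComplement ⟨w, hw⟩
  have t2 := tendsto_logDeriv_euler_cot_sub hZ
  have t3 := ((((log_diff_tendsto w hs1).sub (log_diff_tendsto _ hs2)).add
    ((inv_add_tendsto w).div_const 2)).sub ((inv_add_tendsto (-w)).div_const 2)).sub t2
  have t4 := t3.add_const (Complex.log (-w) - Complex.log w - 1 / w)
  have hlog : Complex.log (-w) = Complex.log w - Real.pi * I := by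
    rw [Complex.log, Complex.log, norm_neg, arg_neg_eq_arg_sub_pi_of_im_pos hw]
    push_cast; ring
  have := tendsto_nhds_unique t1 (t4.congr (fun N => by
    simp only [chiF_telescope]
    have : ∑ j ∈ Finset.range N, cotTerm w j = ∑ n ∈ Finset.range N, 1 / (w + (n + 1))
        - ∑ n ∈ Finset.range N, 1 / (-w + ((n : ℂ) + 1)) := by
      rw [← Finset.sum_sub_distrib]
      apply Finset.sum_congr rfl
      intro n _
      rw [cotTerm, show -w + ((n : ℂ) + 1) = -(w - (n + 1)) by ring, one_div_neg_eq_neg_one_div]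
      ring
    rw [this, one_div_neg_eq_neg_one_div]
    ring))
  rw [this, hlog]
  have hq := pi_mul_cot_pi_q_exp ⟨w, hw⟩
  simp only at hq
  have hn : ‖Complex.exp (2 * Real.pi * I * w)‖ < 1 := by
    have := UpperHalfPlane.norm_exp_two_pi_I_lt_one ⟨w, hw⟩
    simpa using this
  rw [(summable_geometric_of_norm_lt_one hn).tsum_eq_zero_add] at hq
  rw [hq]
  ring

def eisS (z : ℂ) : ℂ := ∑' n : ℕ, (((n + 1).divisors.card : ℂ)) *
    Complex.exp (2 * Real.pi * Complex.I * ((n : ℂ) + 1) * z)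

lemma eisS_eq {z : ℂ} (hz : 0 < z.im) : 2 * Real.pi * I * eisS z = bigF z - bigF (-z) := by
  have hs1 : z ∈ slitPlane := mem_slitPlane_iff.2 (Or.inr hz.ne')
  have hs2 : -z ∈ slitPlane := mem_slitPlane_iff.2 (Or.inr (by simpa using hz.ne'))
  have hn : ‖Complex.exp (2 * Real.pi * I * z)‖ < 1 := by
    have := UpperHalfPlane.norm_exp_two_pi_I_lt_one ⟨z, hz⟩
    simpa using this
  set r := Complex.exp (2 * Real.pi * I * z) with hr
  have h1 := tsum_prod_pow_eq_tsum_sigma 0 hn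
  have e1 : eisS z = ∑' e : ℕ+, (ArithmeticFunction.sigma 0 e : ℂ) * r ^ (e : ℕ) := by
    rw [tsum_pnat_eq_tsum_succ (f := fun n : ℕ => (ArithmeticFunction.sigma 0 n : ℂ) * r ^ n)]
    unfold eisS
    apply tsum_congr
    intro n
    rw [ArithmeticFunction.sigma_zero_apply, hr, ← Complex.exp_nat_mul]
    congr 2
    push_cast; ring
  have e2 : ∑' d : ℕ+, ∑' c : ℕ+, (c : ℂ) ^ 0 * r ^ (d * c : ℕ) =
      ∑' m : ℕ, ∑' n : ℕ, (Complex.exp (2 * Real.pi * I * (((m : ℂ) + 1) * z))) ^ (n + 1) := by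
    rw [tsum_pnat_eq_tsum_succ (f := fun d : ℕ => ∑' c : ℕ+, (c : ℂ) ^ 0 * r ^ (d * c : ℕ))]
    apply tsum_congr
    intro m
    rw [tsum_pnat_eq_tsum_succ (f := fun c : ℕ => (c : ℂ) ^ 0 * r ^ ((m + 1) * c : ℕ))]
    apply tsum_congr
    intro n
    rw [pow_zero, one_mul, pow_mul, hr, ← Complex.exp_nat_mul]
    congr 2
    push_cast; ring
  rw [e1, ← h1, e2, ← tsum_mul_left]
  unfold bigF
  rw [(bigF_summable hs1).tsum_prod, (bigF_summable hs2).tsum_prod,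
    ← (bigF_summable hs1).prod.tsum_sub (bigF_summable hs2).prod]
  apply tsum_congr
  intro m
  rw [← phi_cot]
  · simp
  · have : (((m : ℂ) + 1) * z).im = ((m : ℝ) + 1) * z.im := by simp
    rw [this]; positivity

/-! Guinand at rationals -/

def Hs (n : ℕ) : ℝ := ∑ i ∈ Finset.range n, 1 / ((i : ℝ) + 1)

def As (n : ℕ) : ℝ := Real.log ((2 * n).factorial) - 2 * Real.log (n.factorial)

def chiR (w : ℝ) : ℝ := Real.log (w + 1) - Real.log w - (1 / w + 1 / (w + 1)) / 2

lemma chiF_ofReal {w : ℝ} (hw : 0 ≤ w) : chiF w = (chiR w : ℂ) := by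
  unfold chiF chiR
  push_cast
  rw [ofReal_log (by linarith), ofReal_log hw]
  push_cast
  rfl

lemma chiR_telescope (w : ℝ) (N : ℕ) : ∑ n ∈ Finset.range N, chiR (w + n) =
    Real.log (w + N) - Real.log w - 1 / w / 2 + 1 / (w + N) / 2
      - ∑ n ∈ Finset.range N, 1 / (w + (n + 1)) := by
  induction N with
  | zero => simp
  | succ N ih =>
    rw [Finset.sum_range_succ, ih, Finset.sum_range_succ, chiR]
    push_cast
    rw [add_assoc w]
    ring

lemma log_fact (n : ℕ) : Real.log (n.factorial) = ∑ i ∈ Finset.range n, Real.log ((i : ℝ) + 1) := by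
  induction n with
  | zero => simp
  | succ n ih =>
    rw [Finset.sum_range_succ, ← ih, Nat.factorial_succ]
    push_cast
    rw [Real.log_mul (by positivity) (by positivity)]
    ring

lemma box_sum {M N : ℕ} (hM : 0 < M) (hN : 0 < N) (x : ℝ) (hx : x = N / M) :
    ∑ m ∈ Finset.range M, ∑ n ∈ Finset.range N, chiR (((m : ℝ) + 1) * x + n) =
      As M + (Hs (2 * M) - 2 * Hs M) / (2 * x)
        - ∑ m ∈ Finset.range M, ∑ n ∈ Finset.range N, 1 / (((m : ℝ) + 1) * x + (n + 1)) := by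
  have hM' : (0:ℝ) < M := by exact_mod_cast hM
  have hN' : (0:ℝ) < N := by exact_mod_cast hN
  have hx0 : 0 < x := by rw [hx]; positivity
  have hA : As M = ∑ m ∈ Finset.range M, (Real.log ((M : ℝ) + m + 1) - Real.log ((m : ℝ) + 1)) := by
    rw [As, log_fact, log_fact, two_mul M, Finset.sum_range_add, Finset.sum_sub_distrib]
    push_cast
    ring
  have hH : Hs (2 * M) - 2 * Hs M =
      ∑ m ∈ Finset.range M, (1 / ((M : ℝ) + m + 1) - 1 / ((m : ℝ) + 1)) := by
    rw [Hs, Hs, two_mul M, Finset.sum_range_add, Finset.sum_sub_distrib]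
    push_cast
    ring
  rw [hA, hH, Finset.sum_div, ← Finset.sum_add_distrib, ← Finset.sum_sub_distrib]
  apply Finset.sum_congr rfl
  intro m _
  rw [chiR_telescope]
  have hNx : ((m : ℝ) + 1) * x + N = ((M : ℝ) + m + 1) * x := by
    rw [hx]; field_simp; ring
  rw [hNx, Real.log_mul (by positivity) hx0.ne', Real.log_mul (by positivity) hx0.ne']
  field_simp
  ring

lemma box_diff {M N : ℕ} (hM : 0 < M) (hN : 0 < N) (x : ℝ) (hx : x = N / M) :
    ∑ m ∈ Finset.range M, ∑ n ∈ Finset.range N, chiR (((m : ℝ) + 1) * x + n)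
     - x⁻¹ * ∑ n ∈ Finset.range N, ∑ m ∈ Finset.range M, chiR (((n : ℝ) + 1) * x⁻¹ + m) =
      As M + (Hs (2 * M) - 2 * Hs M) / (2 * x) - (As N / x + (Hs (2 * N) - 2 * Hs N) / 2) := by
  have hM' : (0:ℝ) < M := by exact_mod_cast hM
  have hN' : (0:ℝ) < N := by exact_mod_cast hN
  have hx0 : 0 < x := by rw [hx]; positivity
  rw [box_sum hM hN x hx, box_sum hN hM x⁻¹ (by rw [hx, inv_div])]
  have : ∑ m ∈ Finset.range N, ∑ n ∈ Finset.range M, 1 / (((m : ℝ) + 1) * x⁻¹ + (n + 1)) =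
      x * ∑ m ∈ Finset.range M, ∑ n ∈ Finset.range N, 1 / (((m : ℝ) + 1) * x + (n + 1)) := by
    rw [Finset.sum_comm, Finset.mul_sum]
    apply Finset.sum_congr rfl
    intro m _
    rw [Finset.mul_sum]
    apply Finset.sum_congr rfl
    intro n _
    field_simp
    ring
  rw [this]
  field_simp
  ring

lemma Hs_tendsto : ∃ c, Tendsto (fun M : ℕ => Hs (2 * M) - 2 * Hs M + Real.log M) atTop (𝓝 c) := by
  have h0 := Real.tendsto_harmonic_sub_log
  have h1 := h0.comp (tendsto_id.const_mul_atTop' (show 0 < 2 by norm_num))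
  refine ⟨_, ((h1.sub (h0.const_mul 2)).add_const (Real.log 2)).congr' ?_⟩
  have hh (n : ℕ) : (harmonic n : ℝ) = Hs n := by
    simp [harmonic, Hs]
  filter_upwards [eventually_gt_atTop 0] with M hM
  have hM' : (0:ℝ) < M := by exact_mod_cast hM
  simp only [Function.comp, hh, id]
  push_cast
  rw [Real.log_mul (by norm_num) hM'.ne']
  ring

lemma As_tendsto : ∃ c, Tendsto (fun M : ℕ => As M - 2 * M * Real.log 2 + Real.log M / 2)
    atTop (𝓝 c) := by
  have h0 := (Real.continuousAt_log (show √Real.pi ≠ 0 by positivity)).tendsto.comp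
    Stirling.tendsto_stirlingSeq_sqrt_pi
  have h1 := h0.comp (tendsto_id.const_mul_atTop' (show 0 < 2 by norm_num))
  refine ⟨_, (h1.sub (h0.const_mul 2)).congr' ?_⟩
  filter_upwards [eventually_gt_atTop 0] with M hM
  have hM' : (0:ℝ) < M := by exact_mod_cast hM
  simp only [Function.comp, id, Stirling.log_stirlingSeq_formula, As]
  push_cast
  rw [Real.log_div (by positivity) (by positivity), Real.log_div (by positivity) (by positivity),
    Real.log_mul (by norm_num) (by positivity), Real.log_mul (by norm_num) (by positivity),
    Real.log_exp]
  ring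

lemma box_tendsto {x : ℝ} (hx : 0 < x) {u v : ℕ → ℕ} (hu : Tendsto u atTop atTop)
    (hv : Tendsto v atTop atTop) :
    Tendsto (fun k => ((∑ m ∈ Finset.range (u k), ∑ n ∈ Finset.range (v k),
      chiR (((m : ℝ) + 1) * x + n) : ℝ) : ℂ)) atTop (𝓝 (bigF x)) := by
  have hs : (x : ℂ) ∈ slitPlane := by simpa using hx
  have h1 := (bigF_summable hs).hasSum
  have h2 : Tendsto (fun k => Finset.range (u k) ×ˢ Finset.range (v k)) atTop atTop := by
    rw [tendsto_atTop]
    intro s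
    obtain ⟨B, hB⟩ : ∃ B : ℕ, ∀ p ∈ s, p.1 < B ∧ p.2 < B := by
      refine ⟨s.sup (fun p => p.1 + p.2) + 1, fun p hp => ?_⟩
      have := Finset.le_sup (f := fun p : ℕ × ℕ => p.1 + p.2) hp
      omega
    filter_upwards [hu.eventually_ge_atTop B, hv.eventually_ge_atTop B] with k h1 h2 p hp
    have := hB p hp
    simp; omega
  refine (h1.comp h2).congr (fun k => ?_)
  simp only [Function.comp]
  rw [Finset.sum_product]
  push_cast
  apply Finset.sum_congr rfl
  intro m _
  apply Finset.sum_congr rfl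
  intro n _
  rw [← chiF_ofReal (by positivity)]
  push_cast; rfl

lemma guinand_rat : ∃ C : ℝ, ∀ p q : ℕ, 0 < p → 0 < q → ∀ x : ℝ, x = p / q →
    bigF x - (x : ℂ)⁻¹ * bigF ((x : ℂ)⁻¹) =
      (1 + (x : ℂ)⁻¹) * Complex.log x / 2 + C * (1 - (x : ℂ)⁻¹) := by
  obtain ⟨c1, h1⟩ := As_tendsto
  obtain ⟨c2, h2⟩ := Hs_tendsto
  refine ⟨c1 - c2 / 2, fun p q hp hq x hx => ?_⟩
  have hp' : (0:ℝ) < p := by exact_mod_cast hp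
  have hq' : (0:ℝ) < q := by exact_mod_cast hq
  have hx0 : 0 < x := by rw [hx]; positivity
  have hu : Tendsto (fun k : ℕ => q * k) atTop atTop := tendsto_id.const_mul_atTop' hq
  have hv : Tendsto (fun k : ℕ => p * k) atTop atTop := tendsto_id.const_mul_atTop' hp
  have t1 := (box_tendsto hx0 hu hv).sub
    ((box_tendsto (inv_pos.2 hx0) hv hu).const_mul ((x : ℂ)⁻¹))
  have t2 := (((h1.comp hu).add ((h2.comp hu).div_const (2 * x))).sub
    (((h1.comp hv).div_const x).add ((h2.comp hv).div_const 2))).add_const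
      ((1 + x⁻¹) * Real.log x / 2)
  have t3 := (continuous_ofReal.tendsto _).comp t2
  rw [ofReal_inv] at t1
  rw [tendsto_nhds_unique t1 (t3.congr' ?_)]
  · rw [← ofReal_log hx0.le]
    push_cast
    have : (x : ℂ) ≠ 0 := by exact_mod_cast hx0.ne'
    field_simp
    ring
  filter_upwards [eventually_gt_atTop 0] with k hk
  have hk' : (0:ℝ) < k := by exact_mod_cast hk
  have hxk : x = ((p * k : ℕ) : ℝ) / ((q * k : ℕ) : ℝ) := by
    rw [hx]; push_cast; field_simp
  have := box_diff (M := q * k) (N := p * k) (by positivity) (by positivity) x hxk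
  simp only [Function.comp]
  rw [← ofReal_inv, ← ofReal_mul, ← ofReal_sub, this]
  congr 1
  have hlx : Real.log x = Real.log ((p * k : ℕ) : ℝ) - Real.log ((q * k : ℕ) : ℝ) := by
    rw [hxk, Real.log_div (by positivity) (by positivity)]
  have hpk : ((p * k : ℕ) : ℝ) = x * ((q * k : ℕ) : ℝ) := by
    rw [hxk]; field_simp
  rw [hlx]
  generalize Real.log ((p * k : ℕ) : ℝ) = l1
  generalize Real.log ((q * k : ℕ) : ℝ) = l2
  rw [hpk]
  field_simp
  ring

lemma slit_inv {z : ℂ} (hz : z ∈ slitPlane) : z⁻¹ ∈ slitPlane := by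
  have h0 := normSq_pos.2 (slitPlane_ne_zero hz)
  rw [mem_slitPlane_iff] at *
  rcases hz with h | h
  · left; rw [inv_re]; positivity
  · right; rw [inv_im]; exact div_ne_zero (neg_ne_zero.2 h) h0.ne'

lemma guinand : ∃ C : ℝ, ∀ z ∈ slitPlane, bigF z - z⁻¹ * bigF (z⁻¹) =
      (1 + z⁻¹) * Complex.log z / 2 + C * (1 - z⁻¹) := by
  obtain ⟨C, hC⟩ := guinand_rat
  refine ⟨C, ?_⟩
  have a1 : AnalyticOnNhd ℂ (fun z => bigF z - z⁻¹ * bigF (z⁻¹)) slitPlane := by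
    apply DifferentiableOn.analyticOnNhd _ isOpen_slitPlane
    intro z hz
    apply DifferentiableAt.differentiableWithinAt
    have h0 := slitPlane_ne_zero hz
    have := bigF_diff hz
    have : DifferentiableAt ℂ (fun z : ℂ => bigF (z⁻¹)) z :=
      (bigF_diff (slit_inv hz)).comp z (differentiableAt_inv h0)
    fun_prop (disch := assumption)
  have a2 : AnalyticOnNhd ℂ (fun z => (1 + z⁻¹) * Complex.log z / 2 + C * (1 - z⁻¹)) slitPlane := by
    apply DifferentiableOn.analyticOnNhd _ isOpen_slitPlane
    intro z hz
    apply DifferentiableAt.differentiableWithinAt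
    have h0 := slitPlane_ne_zero hz
    have := differentiableAt_log hz
    fun_prop (disch := assumption)
  have hpre : IsPreconnected slitPlane :=
    (starConvex_one_slitPlane.isPathConnected one_mem_slitPlane).isConnected.isPreconnected
  refine a1.eqOn_of_preconnected_of_frequently_eq a2 hpre one_mem_slitPlane ?_
  have ht : Tendsto (fun k : ℕ => (((((k + 2 : ℕ) : ℝ) / ((k + 1 : ℕ) : ℝ) : ℝ)) : ℂ)) atTop (𝓝[≠] 1) := by
    rw [tendsto_nhdsWithin_iff]
    constructor
    · have : Tendsto (fun k : ℕ => 1 + 1 / ((k : ℂ) + 1)) atTop (𝓝 (1 + 0)) :=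
        (tendsto_one_div_add_atTop_nhds_zero_nat (𝕜 := ℂ)).const_add 1
      rw [add_zero] at this
      refine this.congr (fun k => ?_)
      have : (k : ℂ) + 1 ≠ 0 := by exact_mod_cast (Nat.succ_ne_zero k)
      push_cast
      field_simp
      ring
    · refine Eventually.of_forall fun k => ?_
      simp only [Set.mem_compl_iff, Set.mem_singleton_iff]
      norm_cast
      intro h
      rw [div_eq_one_iff_eq (by positivity)] at h
      norm_cast at h
      omega
  refine ht.frequently (Eventually.frequently (Eventually.of_forall fun k => ?_))
  exact hC (k + 2) (k + 1) (by omega) (by omega) _ rfl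

/-- the weight-one modular obstruction
`ψ(z) = f(z) − z⁻¹ f(−1/z)` of `f(z) = 1 − 4∑_{n≥1} d(n)e^{2πinz}` on the upper
half-plane extends to a function analytic on the cut plane `ℂ ∖ (−∞, 0]`. -/
theorem statement8 :
    ∃ Ψ : ℂ → ℂ, AnalyticOnNhd ℂ Ψ Complex.slitPlane ∧
      ∀ z : ℂ, 0 < z.im →
        Ψ z = eisPeriodic z - z⁻¹ * eisPeriodic (-1 / z) := by
  obtain ⟨C, hC⟩ := guinand
  refine ⟨fun z => 1 - z⁻¹ - 4 / (2 * Real.pi * I) * (bigF z + z⁻¹ * bigF (z⁻¹)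
    - (1 - z⁻¹) * (Complex.log z - Real.pi * I) / 2 - C * (1 + z⁻¹)), ?_, ?_⟩
  · apply DifferentiableOn.analyticOnNhd _ isOpen_slitPlane
    intro z hz
    apply DifferentiableAt.differentiableWithinAt
    have h0 := slitPlane_ne_zero hz
    have := bigF_diff hz
    have := differentiableAt_log hz
    have : DifferentiableAt ℂ (fun z : ℂ => bigF (z⁻¹)) z :=
      (bigF_diff (slit_inv hz)).comp z (differentiableAt_inv h0)
    fun_prop (disch := assumption)
  · intro z hz
    have hs2 : -z ∈ slitPlane := mem_slitPlane_iff.2 (Or.inr (by simpa using hz.ne'))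
    have h0 : z ≠ 0 := by rintro rfl; simp at hz
    have hz' : 0 < (-1 / z).im := by
      have h1 := normSq_pos.2 h0
      rw [neg_div, one_div, neg_im, inv_im, neg_div, neg_neg]
      positivity
    have hpi : (2 * Real.pi * I : ℂ) ≠ 0 := by simp [Real.pi_ne_zero]
    have e1 := eisS_eq hz
    have e2 := eisS_eq hz'
    have e3 := hC _ hs2
    have hlog : Complex.log (-z) = Complex.log z - Real.pi * I := by
      rw [Complex.log, Complex.log, norm_neg, arg_neg_eq_arg_sub_pi_of_im_pos hz]
      push_cast; ring
    rw [hlog] at e3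
    rw [show -(-1 / z) = z⁻¹ by rw [neg_div, neg_neg, one_div],
      show -1 / z = (-z)⁻¹ by rw [neg_div, one_div, inv_neg]] at e2
    have f1 : eisPeriodic z = 1 - 4 * eisS z := rfl
    have f2 : eisPeriodic (-1 / z) = 1 - 4 * eisS (-1 / z) := rfl
    rw [f1, f2, show -1 / z = (-z)⁻¹ by rw [neg_div, one_div, inv_neg]]
    have g1 : eisS z = (bigF z - bigF (-z)) / (2 * Real.pi * I) := by
      rw [← e1]; field_simp
    have g2 : eisS (-z)⁻¹ = (bigF (-z)⁻¹ - bigF z⁻¹) / (2 * Real.pi * I) := by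
      rw [← e2]; field_simp
    have g3 : bigF (-z) = (-z)⁻¹ * bigF (-z)⁻¹ + ((1 + (-z)⁻¹) * (Complex.log z - Real.pi * I) / 2
      + C * (1 - (-z)⁻¹)) := by rw [← e3]; ring
    rw [g1, g2, g3]
    generalize bigF (-z)⁻¹ = X
    rw [inv_neg]
    ring

end
end

section
/- Let N ∈ ℕ, let k ∈ ℕ with k ≥ 2, and let f be a cusp form of weight k for Γ₀(N) with Fourier expansion f(z) = ∑_{n≥1} a_n e^{2πinz}. Define the Eichler integral f̃(z) = ∑_{n≥1} a_n n^{1−k} e^{2πinz} for z ∈ ℍ. Then for every γ = (a b; c d) ∈ Γ₀(N) there exists a polynomial P ∈ ℂ[z] of degree at most k − 2 such that f̃(z) − (cz+d)^{k−2} f̃((az+b)/(cz+d)) = P(z) for all z ∈ ℍ. -/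
namespace Eich

/-- `F` is an `n`-fold primitive of `H` on the upper half plane. -/
def Prim : ℕ → (ℂ → ℂ) → (ℂ → ℂ) → Prop
  | 0, F, H => ∀ z : ℂ, 0 < z.im → F z = H z
  | n + 1, F, H => ∃ F' : ℂ → ℂ, (∀ z : ℂ, 0 < z.im → HasDerivAt F (F' z) z) ∧ Prim n F' H

lemma nhds_H {z : ℂ} (hz : 0 < z.im) : ∀ᶠ w in nhds z, 0 < w.im :=
  (isOpen_lt continuous_const Complex.continuous_im).mem_nhds hz

lemma Prim.snoc {n : ℕ} : ∀ {F H H' : ℂ → ℂ}, Prim n F H →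
    (∀ z : ℂ, 0 < z.im → HasDerivAt H (H' z) z) → Prim (n + 1) F H' := by
  induction n with
  | zero =>
    intro F H H' h hd
    refine ⟨H', fun z hz => ?_, fun z _ => rfl⟩
    refine (hd z hz).congr_of_eventuallyEq ?_
    filter_upwards [nhds_H hz] with w hw using h w hw
  | succ n ih =>
    rintro F H H' ⟨F', h1, h2⟩ hd
    exact ⟨F', h1, ih h2 hd⟩

lemma Prim.congr {n : ℕ} : ∀ {F H H' : ℂ → ℂ}, Prim n F H →
    (∀ z : ℂ, 0 < z.im → H z = H' z) → Prim n F H' := by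
  induction n with
  | zero => intro F H H' h hd z hz; rw [h z hz, hd z hz]
  | succ n ih => rintro F H H' ⟨F', h1, h2⟩ hd; exact ⟨F', h1, ih h2 hd⟩

lemma Prim.lin {n : ℕ} (c : ℂ) : ∀ {F H F₁ H₁ : ℂ → ℂ}, Prim n F H → Prim n F₁ H₁ →
    Prim n (fun z => F z + c * F₁ z) (fun z => H z + c * H₁ z) := by
  induction n with
  | zero => intro F H F₁ H₁ h h₁ z hz; simp only [h z hz, h₁ z hz]
  | succ n ih =>
    rintro F H F₁ H₁ ⟨F', h1, h2⟩ ⟨F₁', h3, h4⟩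
    exact ⟨_, fun z hz => (h1 z hz).add ((h3 z hz).const_mul c), ih h2 h4⟩

lemma Prim.mul {n : ℕ} (c d : ℂ) : ∀ {F H H' : ℂ → ℂ}, Prim n F H →
    (∀ z : ℂ, 0 < z.im → HasDerivAt H (H' z) z) →
    Prim (n + 1) (fun z => (c * z + d) * F z)
      (fun z => (c * z + d) * H' z + (n + 1) * c * H z) := by
  have hl : ∀ z : ℂ, HasDerivAt (fun z => c * z + d) c z := fun z => by
    simpa using ((hasDerivAt_id z).const_mul c).add_const d
  induction n with
  | zero =>
    intro F H H' h hd
    obtain ⟨F', h1, h2⟩ := h.snoc hd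
    refine ⟨_, fun z hz => (hl z).mul (h1 z hz), fun z hz => ?_⟩
    rw [h2 z hz, h z hz]; push_cast; ring
  | succ n ih =>
    rintro F H H' ⟨F', h1, h2⟩ hd
    refine ⟨_, fun z hz => (hl z).mul (h1 z hz), ?_⟩
    have := (ih h2 hd).lin c (show Prim (n+1) F H from ⟨F', h1, h2⟩)
    have h3 := this.congr (H' := fun z => (c * z + d) * H' z + ((n + 1 : ℕ) + 1) * c * H z)
      (fun z hz => by push_cast; ring)
    convert h3 using 2
    ring

lemma Prim.poly {n : ℕ} : ∀ {F : ℂ → ℂ}, Prim n F (fun _ => 0) →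
    ∃ p : ℕ → ℂ, ∀ z : ℂ, 0 < z.im → F z = ∑ i ∈ Finset.range n, p i * z ^ i := by
  induction n with
  | zero => intro F h; exact ⟨0, fun z hz => by simpa using h z hz⟩
  | succ n ih =>
    rintro F ⟨F', h1, h2⟩
    obtain ⟨p, hp⟩ := ih h2
    let Q : ℂ → ℂ := fun z => ∑ i ∈ Finset.range n, p i / (i + 1) * z ^ (i + 1)
    have hQ : ∀ z, HasDerivAt Q (∑ i ∈ Finset.range n, p i * z ^ i) z := by
      intro z
      refine HasDerivAt.fun_sum fun i _ => ?_
      refine ((hasDerivAt_pow (i + 1) z).const_mul (p i / (i + 1))).congr_deriv ?_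
      have : (i : ℂ) + 1 ≠ 0 := Nat.cast_add_one_ne_zero i
      push_cast; field_simp
    have hd : ∀ z : ℂ, 0 < z.im → HasDerivAt (fun z => F z - Q z) 0 z := fun z hz => by
      exact ((h1 z hz).sub (hQ z)).congr_deriv (by rw [hp z hz, sub_self])
    have hconv : Convex ℝ {z : ℂ | 0 < z.im} := convex_halfSpace_im_gt 0
    have hopen : IsOpen {z : ℂ | 0 < z.im} := isOpen_lt continuous_const Complex.continuous_im
    obtain ⟨q, hq⟩ := hopen.exists_is_const_of_deriv_eq_zero hconv.isPreconnected
      (f := fun z => F z - Q z)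
      (fun z hz => (hd z hz).differentiableAt.differentiableWithinAt) (fun z hz => (hd z hz).deriv)
    refine ⟨fun i => Nat.casesOn i q (fun i => p i / (i + 1)), fun z hz => ?_⟩
    rw [Finset.sum_range_succ']
    have := hq z hz
    simp only [pow_zero, mul_one]
    rw [← this]; simp [Q]

lemma Prim.bol (A B C D : ℤ) (hdet : A * D - B * C = 1) (G : ℕ → ℂ → ℂ)
    (hG : ∀ j, ∀ z : ℂ, 0 < z.im → HasDerivAt (G j) (G (j + 1) z) z)
    (hne : ∀ z : ℂ, 0 < z.im → (C : ℂ) * z + D ≠ 0)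
    (him : ∀ z : ℂ, 0 < z.im → 0 < (((A : ℂ) * z + B) / ((C : ℂ) * z + D)).im) (m : ℕ) :
    Prim (m + 1) (fun z => ((C : ℂ) * z + D) ^ m * G 0 (((A : ℂ) * z + B) / ((C : ℂ) * z + D)))
      (fun z => G (m + 1) (((A : ℂ) * z + B) / ((C : ℂ) * z + D)) / ((C : ℂ) * z + D) ^ (m + 2)) := by
  have hl : ∀ (c d z : ℂ), HasDerivAt (fun z => c * z + d) c z := fun c d z => by
    simpa using ((hasDerivAt_id z).const_mul c).add_const d
  have hdet' : (A : ℂ) * D - B * C = 1 := by exact_mod_cast hdet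
  have hγ : ∀ z : ℂ, 0 < z.im → HasDerivAt (fun z => ((A : ℂ) * z + B) / ((C : ℂ) * z + D))
      (1 / ((C : ℂ) * z + D) ^ 2) z := fun z hz => by
    refine ((hl A B z).div (hl C D z) (hne z hz)).congr_deriv ?_
    congr 1
    linear_combination hdet'
  have hGγ : ∀ j, ∀ z : ℂ, 0 < z.im →
      HasDerivAt (fun z => G j (((A : ℂ) * z + B) / ((C : ℂ) * z + D)))
      (G (j + 1) (((A : ℂ) * z + B) / ((C : ℂ) * z + D)) * (1 / ((C : ℂ) * z + D) ^ 2)) z :=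
    fun j z hz => (hG j _ (him z hz)).comp z (hγ z hz)
  induction m with
  | zero =>
    refine ⟨_, fun z hz => ?_, fun z hz => rfl⟩
    simpa [div_eq_mul_inv] using hGγ 0 z hz
  | succ m ih =>
    have := Prim.mul (C : ℂ) D ih (fun z hz => (hGγ (m + 1) z hz).div ((hl C D z).pow (m + 2))
      (pow_ne_zero _ (hne z hz)))
    have h2 := this.congr (H' := fun z => G (m + 1 + 1) (((A : ℂ) * z + B) / ((C : ℂ) * z + D)) /
        ((C : ℂ) * z + D) ^ (m + 1 + 2)) ?_
    · convert h2 using 2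
      ring
    · intro z hz
      have h0 := hne z hz
      generalize G (m + 1 + 1) (((A : ℂ) * z + B) / ((C : ℂ) * z + D)) = X
      generalize G (m + 1) (((A : ℂ) * z + B) / ((C : ℂ) * z + D)) = Y
      generalize (C : ℂ) * z + D = l at *
      rw [show m + 2 - 1 = m + 1 by omega]
      field_simp
      push_cast
      ring

lemma series (b : ℕ → ℂ) (K : ℝ) (p : ℕ) (hb : ∀ n, ‖b n‖ ≤ K * ((n + 1 : ℕ) : ℝ) ^ p)
    (z : ℂ) (hz : 0 < z.im) :
    HasDerivAt (fun z => ∑' n : ℕ, b n * Complex.exp (2 * Real.pi * Complex.I * ((n : ℂ) + 1) * z))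
      (∑' n : ℕ, b n * (2 * Real.pi * Complex.I * ((n : ℂ) + 1)) *
        Complex.exp (2 * Real.pi * Complex.I * ((n : ℂ) + 1) * z)) z := by
  have hpi := Real.pi_pos
  obtain ⟨ε, hε, hεz⟩ := exists_between hz
  have hnorm : ∀ (n : ℕ) (w : ℂ), ε < w.im →
      ‖Complex.exp (2 * Real.pi * Complex.I * ((n : ℂ) + 1) * w)‖ ≤
        Real.exp (-(2 * Real.pi * ε) * ((n + 1 : ℕ) : ℝ)) := by
    intro n w hw
    rw [Complex.norm_exp, Real.exp_le_exp]
    have : (2 * Real.pi * Complex.I * ((n : ℂ) + 1) * w).re = - (2 * Real.pi * (n + 1)) * w.im := by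
      simp [Complex.mul_re, Complex.mul_im]
    rw [this]; push_cast
    have : 0 < 2 * Real.pi * ((n : ℝ) + 1) := by positivity
    nlinarith
  have hs : ∀ q : ℕ, Summable fun n : ℕ => ((n + 1 : ℕ) : ℝ) ^ q *
      Real.exp (-(2 * Real.pi * ε) * ((n + 1 : ℕ) : ℝ)) := fun q =>
    (summable_nat_add_iff 1).2 (Real.summable_pow_mul_exp_neg_nat_mul q (by positivity))
  have hK : ∀ n : ℕ, 0 ≤ K * ((n + 1 : ℕ) : ℝ) ^ p := fun n => (norm_nonneg _).trans (hb n)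
  have hconv : Convex ℝ {z : ℂ | ε < z.im} := convex_halfSpace_im_gt ε
  have hopen : IsOpen {z : ℂ | ε < z.im} := isOpen_lt continuous_const Complex.continuous_im
  refine hasDerivAt_tsum_of_isPreconnected (t := {z : ℂ | ε < z.im})
    (u := fun n => K * (2 * Real.pi) * (((n + 1 : ℕ) : ℝ) ^ (p + 1) *
      Real.exp (-(2 * Real.pi * ε) * ((n + 1 : ℕ) : ℝ)))) 
    (g := fun n z => b n * Complex.exp (2 * Real.pi * Complex.I * ((n : ℂ) + 1) * z))
    (g' := fun n z => b n * (2 * Real.pi * Complex.I * ((n : ℂ) + 1)) *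
        Complex.exp (2 * Real.pi * Complex.I * ((n : ℂ) + 1) * z))
    ((hs (p + 1)).mul_left _) hopen hconv.isPreconnected ?_ ?_ hεz ?_ hεz
  · intro n w _
    have h1 := ((hasDerivAt_id w).const_mul (2 * Real.pi * Complex.I * ((n : ℂ) + 1))).cexp.const_mul
      (b n)
    refine h1.congr_deriv ?_
    simp only [id_eq, mul_one]; ring
  · intro n w hw
    have h2 : ‖(2 * Real.pi * Complex.I * ((n : ℂ) + 1))‖ = 2 * Real.pi * ((n + 1 : ℕ) : ℝ) := by
      rw [show ((n : ℂ) + 1) = ((n + 1 : ℕ) : ℂ) by push_cast; rfl]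
      simp only [norm_mul, Complex.norm_natCast]
      simp [abs_of_pos hpi]
    rw [norm_mul, norm_mul, h2]
    calc _ ≤ (K * ((n + 1 : ℕ) : ℝ) ^ p) * (2 * Real.pi * ((n + 1 : ℕ) : ℝ)) *
          Real.exp (-(2 * Real.pi * ε) * ((n + 1 : ℕ) : ℝ)) := by
            have := hK n
            gcongr
            · exact hb n
            · exact hnorm n w hw
      _ = _ := by ring
  · refine Summable.of_norm_bounded ((hs p).mul_left K) fun n => ?_
    rw [norm_mul, ← mul_assoc]
    exact mul_le_mul (hb n) (hnorm n z hεz) (norm_nonneg _) (hK n)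

end Eich


/-- the Eichler integral `f̃(z) = ∑_{n≥1} a_n n^{1−k} e^{2πinz}` of
an integer weight `k ≥ 2` cusp form `f` for `Γ₀(N)` (cusp form conditions given
as hypotheses: holomorphy, modularity, Fourier expansion with polynomially
bounded coefficients, exponential decay at all cusps) has, for each
`γ = (a b; c d) ∈ Γ₀(N)`, a modular obstruction
`f̃(z) − (cz+d)^{k−2} f̃(γz)` equal to a polynomial of degree at most `k − 2`. -/
theorem statement9 (N k : ℕ) (hk : 2 ≤ k) (f : ℂ → ℂ) (a : ℕ → ℂ)
    (hf_hol : DifferentiableOn ℂ f {z : ℂ | 0 < z.im})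
    (hf_mod : ∀ A B C D : ℤ, A * D - B * C = 1 → (N : ℤ) ∣ C →
      ∀ z : ℂ, 0 < z.im →
        f (((A : ℂ) * z + B) / ((C : ℂ) * z + D)) = ((C : ℂ) * z + D) ^ k * f z)
    (hf_four : ∀ z : ℂ, 0 < z.im →
      f z = ∑' n : ℕ, a (n + 1) *
        Complex.exp (2 * Real.pi * Complex.I * ((n : ℂ) + 1) * z))
    (Cb : ℝ) (hbound : ∀ n : ℕ, ‖a (n + 1)‖ ≤ Cb * ((n + 1 : ℕ) : ℝ) ^ k)
    (hf_cusp : ∀ r : ℚ, ∃ δ > (0:ℝ), ∃ M : ℝ, ∀ t : ℝ, 0 < t → t ≤ 1 →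
      ‖f ((r : ℂ) + t * Complex.I)‖ ≤ M * Real.exp (-δ / t))
    (hf_inf : ∃ δ > (0:ℝ), ∃ M : ℝ, ∀ z : ℂ, 1 ≤ z.im →
      ‖f z‖ ≤ M * Real.exp (-δ * z.im)) :
    ∀ A B C D : ℤ, A * D - B * C = 1 → (N : ℤ) ∣ C →
      ∃ P : Polynomial ℂ, P.degree ≤ ((k - 2 : ℕ) : WithBot ℕ) ∧
        ∀ z : ℂ, 0 < z.im →
          (∑' n : ℕ, a (n + 1) * ((n + 1 : ℕ) : ℂ) ^ ((1 : ℤ) - k) *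
              Complex.exp (2 * Real.pi * Complex.I * ((n : ℂ) + 1) * z)) -
            ((C : ℂ) * z + D) ^ (k - 2) *
              (∑' n : ℕ, a (n + 1) * ((n + 1 : ℕ) : ℂ) ^ ((1 : ℤ) - k) *
                Complex.exp (2 * Real.pi * Complex.I * ((n : ℂ) + 1) *
                  (((A : ℂ) * z + B) / ((C : ℂ) * z + D)))) = P.eval z := by
  intro A B C D hdet hN
  have hdet' : (A : ℝ) * D - B * C = 1 := by exact_mod_cast hdet
  have hne : ∀ z : ℂ, 0 < z.im → (C : ℂ) * z + D ≠ 0 := by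
    intro z hz h
    have h1 := congrArg Complex.im h
    have h2 := congrArg Complex.re h
    simp at h1 h2
    rcases h1 with h1 | h1
    · subst h1
      simp at h2
      subst h2
      simp at hdet
    · exact hz.ne' h1
  have him : ∀ z : ℂ, 0 < z.im → 0 < (((A : ℂ) * z + B) / ((C : ℂ) * z + D)).im := by
    intro z hz
    have h0 := Complex.normSq_pos.2 (hne z hz)
    have : (((A : ℂ) * z + B) / ((C : ℂ) * z + D)).im
        = z.im / Complex.normSq ((C : ℂ) * z + D) := by
      rw [Complex.div_im, ← sub_div]
      congr 1
      simp
      linear_combination z.im * hdet'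
    rw [this]
    positivity
  let b : ℕ → ℕ → ℂ := fun j n => a (n + 1) * ((n + 1 : ℕ) : ℂ) ^ ((1 : ℤ) - k) *
    (2 * Real.pi * Complex.I * ((n : ℂ) + 1)) ^ j
  let G : ℕ → ℂ → ℂ := fun j z => ∑' n : ℕ, b j n *
    Complex.exp (2 * Real.pi * Complex.I * ((n : ℂ) + 1) * z)
  have hb : ∀ j n, ‖b j n‖ ≤ (Cb * (2 * Real.pi) ^ j) * ((n + 1 : ℕ) : ℝ) ^ (k + j) := by
    intro j n
    have h2 : ‖(2 * Real.pi * Complex.I * ((n : ℂ) + 1))‖ = 2 * Real.pi * ((n + 1 : ℕ) : ℝ) := by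
      rw [show ((n : ℂ) + 1) = ((n + 1 : ℕ) : ℂ) by push_cast; rfl]
      simp only [norm_mul, Complex.norm_natCast]
      simp [abs_of_pos Real.pi_pos]
    have h3 : ‖((n + 1 : ℕ) : ℂ) ^ ((1 : ℤ) - k)‖ ≤ 1 := by
      rw [norm_zpow, Complex.norm_natCast]
      exact zpow_le_one_of_nonpos₀ (by norm_cast; omega) (by omega)
    simp only [b]
    rw [norm_mul, norm_mul, norm_pow, h2]
    have hpi := Real.pi_pos
    calc _ ≤ (Cb * ((n + 1 : ℕ) : ℝ) ^ k) * 1 * (2 * Real.pi * ((n + 1 : ℕ) : ℝ)) ^ j := by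
            have := (norm_nonneg _).trans (hbound n)
            gcongr
            exact hbound n
      _ = _ := by ring
  have hG : ∀ j, ∀ z : ℂ, 0 < z.im → HasDerivAt (G j) (G (j + 1) z) z := by
    intro j z hz
    have := Eich.series (b j) _ _ (hb j) z hz
    convert this using 1
    simp only [G, b]
    refine tsum_congr fun n => ?_
    ring
  obtain ⟨m, rfl⟩ : ∃ m, k = m + 2 := ⟨k - 2, by omega⟩
  have hlast : ∀ z : ℂ, 0 < z.im → G (m + 1) z = (2 * Real.pi * Complex.I) ^ (m + 1) * f z := by
    intro z hz
    rw [hf_four z hz, ← tsum_mul_left]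
    refine tsum_congr fun n => ?_
    simp only [b]
    have hn : ((n + 1 : ℕ) : ℂ) ≠ 0 := by norm_cast
    have h1 : ((n + 1 : ℕ) : ℂ) ^ ((1 : ℤ) - (m + 2 : ℕ)) * ((n + 1 : ℕ) : ℂ) ^ (m + 1) = 1 := by
      rw [← zpow_natCast, ← zpow_add₀ hn]
      convert zpow_zero _
      push_cast; ring
    rw [mul_pow, show ((n : ℂ) + 1) = ((n + 1 : ℕ) : ℂ) by push_cast; rfl]
    linear_combination a (n + 1) * (2 * Real.pi * Complex.I) ^ (m + 1) *
      Complex.exp (2 * Real.pi * Complex.I * ((n + 1 : ℕ) : ℂ) * z) * h1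
  have hchain : ∀ n j, Eich.Prim n (G j) (G (j + n)) := by
    intro n
    induction n with
    | zero => intro j z _; rfl
    | succ n ih =>
      intro j
      refine ⟨_, hG j, ?_⟩
      rw [show j + (n + 1) = j + 1 + n by ring]
      exact ih (j + 1)
  have hP := (hchain (m + 1) 0).lin (-1) (Eich.Prim.bol A B C D hdet G hG hne him m)
  have hP0 := hP.congr (H' := fun _ => 0) (fun z hz => by
    have h0 := hne z hz
    rw [zero_add, hlast z hz, hlast _ (him z hz), hf_mod A B C D hdet hN z hz]
    field_simp
    ring)
  obtain ⟨p, hp⟩ := hP0.poly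
  refine ⟨∑ i ∈ Finset.range (m + 1), Polynomial.C (p i) * Polynomial.X ^ i, ?_, fun z hz => ?_⟩
  · refine (Polynomial.degree_sum_le _ _).trans (Finset.sup_le fun i hi => ?_)
    refine (Polynomial.degree_C_mul_X_pow_le _ _).trans ?_
    have := Finset.mem_range.1 hi
    exact_mod_cast (show i ≤ m + 2 - 2 by omega)
  · have := hp z hz
    simp only [Polynomial.eval_finsetSum, Polynomial.eval_mul, Polynomial.eval_C,
      Polynomial.eval_pow, Polynomial.eval_X]
    rw [← this]
    simp only [G, b, pow_zero, mul_one, Nat.add_sub_cancel]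
    ring
end

section
/- Let N ∈ ℕ, let k ∈ ℕ with k ≥ 2, let f be a cusp form of weight k for Γ₀(N) with Fourier expansion f(z) = ∑_{n≥1} a_n e^{2πinz}, and define its Eichler integral f̃(z) = ∑_{n≥1} a_n n^{1−k} e^{2πinz} for z ∈ ℍ. Then for every γ = (a b; c d) ∈ Γ₀(N) with c > 0 and every z ∈ ℍ, f̃(z) − (cz+d)^{k−2} f̃((az+b)/(cz+d)) = ((−2πi)^{k−1}/(k−2)!) · i · ∫₀^∞ f(−d/c + it) · ((−d/c + it) − z)^{k−2} dt, where the integral converges absolutely. -/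
open MeasureTheory Set

noncomputable def eichE (a : ℕ → ℂ) (j : ℕ) (z : ℂ) : ℂ :=
  ∑' n : ℕ, a (n + 1) * ((2 * Real.pi * Complex.I * ((n : ℂ) + 1)) ^ j)⁻¹ *
    Complex.exp (2 * Real.pi * Complex.I * ((n : ℂ) + 1) * z)

noncomputable def eichP (a : ℕ → ℂ) (X : ℂ) : ℕ → ℕ → ℂ → ℂ
  | 0, j, z => eichE a (j + 1) z
  | (m + 1), j, z => (z - X) ^ (m + 1) * eichE a (j + 1) z - (m + 1) * eichP a X m (j + 1) z

lemma eich_norm_exp (n : ℕ) (z : ℂ) :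
    ‖Complex.exp (2 * Real.pi * Complex.I * ((n : ℂ) + 1) * z)‖
      = Real.exp (-(2 * Real.pi * z.im) * ((n : ℝ) + 1)) := by
  rw [Complex.norm_exp]
  congr 1
  simp [Complex.mul_re, Complex.mul_im]
  ring

lemma eich_norm_inv (j n : ℕ) :
    ‖((2 * Real.pi * Complex.I * ((n : ℂ) + 1)) ^ j)⁻¹‖ ≤ 1 := by
  rw [norm_inv, norm_pow]
  apply inv_le_one_of_one_le₀
  apply one_le_pow₀
  have h : ‖(n : ℂ) + 1‖ = (n : ℝ) + 1 := by
    have := Complex.norm_natCast (n + 1)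
    push_cast at this
    exact this
  simp only [norm_mul, Complex.norm_I, h, Complex.norm_real, Real.norm_eq_abs, Complex.norm_ofNat]
  rw [abs_of_pos Real.pi_pos]
  have := Real.pi_gt_three
  have hn : (0:ℝ) ≤ n := n.cast_nonneg
  nlinarith

lemma eich_summable (k : ℕ) (c : ℝ) (hc : 0 < c) (Cb : ℝ) :
    Summable (fun n : ℕ => Cb * ((n + 1 : ℕ) : ℝ) ^ k * Real.exp (-c * ((n : ℝ) + 1))) := by
  have h := (summable_nat_add_iff 1).2 (Real.summable_pow_mul_exp_neg_nat_mul k hc)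
  refine (h.mul_left Cb).congr fun n => ?_
  push_cast
  ring

lemma eich_term_le {k : ℕ} {a : ℕ → ℂ} {Cb : ℝ}
    (hb : ∀ n : ℕ, ‖a (n + 1)‖ ≤ Cb * ((n + 1 : ℕ) : ℝ) ^ k) (j n : ℕ) (z : ℂ) :
    ‖a (n + 1) * ((2 * Real.pi * Complex.I * ((n : ℂ) + 1)) ^ j)⁻¹ *
      Complex.exp (2 * Real.pi * Complex.I * ((n : ℂ) + 1) * z)‖
      ≤ Cb * ((n + 1 : ℕ) : ℝ) ^ k * Real.exp (-(2 * Real.pi * z.im) * ((n : ℝ) + 1)) := by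
  rw [norm_mul, norm_mul, eich_norm_exp]
  refine mul_le_mul_of_nonneg_right ?_ (Real.exp_pos _).le
  calc _ ≤ ‖a (n + 1)‖ * 1 := by gcongr; exact eich_norm_inv j n
    _ ≤ _ := by rw [mul_one]; exact hb n

lemma eich_deriv {k : ℕ} {a : ℕ → ℂ} {Cb : ℝ}
    (hb : ∀ n : ℕ, ‖a (n + 1)‖ ≤ Cb * ((n + 1 : ℕ) : ℝ) ^ k) (j : ℕ) (z : ℂ) (hz : 0 < z.im) :
    HasDerivAt (eichE a (j + 1)) (eichE a j z) z := by
  have hC : 0 ≤ Cb := by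
    have := (norm_nonneg _).trans (hb 0)
    simpa using this
  have hU : IsOpen {w : ℂ | z.im / 2 < w.im} := isOpen_lt continuous_const Complex.continuous_im
  have hzU : z ∈ {w : ℂ | z.im / 2 < w.im} := by simp only [mem_ofPred_eq]; linarith
  have hle : ∀ (n : ℕ) (w : ℂ), w ∈ {w : ℂ | z.im / 2 < w.im} →
      ‖a (n + 1) * ((2 * Real.pi * Complex.I * ((n : ℂ) + 1)) ^ (j + 1))⁻¹ *
      Complex.exp (2 * Real.pi * Complex.I * ((n : ℂ) + 1) * w)‖
      ≤ Cb * ((n + 1 : ℕ) : ℝ) ^ k * Real.exp (-(2 * Real.pi * (z.im / 2)) * ((n : ℝ) + 1)) := by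
    intro n w hw
    refine (eich_term_le hb (j + 1) n w).trans ?_
    simp only [mem_ofPred_eq] at hw
    gcongr
  have hs := eich_summable k (2 * Real.pi * (z.im / 2)) (by have := Real.pi_pos; positivity) Cb
  have hd : ∀ n : ℕ, DifferentiableOn ℂ (fun w : ℂ =>
      a (n + 1) * ((2 * Real.pi * Complex.I * ((n : ℂ) + 1)) ^ (j + 1))⁻¹ *
      Complex.exp (2 * Real.pi * Complex.I * ((n : ℂ) + 1) * w)) {w : ℂ | z.im / 2 < w.im} := by
    intro n
    fun_prop
  have h1 := Complex.hasSum_deriv_of_summable_norm hs hd hU hle hzU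
  have h2 := Complex.differentiableOn_tsum_of_summable_norm hs hd hU hle
  have h3 := (h2.differentiableAt (hU.mem_nhds hzU)).hasDerivAt
  rw [← h1.tsum_eq] at h3
  have h4 : eichE a j z = ∑' n : ℕ, deriv (fun w : ℂ =>
      a (n + 1) * ((2 * Real.pi * Complex.I * ((n : ℂ) + 1)) ^ (j + 1))⁻¹ *
      Complex.exp (2 * Real.pi * Complex.I * ((n : ℂ) + 1) * w)) z := by
    unfold eichE
    congr 1
    ext n
    have hne : (2 * Real.pi * Complex.I * ((n : ℂ) + 1)) ≠ 0 := by
      have : (n : ℂ) + 1 ≠ 0 := by exact_mod_cast n.succ_ne_zero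
      simp [Real.pi_ne_zero, this]
    generalize (2 * Real.pi * Complex.I * ((n : ℂ) + 1)) = c at hne
    have : HasDerivAt (fun w : ℂ => a (n + 1) * (c ^ (j + 1))⁻¹ * Complex.exp (c * w))
        (a (n + 1) * (c ^ (j + 1))⁻¹ * (Complex.exp (c * z) * (c * 1))) z :=
      (((hasDerivAt_id z).const_mul c).cexp).const_mul _
    rw [this.deriv]
    field_simp
    ring
  rw [h4]
  exact h3

lemma eich_decay {k : ℕ} {a : ℕ → ℂ} {Cb : ℝ}
    (hb : ∀ n : ℕ, ‖a (n + 1)‖ ≤ Cb * ((n + 1 : ℕ) : ℝ) ^ k) (j : ℕ) :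
    ∃ K : ℝ, 0 ≤ K ∧ ∀ z : ℂ, 1 ≤ z.im → ‖eichE a j z‖ ≤ K * Real.exp (-z.im) := by
  have hC : 0 ≤ Cb := by
    have := (norm_nonneg _).trans (hb 0)
    simpa using this
  have hs := eich_summable k 1 one_pos Cb
  refine ⟨∑' n : ℕ, Cb * ((n + 1 : ℕ) : ℝ) ^ k * Real.exp (-1 * ((n : ℝ) + 1)),
    tsum_nonneg fun n => by positivity, fun z hz => ?_⟩
  rw [← tsum_mul_right]
  refine tsum_of_norm_bounded (hs.mul_right _).hasSum fun n => ?_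
  refine (eich_term_le hb j n z).trans ?_
  rw [mul_assoc (Cb * _), ← Real.exp_add]
  gcongr
  have := Real.pi_gt_three
  have hn : (0:ℝ) ≤ n := n.cast_nonneg
  have h1 : z.im * (n + 1) ≥ n + 1 := by nlinarith
  have h2 : z.im * (n + 1) ≥ z.im := by nlinarith
  have h3 : Real.pi * (z.im * (n + 1)) ≥ 1 * (z.im * (n + 1)) := by
    apply mul_le_mul_of_nonneg_right <;> nlinarith
  nlinarith

lemma eich_norm_line (w : ℂ) (t : ℝ) (ht : 1 ≤ t) (p : ℕ) :
    ‖(w + t * Complex.I) ^ p‖ ≤ (‖w‖ + 1) ^ p * t ^ p := by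
  rw [norm_pow, ← mul_pow]
  gcongr
  refine (norm_add_le _ _).trans ?_
  simp only [norm_mul, Complex.norm_I, Complex.norm_real, Real.norm_eq_abs]
  rw [abs_of_pos (by linarith)]
  nlinarith [norm_nonneg w]

lemma eich_tendsto {k : ℕ} {a : ℕ → ℂ} {Cb : ℝ}
    (hb : ∀ n : ℕ, ‖a (n + 1)‖ ≤ Cb * ((n + 1 : ℕ) : ℝ) ^ k) (j p : ℕ) (x : ℝ) (X : ℂ) :
    Filter.Tendsto (fun t : ℝ => ((x : ℂ) + t * Complex.I - X) ^ p *
      eichE a j ((x : ℂ) + t * Complex.I)) Filter.atTop (nhds 0) := by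
  obtain ⟨K, hK, h⟩ := eich_decay hb j
  have h1 := (Real.tendsto_pow_mul_exp_neg_atTop_nhds_zero p).const_mul ((‖(x : ℂ) - X‖ + 1) ^ p * K)
  rw [mul_zero] at h1
  refine squeeze_zero_norm' ?_ h1
  filter_upwards [Filter.eventually_ge_atTop 1] with t ht
  rw [norm_mul]
  have h2 := h ((x : ℂ) + t * Complex.I) (by simpa using ht)
  have h3 : ((x : ℂ) + t * Complex.I).im = t := by simp
  rw [h3] at h2
  have h4 := eich_norm_line ((x : ℂ) - X) t ht p
  rw [show (x : ℂ) + t * Complex.I - X = (x : ℂ) - X + t * Complex.I by ring]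
  calc _ ≤ ((‖(x : ℂ) - X‖ + 1) ^ p * t ^ p) * (K * Real.exp (-t)) := by gcongr
    _ = _ := by ring

lemma eichP_tendsto {k : ℕ} {a : ℕ → ℂ} {Cb : ℝ}
    (hb : ∀ n : ℕ, ‖a (n + 1)‖ ≤ Cb * ((n + 1 : ℕ) : ℝ) ^ k) (x : ℝ) (X : ℂ) (m : ℕ) : ∀ j : ℕ,
    Filter.Tendsto (fun t : ℝ => eichP a X m j ((x : ℂ) + t * Complex.I))
      Filter.atTop (nhds 0) := by
  induction m with
  | zero =>
    intro j
    simpa [eichP] using eich_tendsto hb (j + 1) 0 x X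
  | succ m ih =>
    intro j
    simpa [eichP] using (eich_tendsto hb (j + 1) (m + 1) x X).sub ((ih (j + 1)).const_mul ((m : ℂ) + 1))

lemma eichP_deriv {k : ℕ} {a : ℕ → ℂ} {Cb : ℝ}
    (hb : ∀ n : ℕ, ‖a (n + 1)‖ ≤ Cb * ((n + 1 : ℕ) : ℝ) ^ k) (X : ℂ) (m : ℕ) :
    ∀ (j : ℕ) (z : ℂ), 0 < z.im →
    HasDerivAt (eichP a X m j) ((z - X) ^ m * eichE a j z) z := by
  induction m with
  | zero =>
    intro j z hz
    simpa [eichP] using eich_deriv hb j z hz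
  | succ m ih =>
    intro j z hz
    have h := ((((hasDerivAt_id z).sub_const X).pow (m + 1)).mul (eich_deriv hb j z hz)).sub
      ((ih (j + 1) z hz).const_mul ((m : ℂ) + 1))
    have h' : HasDerivAt (eichP a X (m + 1) j) _ z := h
    convert h' using 1
    simp
    ring

lemma eichP_self (a : ℕ → ℂ) (X : ℂ) (m : ℕ) : ∀ j : ℕ,
    eichP a X m j X = (-1) ^ m * (m.factorial : ℂ) * eichE a (j + m + 1) X := by
  induction m with
  | zero => intro j; simp [eichP]
  | succ m ih =>
    intro j
    simp only [eichP, ih, sub_self, Nat.factorial_succ]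
    rw [show j + 1 + m + 1 = j + (m + 1) + 1 by ring]
    push_cast
    ring

lemma eich_tilde (a : ℕ → ℂ) (m : ℕ) (z : ℂ) :
    (∑' n : ℕ, a (n + 1) * ((n + 1 : ℕ) : ℂ) ^ ((1 : ℤ) - (m + 2 : ℕ)) *
          Complex.exp (2 * Real.pi * Complex.I * ((n : ℂ) + 1) * z))
    = (2 * Real.pi * Complex.I) ^ (m + 1) * eichE a (m + 1) z := by
  unfold eichE
  rw [← tsum_mul_left]
  congr 1
  ext n
  have h0 : (2 * Real.pi * Complex.I : ℂ) ≠ 0 := by simp [Real.pi_ne_zero]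
  have : (n : ℂ) + 1 ≠ 0 := by exact_mod_cast n.succ_ne_zero
  rw [show (1 : ℤ) - (m + 2 : ℕ) = -((m + 1 : ℕ) : ℤ) by push_cast; ring, zpow_neg, zpow_natCast,
    mul_pow _ ((n : ℂ) + 1)]
  generalize (2 * Real.pi * Complex.I : ℂ) = c at *
  push_cast
  field_simp

lemma eich_den_ne (C D : ℤ) (hC : 0 < C) (z : ℂ) (hz : 0 < z.im) : (C : ℂ) * z + D ≠ 0 := by
  intro h
  have := congrArg Complex.im h
  have hC' : (0:ℝ) < C := by exact_mod_cast hC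
  simp at this
  rcases this with h | h
  · omega
  · linarith

lemma eich_im_pos (A B C D : ℤ) (hdet : A * D - B * C = 1) (hC : 0 < C) (z : ℂ) (hz : 0 < z.im) :
    0 < (((A : ℂ) * z + B) / ((C : ℂ) * z + D)).im := by
  have hne := eich_den_ne C D hC z hz
  have hpos := Complex.normSq_pos.2 hne
  have hd : (A : ℝ) * D - B * C = 1 := by exact_mod_cast hdet
  rw [Complex.div_im, ← sub_div]
  apply div_pos _ hpos
  have : z.im = z.im * ((A : ℝ) * D - B * C) := by rw [hd, mul_one]
  simp
  nlinarith

lemma eich_integrable (m : ℕ) (f : ℂ → ℂ) (hf_hol : DifferentiableOn ℂ f {z : ℂ | 0 < z.im})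
    (hf_cusp : ∀ r : ℚ, ∃ δ > (0:ℝ), ∃ M : ℝ, ∀ t : ℝ, 0 < t → t ≤ 1 →
      ‖f ((r : ℂ) + t * Complex.I)‖ ≤ M * Real.exp (-δ / t))
    (hf_inf : ∃ δ > (0:ℝ), ∃ M : ℝ, ∀ z : ℂ, 1 ≤ z.im →
      ‖f z‖ ≤ M * Real.exp (-δ * z.im)) (r : ℚ) (z : ℂ) :
    IntegrableOn (fun t : ℝ => f ((r : ℂ) + t * Complex.I) *
          (((r : ℂ) + t * Complex.I) - z) ^ m) (Ioi 0) := by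
  have hcont : ContinuousOn (fun t : ℝ => f ((r : ℂ) + t * Complex.I) *
          (((r : ℂ) + t * Complex.I) - z) ^ m) (Ioi 0) := by
    apply ContinuousOn.mul
    · refine hf_hol.continuousOn.comp (by fun_prop) ?_
      intro t ht
      simpa using ht
    · fun_prop
  have hmeas := hcont.aestronglyMeasurable (μ := volume) measurableSet_Ioi
  obtain ⟨δ, hδ, M, hM⟩ := hf_cusp r
  obtain ⟨δ', hδ', M', hM'⟩ := hf_inf
  have hi := integrableOn_rpow_mul_exp_neg_mul_rpow (p := 1) (s := m) (b := δ')
    (by have : (0:ℝ) ≤ m := m.cast_nonneg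
        linarith) one_pos hδ'
  rw [← Ioc_union_Ioi_eq_Ioi (zero_le_one (α := ℝ))]
  apply IntegrableOn.union
  · refine Integrable.mono' (g := fun _ => |M| * (‖(r : ℂ) - z‖ + 1) ^ m) ?_
      (hmeas.mono_measure (Measure.restrict_mono Ioc_subset_Ioi_self le_rfl)) ?_
    · exact integrableOn_const (by simp)
    · filter_upwards [ae_restrict_mem measurableSet_Ioc] with t ht
      rw [norm_mul, norm_pow]
      have h1 := hM t ht.1 ht.2
      have h2 : Real.exp (-δ / t) ≤ 1 := by
        rw [Real.exp_le_one_iff]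
        exact div_nonpos_of_nonpos_of_nonneg (by linarith) ht.1.le
      have h3 : M * Real.exp (-δ / t) ≤ |M| * 1 :=
        mul_le_mul (le_abs_self M) h2 (Real.exp_pos _).le (abs_nonneg _)
      have h4 : ‖(r : ℂ) + t * Complex.I - z‖ ≤ ‖(r : ℂ) - z‖ + 1 := by
        rw [show (r : ℂ) + t * Complex.I - z = (r : ℂ) - z + t * Complex.I by ring]
        refine (norm_add_le _ _).trans ?_
        simp only [norm_mul, Complex.norm_I, Complex.norm_real, Real.norm_eq_abs]
        rw [abs_of_pos ht.1]
        linarith [ht.2]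
      have h5 : ‖f ((r : ℂ) + t * Complex.I)‖ ≤ |M| := by linarith
      gcongr
  · refine Integrable.mono' ((hi.mono_set (Ioi_subset_Ioi zero_le_one)).const_mul
      (|M'| * (‖(r : ℂ) - z‖ + 1) ^ m))
      (hmeas.mono_measure (Measure.restrict_mono (Ioi_subset_Ioi zero_le_one) le_rfl)) ?_
    filter_upwards [ae_restrict_mem measurableSet_Ioi] with t ht
    have ht1 : 1 ≤ t := le_of_lt ht
    rw [norm_mul, Real.rpow_natCast, Real.rpow_one]
    have h1 := hM' ((r : ℂ) + t * Complex.I) (by simpa using ht1)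
    have h3 : ((r : ℂ) + t * Complex.I).im = t := by simp
    rw [h3] at h1
    have h4 := eich_norm_line ((r : ℂ) - z) t ht1 m
    rw [show (r : ℂ) + t * Complex.I - z = (r : ℂ) - z + t * Complex.I by ring]
    have h5 : M' * Real.exp (-δ' * t) ≤ |M'| * Real.exp (-δ' * t) := by
      gcongr
      exact le_abs_self _
    calc _ ≤ (|M'| * Real.exp (-δ' * t)) * ((‖(r : ℂ) - z‖ + 1) ^ m * t ^ m) := by
          gcongr
          exact h1.trans h5
      _ = _ := by ring

/-- integral representation of the modular obstruction of the
Eichler integral of an integer weight `k ≥ 2` cusp form `f` for `Γ₀(N)`.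
For `γ = (a b; c d) ∈ Γ₀(N)` with `c > 0` and `z ∈ ℍ`,
`f̃(z) − (cz+d)^{k−2} f̃(γz)
  = ((−2πi)^{k−1}/(k−2)!) · i · ∫₀^∞ f(−d/c + it)((−d/c + it) − z)^{k−2} dt`,
the integral converging absolutely. -/
theorem statement10 (N k : ℕ) (hk : 2 ≤ k) (f : ℂ → ℂ) (a : ℕ → ℂ)
    (hf_hol : DifferentiableOn ℂ f {z : ℂ | 0 < z.im})
    (hf_mod : ∀ A B C D : ℤ, A * D - B * C = 1 → (N : ℤ) ∣ C →
      ∀ z : ℂ, 0 < z.im →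
        f (((A : ℂ) * z + B) / ((C : ℂ) * z + D)) = ((C : ℂ) * z + D) ^ k * f z)
    (hf_four : ∀ z : ℂ, 0 < z.im →
      f z = ∑' n : ℕ, a (n + 1) *
        Complex.exp (2 * Real.pi * Complex.I * ((n : ℂ) + 1) * z))
    (Cb : ℝ) (hbound : ∀ n : ℕ, ‖a (n + 1)‖ ≤ Cb * ((n + 1 : ℕ) : ℝ) ^ k)
    (hf_cusp : ∀ r : ℚ, ∃ δ > (0:ℝ), ∃ M : ℝ, ∀ t : ℝ, 0 < t → t ≤ 1 →
      ‖f ((r : ℂ) + t * Complex.I)‖ ≤ M * Real.exp (-δ / t))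
    (hf_inf : ∃ δ > (0:ℝ), ∃ M : ℝ, ∀ z : ℂ, 1 ≤ z.im →
      ‖f z‖ ≤ M * Real.exp (-δ * z.im))
    (A B C D : ℤ) (hdet : A * D - B * C = 1) (hNC : (N : ℤ) ∣ C) (hC : 0 < C) :
    ∀ z : ℂ, 0 < z.im →
      IntegrableOn
        (fun t : ℝ => f (-(D : ℂ) / (C : ℂ) + t * Complex.I) *
          ((-(D : ℂ) / (C : ℂ) + t * Complex.I) - z) ^ (k - 2)) (Ioi 0) ∧
      (∑' n : ℕ, a (n + 1) * ((n + 1 : ℕ) : ℂ) ^ ((1 : ℤ) - k) *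
          Complex.exp (2 * Real.pi * Complex.I * ((n : ℂ) + 1) * z)) -
        ((C : ℂ) * z + D) ^ (k - 2) *
          (∑' n : ℕ, a (n + 1) * ((n + 1 : ℕ) : ℂ) ^ ((1 : ℤ) - k) *
            Complex.exp (2 * Real.pi * Complex.I * ((n : ℂ) + 1) *
              (((A : ℂ) * z + B) / ((C : ℂ) * z + D)))) =
      ((-(2 * (Real.pi : ℂ) * Complex.I)) ^ (k - 1) / ((k - 2).factorial : ℂ)) *
        Complex.I *
        ∫ t in Ioi (0:ℝ), f (-(D : ℂ) / (C : ℂ) + t * Complex.I) *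
          ((-(D : ℂ) / (C : ℂ) + t * Complex.I) - z) ^ (k - 2) := by
  intro z hz
  obtain ⟨m, rfl⟩ : ∃ m, k = m + 2 := ⟨k - 2, by omega⟩
  have hC0 : (C : ℂ) ≠ 0 := by exact_mod_cast hC.ne'
  have hCR : (0:ℝ) < C := by exact_mod_cast hC
  have hdC : (A : ℂ) * D - B * C = 1 := by exact_mod_cast hdet
  have hr : -(D : ℂ) / (C : ℂ) = (((-D / C : ℚ)) : ℂ) := by push_cast; rfl
  have hrR : -(D : ℂ) / (C : ℂ) = (((-D / C : ℝ)) : ℂ) := by push_cast; rfl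
  have hint : IntegrableOn
        (fun t : ℝ => f (-(D : ℂ) / (C : ℂ) + t * Complex.I) *
          ((-(D : ℂ) / (C : ℂ) + t * Complex.I) - z) ^ m) (Ioi 0) := by
    rw [hr]
    exact eich_integrable m f hf_hol hf_cusp hf_inf (-D / C : ℚ) z
  simp only [show m + 2 - 2 = m by omega, show m + 2 - 1 = m + 1 by omega]
  refine ⟨hint, ?_⟩
  rw [eich_tilde, eich_tilde]
  have hE0 : ∀ w : ℂ, 0 < w.im → eichE a 0 w = f w := by
    intro w hw
    rw [hf_four w hw]
    simp [eichE]
  set g : ℂ → ℂ := fun w => ((A : ℂ) * w + B) / ((C : ℂ) * w + D) with hg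
  have hgim : ∀ w : ℂ, 0 < w.im → 0 < (g w).im := fun w hw => eich_im_pos A B C D hdet hC w hw
  have hne : ∀ w : ℂ, 0 < w.im → (C : ℂ) * w + D ≠ 0 := fun w hw => eich_den_ne C D hC w hw
  have hgd : ∀ w : ℂ, 0 < w.im → HasDerivAt g (1 / ((C : ℂ) * w + D) ^ 2) w := by
    intro w hw
    have h := ((((hasDerivAt_id w).const_mul (A : ℂ)).add_const (B : ℂ))).div
      ((((hasDerivAt_id w).const_mul (C : ℂ)).add_const (D : ℂ))) (hne w hw)
    have h' : HasDerivAt g _ w := h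
    convert h' using 1
    simp only [id]
    congr 1
    linear_combination -hdC
  -- the difference of the two primitives is constant
  set Φ : ℂ → ℂ := eichP a z m 0 with hΦ
  set Ψ : ℂ → ℂ := fun w => ((C : ℂ) * z + D) ^ m * eichP a (g z) m 0 (g w) with hΨ
  have hΦd : ∀ w : ℂ, 0 < w.im → HasDerivAt Φ (f w * (w - z) ^ m) w := by
    intro w hw
    have := eichP_deriv hbound z m 0 w hw
    rw [hE0 w hw, mul_comm] at this
    exact this
  have hΨd : ∀ w : ℂ, 0 < w.im → HasDerivAt Ψ (f w * (w - z) ^ m) w := by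
    intro w hw
    have h1 := eichP_deriv hbound (g z) m 0 (g w) (hgim w hw)
    rw [hE0 _ (hgim w hw)] at h1
    have h2 := (h1.comp w (hgd w hw)).const_mul (((C : ℂ) * z + D) ^ m)
    have h' : HasDerivAt Ψ _ w := h2
    convert h' using 1
    have h3 : f (g w) = _ := hf_mod A B C D hdet hNC w hw
    have h4 : g w - g z = (w - z) / (((C : ℂ) * w + D) * ((C : ℂ) * z + D)) := by
      simp only [hg]
      have a1 := hne w hw
      have a2 := hne z hz
      rw [div_sub_div _ _ a1 a2]
      congr 1
      linear_combination (w - z) * hdC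
    rw [h3, h4, div_pow, mul_pow]
    have a1 := hne w hw
    have a2 := hne z hz
    generalize (C : ℂ) * w + D = p at *
    generalize (C : ℂ) * z + D = q at *
    field_simp
    ring
  have hconst : ∀ w : ℂ, 0 < w.im → Φ w - Ψ w = Φ z - Ψ z := by
    intro w hw
    have hU : IsOpen {w : ℂ | 0 < w.im} := isOpen_lt continuous_const Complex.continuous_im
    have hd : ∀ v ∈ {w : ℂ | 0 < w.im}, HasDerivAt (fun w => Φ w - Ψ w) 0 v := by
      intro v hv
      have h := (hΦd v hv).sub (hΨd v hv)
      rw [sub_self] at h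
      exact h
    exact hU.is_const_of_deriv_eq_zero (convex_halfSpace_im_gt 0).isPreconnected
      (fun v hv => (hd v hv).differentiableAt.differentiableWithinAt)
      (fun v hv => (hd v hv).deriv) hw hz
  set L : ℂ := Φ z - Ψ z with hL
  set ℓ : ℝ → ℂ := fun t => -(D : ℂ) / (C : ℂ) + t * Complex.I with hℓ
  have hℓim : ∀ t : ℝ, (ℓ t).im = t := by
    intro t
    simp only [hℓ]
    rw [hrR]
    simp
  have htop : Filter.Tendsto (fun t : ℝ => Φ (ℓ t)) Filter.atTop (nhds 0) := by
    simp only [hℓ]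
    rw [hrR]
    exact eichP_tendsto hbound _ z m 0
  have hgl : ∀ t : ℝ, 0 < t → g (ℓ t) = ((A / C : ℝ) : ℂ) + (((C : ℝ) ^ 2 * t)⁻¹ : ℝ) * Complex.I := by
    intro t ht
    have ht' : (t : ℂ) ≠ 0 := by exact_mod_cast ht.ne'
    simp only [hg, hℓ]
    have h1 : (C : ℂ) * (-(D : ℂ) / C + t * Complex.I) + D = C * t * Complex.I := by
      field_simp
      ring
    rw [h1]
    have hI := Complex.I_sq
    push_cast
    field_simp
    linear_combination -hdC - hI
  have hbot : Filter.Tendsto (fun t : ℝ => Ψ (ℓ t)) (nhdsWithin 0 (Ioi 0)) (nhds 0) := by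
    have h1 : Filter.Tendsto (fun t : ℝ => ((C : ℝ) ^ 2 * t)⁻¹) (nhdsWithin 0 (Ioi 0)) Filter.atTop := by
      have := (tendsto_inv_nhdsGT_zero (𝕜 := ℝ)).const_mul_atTop (r := ((C : ℝ) ^ 2)⁻¹) (by positivity)
      refine this.congr fun t => ?_
      rw [mul_inv]
    have h2 := ((eichP_tendsto hbound (A / C : ℝ) (g z) m 0).comp h1).const_mul (((C : ℂ) * z + D) ^ m)
    rw [mul_zero] at h2
    refine h2.congr' ?_
    filter_upwards [self_mem_nhdsWithin] with t ht
    simp only [hΨ, Function.comp]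
    rw [hgl t ht]
  have hbot' : Filter.Tendsto (fun t : ℝ => Φ (ℓ t)) (nhdsWithin 0 (Ioi 0)) (nhds L) := by
    have h2 := hbot.add_const L
    rw [zero_add] at h2
    refine h2.congr' ?_
    filter_upwards [self_mem_nhdsWithin] with t ht
    have := hconst (ℓ t) (by rw [hℓim]; exact ht)
    linear_combination -this
  have hℓd : ∀ t : ℝ, HasDerivAt ℓ Complex.I t := by
    intro t
    have := ((Complex.ofRealCLM.hasDerivAt (x := t)).mul_const Complex.I).const_add (-(D : ℂ) / (C : ℂ))
    have h' : HasDerivAt ℓ (((1 : ℝ) : ℂ) * Complex.I) t := this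
    simpa using h'
  have hFTC : ∫ t in Ioi (0:ℝ), (f (ℓ t) * (ℓ t - z) ^ m) * Complex.I = 0 - L := by
    have h := integral_Ioi_of_hasDerivAt_of_tendsto (a := (0:ℝ)) (m := (0:ℂ))
      (f := Function.update (fun t : ℝ => Φ (ℓ t)) 0 L)
      (f' := fun t => (f (ℓ t) * (ℓ t - z) ^ m) * Complex.I) ?_ ?_ (hint.mul_const _) ?_
    · rw [h, Function.update_self]
    · rw [continuousWithinAt_update_same]
      rw [Ici_sdiff_left]
      exact hbot'
    · intro t ht
      have h1 : HasDerivAt (fun t : ℝ => Φ (ℓ t)) ((f (ℓ t) * (ℓ t - z) ^ m) * Complex.I) t :=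
        (hΦd (ℓ t) (by rw [hℓim]; exact ht)).comp t (hℓd t)
      refine h1.congr_of_eventuallyEq ?_
      filter_upwards [Ioi_mem_nhds ht] with s hs
      exact Function.update_of_ne (ne_of_gt hs) _ _
    · refine htop.congr' ?_
      filter_upwards [Filter.eventually_gt_atTop 0] with s hs
      exact (Function.update_of_ne (ne_of_gt hs) L (fun t : ℝ => Φ (ℓ t))).symm
  rw [integral_mul_const] at hFTC
  have hLval : L = (-1) ^ m * (m.factorial : ℂ) *
      (eichE a (m + 1) z - ((C : ℂ) * z + D) ^ m * eichE a (m + 1) (g z)) := by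
    simp only [hL, hΦ, hΨ, eichP_self, zero_add]
    ring
  have hfac : (m.factorial : ℂ) ≠ 0 := by exact_mod_cast m.factorial_ne_zero
  have hgz : ((A : ℂ) * z + B) / ((C : ℂ) * z + D) = g z := rfl
  have hsq : ((-1 : ℂ) ^ m) * (-1) ^ m = 1 := by rw [← mul_pow]; simp
  rw [hLval] at hFTC
  rw [hgz]
  rw [mul_assoc _ Complex.I, mul_comm Complex.I, hFTC, neg_pow (2 * (Real.pi : ℂ) * Complex.I)]
  generalize (2 * (Real.pi : ℂ) * Complex.I) = c
  field_simp
  rw [pow_succ (-1 : ℂ) m]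
  linear_combination (-c ^ (m + 1) * m.factorial * (eichE a (m + 1) z - ((C : ℂ) * z + D) ^ m * eichE a (m + 1) (g z))) * hsq
end

section
/- Let k ∈ ℕ with k ≥ 2 and let f be a cusp form of weight k for SL₂(ℤ) with Fourier expansion f(z) = ∑_{n≥1} a_n e^{2πinz}; define its Eichler integral f̃(z) = ∑_{n≥1} a_n n^{1−k} e^{2πinz} and the completed L-values Λ(f; ρ) := ∫₀^∞ f(it) t^{ρ−1} dt (the integral converges absolutely for every ρ ∈ ℂ). Then for all z ∈ ℍ, f̃(z) − z^{k−2} f̃(−1/z) = ((−2πi)^{k−1}/(k−2)!) · ∑_{n=0}^{k−2} binom(k−2, n) · i^{n−1} · Λ(f; n+1) · z^n. -/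
open MeasureTheory Set

namespace S11
open Filter Topology

lemma normexp (n : ℕ) (z : ℂ) : ‖Complex.exp (2 * Real.pi * Complex.I * ((n : ℂ) + 1) * z)‖
    = Real.exp (-(2 * Real.pi * z.im) * ((n + 1 : ℕ) : ℝ)) := by
  rw [Complex.norm_exp]
  congr 1
  simp [Complex.mul_re, Complex.mul_im]
  ring

lemma summ (k : ℕ) (a : ℕ → ℂ) (Cb : ℝ)
    (hbound : ∀ n : ℕ, ‖a (n + 1)‖ ≤ Cb * ((n + 1 : ℕ) : ℝ) ^ k) {y : ℝ} (hy : 0 < y) :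
    Summable fun n : ℕ => ‖a (n + 1)‖ * Real.exp (-(2 * Real.pi * y) * ((n + 1 : ℕ) : ℝ)) := by
  have h := (summable_nat_add_iff 1).2 (Real.summable_pow_mul_exp_neg_nat_mul k
    (show 0 < 2 * Real.pi * y by positivity))
  refine Summable.of_nonneg_of_le (fun n => by positivity) (fun n => ?_) (h.mul_left Cb)
  rw [← mul_assoc]
  exact mul_le_mul_of_nonneg_right (hbound n) (Real.exp_pos _).le

lemma norm_cast_zpow (n m : ℕ) : ‖((n + 1 : ℕ) : ℂ) ^ ((1 : ℤ) - (m + 2 : ℕ))‖ ≤ 1 := by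
  have : ((1 : ℤ) - (m + 2 : ℕ)) = -((m + 1 : ℕ) : ℤ) := by push_cast; ring
  rw [this, zpow_neg, zpow_natCast, norm_inv, norm_pow, Complex.norm_natCast]
  apply inv_le_one_of_one_le₀
  apply one_le_pow₀
  push_cast
  have : (0:ℝ) ≤ n := by positivity
  linarith

noncomputable def E (a : ℕ → ℂ) (m : ℕ) (z : ℂ) : ℂ :=
  ∑' n : ℕ, a (n + 1) * ((n + 1 : ℕ) : ℂ) ^ ((1 : ℤ) - (m + 2 : ℕ)) *
          Complex.exp (2 * Real.pi * Complex.I * ((n : ℂ) + 1) * z)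

lemma E_diff (m : ℕ) (a : ℕ → ℂ) (Cb : ℝ)
    (hbound : ∀ n : ℕ, ‖a (n + 1)‖ ≤ Cb * ((n + 1 : ℕ) : ℝ) ^ (m + 2)) :
    DifferentiableOn ℂ (E a m) {z : ℂ | 0 < z.im} := by
  intro z hz
  have hz' : 0 < z.im / 2 := half_pos hz
  have ho : IsOpen {w : ℂ | z.im / 2 < w.im} := isOpen_lt continuous_const Complex.continuous_im
  have : DifferentiableOn ℂ (E a m) {w : ℂ | z.im / 2 < w.im} := by
    refine Complex.differentiableOn_tsum_of_summable_norm (summ (m + 2) a Cb hbound hz')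
      (fun n => ?_) ho ?_
    · apply Differentiable.differentiableOn
      fun_prop
    · intro n w hw
      rw [norm_mul, norm_mul, normexp]
      have h1 := norm_cast_zpow n m
      have h2 : Real.exp (-(2 * Real.pi * w.im) * ((n + 1 : ℕ) : ℝ)) ≤
          Real.exp (-(2 * Real.pi * (z.im / 2)) * ((n + 1 : ℕ) : ℝ)) := by
        have hw' : z.im / 2 ≤ w.im := le_of_lt hw
        gcongr
      calc _ ≤ ‖a (n + 1)‖ * 1 * Real.exp (-(2 * Real.pi * (z.im / 2)) * ((n + 1 : ℕ) : ℝ)) := by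
            gcongr
        _ = _ := by ring
  exact (this.differentiableAt (ho.mem_nhds (half_lt_self (show 0 < z.im from hz)))).differentiableWithinAt

lemma shift (g : ℝ → ℂ) (y : ℝ) : ∫ t in Ioi (0:ℝ), g (t + y) = ∫ t in Ioi y, g t := by
  rw [← integral_indicator measurableSet_Ioi, ← integral_indicator measurableSet_Ioi,
    ← integral_add_right_eq_self ((Ioi y).indicator fun t => g t) y]
  congr 1
  ext t
  simp [indicator]

lemma E_int (m : ℕ) (f : ℂ → ℂ) (a : ℕ → ℂ)
    (hf_four : ∀ z : ℂ, 0 < z.im →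
      f z = ∑' n : ℕ, a (n + 1) *
        Complex.exp (2 * Real.pi * Complex.I * ((n : ℂ) + 1) * z))
    (Cb : ℝ) (hbound : ∀ n : ℕ, ‖a (n + 1)‖ ≤ Cb * ((n + 1 : ℕ) : ℝ) ^ (m + 2))
    {y : ℝ} (hy : 0 < y) :
    E a m (y * Complex.I) = ((2 * Real.pi : ℂ) ^ (m + 1) / (m.factorial : ℂ)) *
      ∫ t in Ioi y, f (t * Complex.I) * ((t : ℂ) - y) ^ m := by
  have key := hasSum_mellin (ι := ℕ)
    (a := fun n => a (n + 1) * Complex.exp (2 * Real.pi * Complex.I * ((n : ℂ) + 1) * (y * Complex.I)))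
    (p := fun n => 2 * Real.pi * ((n + 1 : ℕ) : ℝ))
    (F := fun t => f (((t + y : ℝ) : ℂ) * Complex.I)) (s := (m : ℂ) + 1)
    (fun n => Or.inr (by positivity))
    (by simp; positivity)
    (by
      intro t ht
      have ht : 0 < t := ht
      have hs : Summable fun n : ℕ => a (n + 1) *
        Complex.exp (2 * Real.pi * Complex.I * ((n : ℂ) + 1) * (((t + y : ℝ) : ℂ) * Complex.I)) := by
        apply Summable.of_norm
        simp_rw [norm_mul, normexp]
        simpa using summ _ a Cb hbound (add_pos ht hy)
      have := hs.hasSum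
      rw [← hf_four _ (by simpa using add_pos ht hy)] at this
      convert this using 2 with n
      rw [mul_assoc, Complex.ofReal_exp, ← Complex.exp_add]
      congr 2
      push_cast
      linear_combination (-2 * Real.pi * (n + 1) * t : ℂ) * Complex.I_sq )
    (by
      have := summ _ a Cb hbound hy
      refine Summable.of_nonneg_of_le (fun n => by positivity) (fun n => ?_) this
      rw [norm_mul, normexp]
      simp only [Complex.mul_im, Complex.ofReal_re, Complex.I_im, Complex.ofReal_im, Complex.I_re,
        mul_one, mul_zero, add_zero]
      apply div_le_self (by positivity)
      apply Real.one_le_rpow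
      · have := Real.pi_gt_three
        have : (0:ℝ) ≤ n := by positivity
        push_cast
        nlinarith
      · simp; positivity)
  have hm : mellin (fun t : ℝ => f (((t + y : ℝ) : ℂ) * Complex.I)) ((m : ℂ) + 1) =
      ∫ t in Ioi y, f (t * Complex.I) * ((t : ℂ) - y) ^ m := by
    rw [← shift]
    refine setIntegral_congr_fun measurableSet_Ioi fun t ht => ?_
    simp [mul_comm]
  rw [← hm, ← key.tsum_eq, ← tsum_mul_left, E]
  congr 1
  ext n
  rw [Complex.Gamma_nat_eq_factorial]
  have h1 : ((2 * Real.pi * ((n + 1 : ℕ) : ℝ) : ℝ) : ℂ) ^ ((m : ℂ) + 1) =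
      (2 * Real.pi : ℂ) ^ (m + 1) * ((n + 1 : ℕ) : ℂ) ^ (m + 1) := by
    rw [show (m : ℂ) + 1 = ((m + 1 : ℕ) : ℂ) by push_cast; ring, Complex.cpow_natCast, ← mul_pow]
    push_cast; rfl
  rw [h1]
  have : ((1 : ℤ) - (m + 2 : ℕ)) = -((m + 1 : ℕ) : ℤ) := by push_cast; ring
  rw [this, zpow_neg, zpow_natCast]
  have h2 : ((n + 1 : ℕ) : ℂ) ≠ 0 := by exact_mod_cast Nat.succ_ne_zero n
  have h3 : (Real.pi : ℂ) ≠ 0 := by exact_mod_cast Real.pi_ne_zero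
  have h4 : (m.factorial : ℂ) ≠ 0 := by exact_mod_cast m.factorial_ne_zero
  field_simp

lemma inv_sub (g : ℝ → ℂ) : ∫ t in Ioi (0:ℝ), g t = ∫ t in Ioi (0:ℝ), ((t : ℂ) ^ 2)⁻¹ * g (t⁻¹) := by
  rw [← integral_comp_rpow_Ioi g (p := -1) (by norm_num)]
  refine setIntegral_congr_fun measurableSet_Ioi fun t ht => ?_
  have ht : 0 < t := ht
  simp only [abs_neg, abs_one, one_mul, Real.rpow_neg_one, Complex.real_smul]
  congr 1
  rw [show (-1 - 1 : ℝ) = -((2 : ℕ) : ℝ) by norm_num, Real.rpow_neg ht.le, Real.rpow_natCast]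
  push_cast; rfl

lemma feq (k : ℕ) (f : ℂ → ℂ)
    (hf_mod : ∀ A B C D : ℤ, A * D - B * C = 1 →
      ∀ z : ℂ, 0 < z.im →
        f (((A : ℂ) * z + B) / ((C : ℂ) * z + D)) = ((C : ℂ) * z + D) ^ k * f z)
    {t : ℝ} (ht : 0 < t) : f ((t⁻¹ : ℝ) * Complex.I) =
      Complex.I ^ k * (t : ℂ) ^ k * f (t * Complex.I) := by
  have := hf_mod 0 (-1) 1 0 (by norm_num) (t * Complex.I) (by simpa using ht)
  rw [← mul_pow, mul_comm Complex.I, ← (by simpa using this :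
    f (-1 / (t * Complex.I)) = (t * Complex.I) ^ k * f (t * Complex.I))]
  congr 1
  have : (t : ℂ) ≠ 0 := by exact_mod_cast ht.ne'
  push_cast
  field_simp
  simp

lemma fe (k : ℕ) (hk : 2 ≤ k) (f : ℂ → ℂ)
    (hf_hol : DifferentiableOn ℂ f {z : ℂ | 0 < z.im})
    (hf_mod : ∀ A B C D : ℤ, A * D - B * C = 1 →
      ∀ z : ℂ, 0 < z.im →
        f (((A : ℂ) * z + B) / ((C : ℂ) * z + D)) = ((C : ℂ) * z + D) ^ k * f z)
    (hf_inf : ∃ δ > (0:ℝ), ∃ M : ℝ, ∀ z : ℂ, 1 ≤ z.im →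
      ‖f z‖ ≤ M * Real.exp (-δ * z.im)) (s : ℂ) :
    MellinConvergent (fun t : ℝ => f (t * Complex.I)) s ∧
    mellin (fun t : ℝ => f (t * Complex.I)) (k - s) =
      Complex.I ^ k * mellin (fun t : ℝ => f (t * Complex.I)) s := by
  have hint : LocallyIntegrableOn (fun t : ℝ => f (t * Complex.I)) (Ioi 0) := by
    refine ContinuousOn.locallyIntegrableOn ?_ measurableSet_Ioi
    refine hf_hol.continuousOn.comp (by fun_prop) ?_
    intro t ht
    simpa using ht
  have htop (r : ℝ) : (fun t : ℝ => f (t * Complex.I) - 0) =O[atTop] (· ^ r) := by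
    obtain ⟨δ, hδ, M, hM⟩ := hf_inf
    refine Asymptotics.IsBigO.trans ?_ (isLittleO_exp_neg_mul_rpow_atTop hδ r).isBigO
    refine Asymptotics.IsBigO.of_bound M ?_
    filter_upwards [eventually_ge_atTop 1] with t ht
    simpa using hM (t * Complex.I) (by simpa using ht)
  let P : WeakFEPair ℂ :=
    { f := fun t : ℝ => f (t * Complex.I)
      g := fun t : ℝ => f (t * Complex.I)
      k := k
      ε := Complex.I ^ k
      f₀ := 0
      g₀ := 0
      hf_int := hint
      hg_int := hint
      hk := by positivity
      hε := by simp
      h_feq := by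
        intro t ht
        rw [one_div, feq k f hf_mod ht]
        simp
      hf_top := htop
      hg_top := htop }
  have hP : IsStrongFEPair P := ⟨rfl, rfl⟩
  refine ⟨(hP.hasMellin s).1, ?_⟩
  have := P.functional_equation s
  rw [hP.Λ_eq, hP.symm_Λ_eq] at this
  exact this

lemma on_axis (m : ℕ) (f : ℂ → ℂ) (a : ℕ → ℂ)
    (hf_hol : DifferentiableOn ℂ f {z : ℂ | 0 < z.im})
    (hf_mod : ∀ A B C D : ℤ, A * D - B * C = 1 →
      ∀ z : ℂ, 0 < z.im →
        f (((A : ℂ) * z + B) / ((C : ℂ) * z + D)) = ((C : ℂ) * z + D) ^ (m + 2) * f z)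
    (hf_four : ∀ z : ℂ, 0 < z.im →
      f z = ∑' n : ℕ, a (n + 1) *
        Complex.exp (2 * Real.pi * Complex.I * ((n : ℂ) + 1) * z))
    (Cb : ℝ) (hbound : ∀ n : ℕ, ‖a (n + 1)‖ ≤ Cb * ((n + 1 : ℕ) : ℝ) ^ (m + 2))
    (hf_inf : ∃ δ > (0:ℝ), ∃ M : ℝ, ∀ z : ℂ, 1 ≤ z.im →
      ‖f z‖ ≤ M * Real.exp (-δ * z.im)) {y : ℝ} (hy : 0 < y) :
    E a m (y * Complex.I) - (y * Complex.I) ^ m * E a m (-1 / (y * Complex.I)) =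
      ((-(2 * (Real.pi : ℂ) * Complex.I)) ^ (m + 1) / (m.factorial : ℂ)) *
        ∑ n ∈ Finset.range (m + 1),
          (m.choose n : ℂ) * Complex.I ^ ((n : ℤ) - 1) *
            mellin (fun t : ℝ => f (t * Complex.I)) ((n : ℂ) + 1) * (y * Complex.I) ^ n := by
  have hy0 : (y : ℂ) ≠ 0 := by exact_mod_cast hy.ne'
  have hinv : -1 / (y * Complex.I) = ((y⁻¹ : ℝ) : ℂ) * Complex.I := by
    push_cast; field_simp; simp
  rw [hinv, E_int m f a hf_four Cb hbound hy, E_int m f a hf_four Cb hbound (inv_pos.2 hy)]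
  rcases Nat.even_or_odd m with hm | hm
  swap
  · have hz : ∀ t : ℝ, 0 < t → f (t * Complex.I) = 0 := by
      intro t ht
      have := hf_mod (-1) 0 0 (-1) (by norm_num) (t * Complex.I) (by simpa using ht)
      have ho : (-1 : ℂ) ^ (m + 2) = -1 := (hm.add_even even_two).neg_one_pow
      simp [ho] at this
      exact self_eq_neg.1 this
    have h1 : ∀ x : ℝ, 0 < x → ∫ t in Ioi x, f (t * Complex.I) * ((t : ℂ) - x) ^ m = 0 := by
      intro x hx
      rw [setIntegral_congr_fun (g := fun _ => 0) measurableSet_Ioi, integral_zero]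
      intro t ht
      simp [hz t (hx.trans ht)]
    have h2 : ∀ s, mellin (fun t : ℝ => f (t * Complex.I)) s = 0 := by
      intro s
      rw [mellin, setIntegral_congr_fun (g := fun _ => 0) measurableSet_Ioi, integral_zero]
      intro t ht
      simp [hz t ht]
    simp only [h1 y hy, h1 _ (inv_pos.2 hy), h2]
    simp
  have hconv := fun s => (fe (m + 2) (by omega) f hf_hol hf_mod hf_inf s).1
  have hfe := fun s => (fe (m + 2) (by omega) f hf_hol hf_mod hf_inf s).2
  have hcn : ∀ n : ℕ, IntegrableOn (fun t : ℝ => f (t * Complex.I) * (t : ℂ) ^ n) (Ioi 0) := by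
    intro n
    have := hconv (n + 1)
    simp only [MellinConvergent, add_sub_cancel_right, Complex.cpow_natCast, smul_eq_mul] at this
    simpa only [mul_comm] using this
  have hmn : ∀ n : ℕ, mellin (fun t : ℝ => f (t * Complex.I)) (n + 1) =
      ∫ t in Ioi (0:ℝ), f (t * Complex.I) * (t : ℂ) ^ n := by
    intro n
    simp only [mellin, add_sub_cancel_right, Complex.cpow_natCast, smul_eq_mul]
    simp only [mul_comm]
  -- expand
  have hexp : ∀ t : ℝ, f (t * Complex.I) * ((t : ℂ) - y) ^ m =
      ∑ n ∈ Finset.range (m + 1), (m.choose n : ℂ) * (-y : ℂ) ^ n *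
        (f (t * Complex.I) * (t : ℂ) ^ (m - n)) := by
    intro t
    rw [show (t : ℂ) - y = -y + t by ring, add_pow, Finset.mul_sum]
    refine Finset.sum_congr rfl fun n _ => by ring
  have hI : IntegrableOn (fun t : ℝ => f (t * Complex.I) * ((t : ℂ) - y) ^ m) (Ioi 0) := by
    simp_rw [hexp]
    exact integrable_finsetSum _ fun n _ => (hcn (m - n)).const_mul _
  have htot : ∫ t in Ioi (0:ℝ), f (t * Complex.I) * ((t : ℂ) - y) ^ m =
      ∑ n ∈ Finset.range (m + 1), (m.choose n : ℂ) * (-y : ℂ) ^ n *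
        (Complex.I ^ (m + 2) * mellin (fun t : ℝ => f (t * Complex.I)) (n + 1)) := by
    simp_rw [hexp]
    rw [integral_finsetSum _ fun n _ => (hcn (m - n)).const_mul _]
    refine Finset.sum_congr rfl fun n hn => ?_
    rw [integral_const_mul, ← hmn, ← hfe]
    congr 2
    have : n ≤ m := by simpa [Nat.lt_succ_iff] using hn
    push_cast [this]
    ring
  have hsecond : (y * Complex.I) ^ m * ∫ t in Ioi (y⁻¹), f (t * Complex.I) * ((t : ℂ) - (y⁻¹ : ℝ)) ^ m
      = - ∫ t in Ioc 0 y, f (t * Complex.I) * ((t : ℂ) - y) ^ m := by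
    have e1 : ∫ t in Ioi (y⁻¹), f (t * Complex.I) * ((t : ℂ) - (y⁻¹ : ℝ)) ^ m =
        ∫ t in Ioi (0:ℝ), (Ioi (y⁻¹)).indicator
          (fun t : ℝ => f (t * Complex.I) * ((t : ℂ) - (y⁻¹ : ℝ)) ^ m) t := by
      rw [setIntegral_indicator measurableSet_Ioi, inter_eq_right.2 (Ioi_subset_Ioi (inv_pos.2 hy).le)]
    have e2 : ∫ t in Ioc 0 y, f (t * Complex.I) * ((t : ℂ) - y) ^ m =
        ∫ t in Ioi (0:ℝ), (Iio y).indicator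
          (fun t : ℝ => f (t * Complex.I) * ((t : ℂ) - y) ^ m) t := by
      rw [setIntegral_indicator measurableSet_Iio, Ioi_inter_Iio, integral_Ioc_eq_integral_Ioo]
    rw [e1, e2, inv_sub, ← integral_const_mul, ← integral_neg]
    refine setIntegral_congr_fun measurableSet_Ioi fun t ht => ?_
    have ht : 0 < t := ht
    have ht0 : (t : ℂ) ≠ 0 := by exact_mod_cast ht.ne'
    by_cases h : t < y
    · have h' : y⁻¹ < t⁻¹ := (inv_lt_inv₀ hy ht).2 h
      simp only [indicator, mem_Ioi, mem_Iio, h, h', if_true]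
      rw [feq _ f hf_mod ht]
      have hd : ((t⁻¹ : ℝ) : ℂ) - ((y⁻¹ : ℝ) : ℂ) = (y - t) / (t * y) := by
        push_cast; field_simp
      have hp : ((y : ℂ) - t) ^ m = (t - y) ^ m := by
        rw [← neg_sub, hm.neg_pow]
      have hII : Complex.I ^ m * Complex.I ^ m = 1 := by
        obtain ⟨r, rfl⟩ := hm
        rw [← pow_add, show r + r + (r + r) = 4 * r by ring, pow_mul]
        simp
      rw [hd, div_pow, hp, mul_pow, mul_pow, pow_add, Complex.I_sq, pow_add]
      field_simp
      linear_combination (- f (t * Complex.I) * (t - y : ℂ) ^ m) * hII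
    · have h' : ¬ y⁻¹ < t⁻¹ := by rwa [inv_lt_inv₀ hy ht]
      simp [indicator, h, h']
  have hsplit : ∫ t in Ioi (0:ℝ), f (t * Complex.I) * ((t : ℂ) - y) ^ m =
      (∫ t in Ioc 0 y, f (t * Complex.I) * ((t : ℂ) - y) ^ m) +
      ∫ t in Ioi y, f (t * Complex.I) * ((t : ℂ) - y) ^ m := by
    rw [← setIntegral_union Ioc_disjoint_Ioi_same measurableSet_Ioi
      (hI.mono_set Ioc_subset_Ioi_self) (hI.mono_set (Ioi_subset_Ioi hy.le)),
      Ioc_union_Ioi_eq_Ioi hy.le]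
  have hL : ∀ K A B C : ℂ, K * A - C * (K * B) = K * (A - C * B) := by intros; ring
  rw [hL, hsecond, sub_neg_eq_add, add_comm (∫ t in Ioi y, _), ← hsplit, htot, Finset.mul_sum, Finset.mul_sum]
  refine Finset.sum_congr rfl fun n _ => ?_
  rw [neg_pow (2 * (Real.pi : ℂ) * Complex.I), (hm.add_one).neg_one_pow, neg_pow (y : ℂ),
    mul_pow _ Complex.I, mul_pow _ Complex.I, zpow_sub_one₀ Complex.I_ne_zero, zpow_natCast,
    pow_add Complex.I, pow_add Complex.I, Complex.I_sq, pow_one]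
  have hnn : Complex.I ^ n * Complex.I ^ n = (-1) ^ n := by
    rw [← mul_pow, Complex.I_mul_I]
  rw [← hnn]
  generalize mellin (fun t : ℝ => f (t * Complex.I)) ((n : ℂ) + 1) = L
  field_simp
end S11

/-- the period polynomial of the Eichler integral of a level one
cusp form.  For a cusp form `f` of weight `k ≥ 2` for `SL₂(ℤ)` (hypotheses:
holomorphy, modularity for all of `SL₂(ℤ)`, Fourier expansion with polynomially
bounded coefficients, exponential decay at `i∞`), with completed `L`-values
`Λ(f; ρ) = ∫₀^∞ f(it) t^{ρ−1} dt` (absolutely convergent for all `ρ`), one has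
for all `z ∈ ℍ`:
`f̃(z) − z^{k−2} f̃(−1/z)
  = ((−2πi)^{k−1}/(k−2)!) ∑_{n=0}^{k−2} C(k−2,n) i^{n−1} Λ(f; n+1) zⁿ`. -/
theorem statement11 (k : ℕ) (hk : 2 ≤ k) (f : ℂ → ℂ) (a : ℕ → ℂ)
    (hf_hol : DifferentiableOn ℂ f {z : ℂ | 0 < z.im})
    (hf_mod : ∀ A B C D : ℤ, A * D - B * C = 1 →
      ∀ z : ℂ, 0 < z.im →
        f (((A : ℂ) * z + B) / ((C : ℂ) * z + D)) = ((C : ℂ) * z + D) ^ k * f z)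
    (hf_four : ∀ z : ℂ, 0 < z.im →
      f z = ∑' n : ℕ, a (n + 1) *
        Complex.exp (2 * Real.pi * Complex.I * ((n : ℂ) + 1) * z))
    (Cb : ℝ) (hbound : ∀ n : ℕ, ‖a (n + 1)‖ ≤ Cb * ((n + 1 : ℕ) : ℝ) ^ k)
    (hf_inf : ∃ δ > (0:ℝ), ∃ M : ℝ, ∀ z : ℂ, 1 ≤ z.im →
      ‖f z‖ ≤ M * Real.exp (-δ * z.im)) :
    (∀ ρ : ℂ, IntegrableOn
      (fun t : ℝ => f ((t : ℂ) * Complex.I) * (t : ℂ) ^ (ρ - 1)) (Ioi 0)) ∧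
    ∀ z : ℂ, 0 < z.im →
      (∑' n : ℕ, a (n + 1) * ((n + 1 : ℕ) : ℂ) ^ ((1 : ℤ) - k) *
          Complex.exp (2 * Real.pi * Complex.I * ((n : ℂ) + 1) * z)) -
        z ^ (k - 2) *
          (∑' n : ℕ, a (n + 1) * ((n + 1 : ℕ) : ℂ) ^ ((1 : ℤ) - k) *
            Complex.exp (2 * Real.pi * Complex.I * ((n : ℂ) + 1) * (-1 / z))) =
      ((-(2 * (Real.pi : ℂ) * Complex.I)) ^ (k - 1) / ((k - 2).factorial : ℂ)) *
        ∑ n ∈ Finset.range (k - 1),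
          ((k - 2).choose n : ℂ) * Complex.I ^ ((n : ℤ) - 1) *
            (∫ t in Ioi (0:ℝ), f ((t : ℂ) * Complex.I) *
              (t : ℂ) ^ (((n : ℂ) + 1) - 1)) * z ^ n := by
  obtain ⟨m, rfl⟩ : ∃ m, k = m + 2 := ⟨k - 2, by omega⟩
  refine ⟨fun ρ => ?_, ?_⟩
  · have := (S11.fe (m + 2) hk f hf_hol hf_mod hf_inf ρ).1
    simp only [MellinConvergent, smul_eq_mul] at this
    simpa only [mul_comm] using this
  have hE := S11.E_diff m a Cb hbound
  have ho : IsOpen {z : ℂ | 0 < z.im} := isOpen_lt continuous_const Complex.continuous_im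
  have hne : ∀ z ∈ {z : ℂ | 0 < z.im}, z ≠ 0 := by
    rintro z hz rfl
    simp at hz
  set R : ℂ → ℂ := fun z => ((-(2 * (Real.pi : ℂ) * Complex.I)) ^ (m + 1) / (m.factorial : ℂ)) *
        ∑ n ∈ Finset.range (m + 1),
          (m.choose n : ℂ) * Complex.I ^ ((n : ℤ) - 1) *
            mellin (fun t : ℝ => f (t * Complex.I)) ((n : ℂ) + 1) * z ^ n with hR
  have hEq : EqOn (fun z => S11.E a m z - z ^ m * S11.E a m (-1 / z)) R {z : ℂ | 0 < z.im} := by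
    refine AnalyticOnNhd.eqOn_of_preconnected_of_frequently_eq (z₀ := Complex.I)
      (DifferentiableOn.analyticOnNhd ?_ ho) (DifferentiableOn.analyticOnNhd ?_ ho)
      (convex_halfSpace_im_gt 0).isPreconnected (by simp) ?_
    · refine hE.sub ((differentiableOn_pow m).mul (hE.comp ?_ ?_))
      · exact (differentiableOn_const _).div differentiableOn_id hne
      · intro z hz
        have hz' := hz
        simp only [mem_ofPred_eq] at hz' ⊢
        have : 0 < Complex.normSq z := Complex.normSq_pos.2 (hne z hz)
        rw [neg_div, one_div, Complex.neg_im, Complex.inv_im, neg_div, neg_neg]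
        positivity
    · apply Differentiable.differentiableOn
      fun_prop
    · have ht : Filter.Tendsto (fun y : ℝ => (y : ℂ) * Complex.I) (nhdsWithin 1 (Ioi 1))
          (nhdsWithin Complex.I {Complex.I}ᶜ) := by
        refine tendsto_nhdsWithin_iff.2 ⟨?_, ?_⟩
        · have : Continuous (fun y : ℝ => (y : ℂ) * Complex.I) := by fun_prop
          simpa using (this.tendsto 1).mono_left nhdsWithin_le_nhds
        · filter_upwards [self_mem_nhdsWithin] with y hy h
          have : (y : ℂ) * Complex.I = Complex.I := h
          have := congrArg Complex.im this
          simp at this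
          exact (ne_of_gt hy) this
      refine ht.frequently (Filter.Eventually.frequently ?_)
      filter_upwards [self_mem_nhdsWithin] with y hy
      have hy : (1:ℝ) < y := hy
      exact S11.on_axis m f a hf_hol hf_mod hf_four Cb hbound hf_inf (by linarith)
  intro z hz
  have := hEq hz
  simp only [hR, mellin, smul_eq_mul] at this
  simp only [Nat.add_sub_cancel, show m + 2 - 1 = m + 1 from rfl]
  refine Eq.trans this ?_
  congr 1
  refine Finset.sum_congr rfl fun n _ => ?_
  congr 2
  refine integral_congr_ae (Filter.Eventually.of_forall fun t => ?_)
  exact mul_comm _ _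
end
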